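/- Let s ∈ ℂ with Re(s) > −1/2 and let F_∞ be the Fredholm determinant associated with the limiting kernel K_∞ restricted to (0,∞)². Then F_∞(t) ≠ 0 for every t > 0. -/

import Mathlib

noncomputable section

open Complex MeasureTheory Filter Set

/-- Rising Pochhammer symbol `(x)_n = x(x+1)⋯(x+n−1)`. -/
def poch (x : ℂ) (n : ℕ) : ℂ := ∏ i ∈ Finset.range n, (x + i)

/-- Confluent hypergeometric series `₁F₁[r, q; z]`. -/
def oneF1 (r q z : ℂ) : ℂ := ∑' n : ℕ, poch r n / (poch q n * n.factorial) * z ^ n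

/-- Terminating Gauss hypergeometric series `₂F₁[−m, b, c; z]`. -/
def twoF1neg (m : ℕ) (b c z : ℂ) : ℂ :=
  ∑ k ∈ Finset.range (m + 1),
    poch (-(m : ℂ)) k * poch b k / (poch c k * (k.factorial : ℂ)) * z ^ k

/-- The common prefactor `|2/x|^{Re s} e^{−i/x + π Im(s) Sgn(x)/2}`. -/
def prefac (s : ℂ) (x : ℝ) : ℂ :=
  ((|2 / x| ^ s.re : ℝ) : ℂ) *
    Complex.exp (-Complex.I / (x : ℂ) + ((Real.pi * s.im * Real.sign x / 2 : ℝ) : ℂ))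

/-- `P̃(x) = |2/x|^{Re s} e^{−i/x + π Im(s) Sgn(x)/2} ₁F₁[s, 2Re(s)+1; 2i/x]`. -/
def Ptilde (s : ℂ) (x : ℝ) : ℂ :=
  prefac s x * oneF1 s ((2 * s.re + 1 : ℝ) : ℂ) (2 * Complex.I / (x : ℂ))

/-- `Q(x) = (2/x)|2/x|^{Re s} e^{−i/x + π Im(s) Sgn(x)/2} ₁F₁[s+1, 2Re(s)+2; 2i/x]`. -/
def Qfun (s : ℂ) (x : ℝ) : ℂ :=
  (2 / (x : ℂ)) * prefac s x * oneF1 (s + 1) ((2 * s.re + 2 : ℝ) : ℂ) (2 * Complex.I / (x : ℂ))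

/-- The constant in front of the limiting kernel `K_∞`. -/
def cinf (s : ℂ) : ℂ :=
  (1 / (2 * (Real.pi : ℂ))) *
    (Complex.Gamma (s + 1) * Complex.Gamma ((starRingEnd ℂ) s + 1) /
      (Complex.Gamma ((2 * s.re + 1 : ℝ) : ℂ) * Complex.Gamma ((2 * s.re + 2 : ℝ) : ℂ)))

/-- The limiting kernel `K_∞`, as a complex number (it is in fact real). -/
def KinfC (s : ℂ) (x y : ℝ) : ℂ :=
  if x = y then cinf s * (deriv (Ptilde s) x * Qfun s x - deriv (Qfun s) x * Ptilde s x)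
  else cinf s * (Ptilde s x * Qfun s y - Qfun s x * Ptilde s y) / ((x : ℂ) - (y : ℂ))

/-- The limiting kernel `K_∞` (real-valued). -/
def Kinf (s : ℂ) (x y : ℝ) : ℝ := (KinfC s x y).re

/-- The generalized Cauchy weight `w_H` on `ℝ`. -/
def wH (s : ℂ) (N : ℕ) (x : ℝ) : ℝ :=
  (1 + x ^ 2) ^ (-s.re - (N : ℝ)) * Real.exp (2 * s.im * Complex.arg (1 + Complex.I * x))

/-- The polynomial `p_{N−1}`. -/
def pPrev (s : ℂ) (N : ℕ) (x : ℝ) : ℂ :=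
  ((x : ℂ) - Complex.I) ^ (N - 1) *
    twoF1neg (N - 1) (s + 1) ((2 * s.re + 2 : ℝ) : ℂ) (2 / (1 + Complex.I * (x : ℂ)))

/-- The polynomial `p̃_N`. -/
def pTil (s : ℂ) (N : ℕ) (x : ℝ) : ℂ :=
  ((x : ℂ) - Complex.I) ^ N *
    twoF1neg N s ((2 * s.re + 1 : ℝ) : ℂ) (2 / (1 + Complex.I * (x : ℂ)))

/-- The constant `C_{N,s}`. -/
def CNs (s : ℂ) (N : ℕ) : ℂ :=
  (((2 : ℝ) ^ (2 * s.re) / Real.pi : ℝ) : ℂ) *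
    (Complex.Gamma ((2 * s.re + N + 1 : ℝ) : ℂ) * Complex.Gamma (s + 1) *
        Complex.Gamma ((starRingEnd ℂ) s + 1) /
      (Complex.Gamma (N : ℂ) * Complex.Gamma ((2 * s.re + 1 : ℝ) : ℂ) *
        Complex.Gamma ((2 * s.re + 2 : ℝ) : ℂ)))

def phiN (s : ℂ) (N : ℕ) (x : ℝ) : ℂ := pTil s N x * (Real.sqrt (wH s N x) : ℂ)

def psiN (s : ℂ) (N : ℕ) (x : ℝ) : ℂ := pPrev s N x * (Real.sqrt (wH s N x) : ℂ)

/-- The finite-`N` kernel `K_N` (complex form; extended to the diagonal by continuity,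
i.e. by the Bernoulli–l'Hôpital expression). -/
def KNC (s : ℂ) (N : ℕ) (x y : ℝ) : ℂ :=
  if x = y then CNs s N * (deriv (phiN s N) x * psiN s N x - deriv (psiN s N) x * phiN s N x)
  else CNs s N * (phiN s N x * psiN s N y - psiN s N x * phiN s N y) / ((x : ℂ) - (y : ℂ))

/-- The finite-`N` kernel `K_N` (real-valued). -/
def KN (s : ℂ) (N : ℕ) (x y : ℝ) : ℝ := (KNC s N x y).re

/-- The rescaled kernel `K_[N](x,y) = N · K_N(Nx, Ny)`. -/
def Kscaled (s : ℂ) (N : ℕ) (x y : ℝ) : ℝ := N * KN s N (N * x) (N * y)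

/-- `P̃_N`. -/
def PtildeN (s : ℂ) (N : ℕ) (x : ℝ) : ℂ :=
  (((2 : ℝ) ^ s.re : ℝ) : ℂ) *
    (Real.sqrt (Real.Gamma (2 * s.re + N + 1) / (N * Real.Gamma N)) : ℂ) *
    pTil s N (N * x) * (Real.sqrt (wH s N (N * x)) : ℂ)

/-- `Q_N`. -/
def QN (s : ℂ) (N : ℕ) (x : ℝ) : ℂ :=
  (((2 : ℝ) ^ (s.re + 1) : ℝ) : ℂ) *
    (Real.sqrt (N * Real.Gamma (2 * s.re + N + 1) / Real.Gamma N) : ℂ) *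
    pPrev s N (N * x) * (Real.sqrt (wH s N (N * x)) : ℂ)

/-- `k`-point correlation function of a kernel. -/
def rhoK (K : ℝ → ℝ → ℝ) (k : ℕ) (x : Fin k → ℝ) : ℝ :=
  Matrix.det (Matrix.of fun i j => K (x i) (x j))

/-- The Fredholm determinant of a kernel restricted to `(t,∞)²`. -/
def fredholmDet (K : ℝ → ℝ → ℝ) (t : ℝ) : ℝ :=
  1 + ∑' k : ℕ, ((-1 : ℝ) ^ (k + 1) / (k + 1).factorial) *
    ∫ x : Fin (k + 1) → ℝ in Set.univ.pi fun _ => Set.Ioi t, rhoK K (k + 1) x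

/-- Mixed partial derivative `∂^{p+q}K/∂x^p∂y^q`. -/
def pderiv₂ (K : ℝ → ℝ → ℝ) (p q : ℕ) (x y : ℝ) : ℝ :=
  iteratedDeriv p (fun x' => iteratedDeriv q (fun y' => K x' y') y) x

/-- `F_{n,h,a}(x) = ₂F₁[−n, h, a; 2/(1+ix)]` (a terminating series). -/
def Fnha (n : ℕ) (h : ℂ) (a : ℝ) (x : ℝ) : ℂ :=
  ∑' k : ℕ, poch (-(n : ℂ)) k * poch h k / (poch (a : ℂ) k * (k.factorial : ℂ)) *
    (2 / (1 + Complex.I * (x : ℂ))) ^ k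

/-- `θ(τ) = τ (d/dτ) log F(τ⁻¹)`. -/
def thetaOf (F : ℝ → ℝ) (τ : ℝ) : ℝ := τ * deriv (fun u => Real.log (F u⁻¹)) τ

/-- Squared Vandermonde determinant `∏_{j<k} (x_j − x_k)²`. -/
def vandSq (N : ℕ) (x : Fin N → ℝ) : ℝ :=
  ∏ p ∈ Finset.univ.filter fun p : Fin N × Fin N => p.1 < p.2, (x p.1 - x p.2) ^ 2

/-- `φ(x,y) = (f(x)g(y) − g(x)f(y))/(x−y)`, extended to the diagonal. -/
def phiFG (f g : ℝ → ℝ) (x y : ℝ) : ℝ :=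
  if x = y then deriv f x * g x - deriv g x * f x else (f x * g y - g x * f y) / (x - y)

open scoped FourierTransform SchwartzMap in
/-- Plancherel's theorem for the integral Fourier transform of functions in `L¹ ∩ L²`. -/
theorem memLp_fourier_and_integral_norm_sq {h : ℝ → ℂ} (h1 : Integrable h) (h2 : MemLp h 2) :
    MemLp (𝓕 h) 2 ∧ ∫ r, ‖𝓕 h r‖ ^ 2 = ∫ r, ‖h r‖ ^ 2 := by
  set H : Lp ℂ 2 (volume : Measure ℝ) := h2.toLp h with hH
  have hcont : Continuous (𝓕 h) :=
    VectorFourier.fourierIntegral_continuous Real.continuous_fourierChar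
      (by exact continuous_inner) h1
  have key : (𝓕 h) =ᵐ[volume] (𝓕 H : Lp ℂ 2 (volume : Measure ℝ)) := by
    apply ae_eq_of_integral_contDiff_smul_eq hcont.locallyIntegrable
      ((Lp.memLp _).locallyIntegrable (by norm_num))
    intro g hg hgs
    have hg' : ContDiff ℝ (⊤ : ℕ∞) (fun x => (g x : ℂ)) := Complex.ofRealCLM.contDiff.comp hg
    let g' : 𝓢(ℝ, ℂ) := HasCompactSupport.toSchwartzMap (f := fun x => (g x : ℂ))
      (hgs.comp_left (g := fun x : ℝ => (x : ℂ)) (by simp)) hg'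
    have hd := congrArg (fun T => T g') (Lp.fourier_toTemperedDistribution_eq H)
    simp only [TemperedDistribution.fourier_apply, Lp.toTemperedDistribution_apply] at hd
    have e1 : ∫ x, g x • (𝓕 H : Lp ℂ 2 (volume : Measure ℝ)) x
        = ∫ x, g' x • (𝓕 H : Lp ℂ 2 (volume : Measure ℝ)) x := by
      apply integral_congr_ae
      filter_upwards with x
      simp [g']
    rw [e1, ← hd]
    have e2 : ∫ x, (𝓕 g') x • H x = ∫ x, (𝓕 (g' : ℝ → ℂ)) x • h x := by
      apply integral_congr_ae
      filter_upwards [h2.coeFn_toLp] with x hx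
      rw [← hx, SchwartzMap.fourier_coe]
    rw [e2]
    have := VectorFourier.integral_fourierIntegral_smul_eq_flip (μ := volume) (ν := volume)
      (L := innerₗ ℝ) (f := g') (g := h) Real.continuous_fourierChar (by exact continuous_inner)
      g'.integrable h1
    rw [flip_innerₗ] at this
    refine Eq.trans ?_ this.symm
    apply integral_congr_ae
    filter_upwards with x
    simp [g']
    exact Or.inl rfl
  have hmem : MemLp (𝓕 h) 2 := (memLp_congr_ae key).mpr (Lp.memLp _)
  refine ⟨hmem, ?_⟩
  have hn := Lp.norm_fourier_eq H
  have sq : ∀ F : Lp ℂ 2 (volume : Measure ℝ), ‖F‖ ^ 2 = ∫ r, ‖F r‖ ^ 2 := by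
    intro F
    have := L2.inner_def (𝕜 := ℂ) F F
    rw [inner_self_eq_norm_sq_to_K] at this
    have h3 : ∀ r, inner ℂ (F r) (F r) = ((‖F r‖ ^ 2 : ℝ) : ℂ) := by
      intro r
      rw [inner_self_eq_norm_sq_to_K]; simp
    simp_rw [h3] at this
    rw [integral_complex_ofReal] at this
    rw [← Complex.ofReal_inj, ← this]
    push_cast
    rfl
  calc ∫ r, ‖𝓕 h r‖ ^ 2 = ∫ r, ‖(𝓕 H : Lp ℂ 2 (volume : Measure ℝ)) r‖ ^ 2 := by
        apply integral_congr_ae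
        filter_upwards [key] with x hx
        rw [hx]
    _ = ∫ r, ‖H r‖ ^ 2 := by rw [← sq, ← sq, hn]
    _ = _ := by
        apply integral_congr_ae
        filter_upwards [h2.coeFn_toLp] with x hx
        rw [hx]

theorem integrableOn_rpow_mul_exp_neg_mul {c b : ℝ} (hc : -1 < c) (hb : 0 < b) :
    IntegrableOn (fun r : ℝ => r ^ c * Real.exp (-b * r)) (Ioi 0) := by
  simpa using integrableOn_rpow_mul_exp_neg_mul_rpow (p := 1) hc one_pos hb

theorem norm_cpow_mul_cexp_neg_mul (a p : ℂ) {r : ℝ} (hr : 0 < r) :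
    ‖(r : ℂ) ^ (a - 1) * cexp (-(p * r))‖ = r ^ (a.re - 1) * Real.exp (-p.re * r) := by
  rw [norm_mul, Complex.norm_cpow_eq_rpow_re_of_pos hr, Complex.norm_exp]
  simp

theorem continuousOn_cpow_mul_cexp_neg_mul (a p : ℂ) :
    ContinuousOn (fun r : ℝ => (r : ℂ) ^ (a - 1) * cexp (-(p * r))) (Ioi 0) := by
  apply ContinuousOn.mul
  · apply ContinuousOn.cpow_const Complex.continuous_ofReal.continuousOn
    intro r hr
    exact Complex.ofReal_mem_slitPlane.mpr hr
  · fun_prop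

theorem integrableOn_cpow_mul_cexp_neg_mul {a p : ℂ} (ha : 0 < a.re) (hp : 0 < p.re) :
    IntegrableOn (fun r : ℝ => (r : ℂ) ^ (a - 1) * cexp (-(p * r))) (Ioi 0) := by
  have h := integrableOn_rpow_mul_exp_neg_mul (c := a.re - 1) (by linarith) hp
  refine Integrable.mono' h
    ((continuousOn_cpow_mul_cexp_neg_mul a p).aestronglyMeasurable measurableSet_Ioi) ?_
  filter_upwards [ae_restrict_mem measurableSet_Ioi] with r hr
  rw [norm_cpow_mul_cexp_neg_mul a p hr]

theorem differentiableAt_integral_cpow_mul_cexp {a p : ℂ} (ha : 0 < a.re) (hp : 0 < p.re) :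
    DifferentiableAt ℂ
      (fun p : ℂ => ∫ r in Ioi (0 : ℝ), (r : ℂ) ^ (a - 1) * cexp (-(p * r))) p := by
  have hs : Metric.ball p (p.re / 2) ∈ nhds p := Metric.ball_mem_nhds _ (by linarith)
  have hre : ∀ q ∈ Metric.ball p (p.re / 2), p.re / 2 < q.re := by
    intro q hq
    rw [Metric.mem_ball, dist_eq_norm] at hq
    have := (Complex.abs_re_le_norm (q - p)).trans_lt hq
    rw [Complex.sub_re, abs_lt] at this
    linarith [this.1]
  have := hasDerivAt_integral_of_dominated_loc_of_deriv_le (μ := volume.restrict (Ioi (0 : ℝ)))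
    (F := fun p r => (r : ℂ) ^ (a - 1) * cexp (-(p * r)))
    (F' := fun p r => (r : ℂ) ^ (a - 1) * (cexp (-(p * r)) * (-r)))
    (bound := fun r => r ^ a.re * Real.exp (-(p.re / 2) * r)) (x₀ := p) hs ?_ ?_ ?_ ?_ ?_ ?_
  · exact this.2.differentiableAt
  · filter_upwards with q
    exact (continuousOn_cpow_mul_cexp_neg_mul a q).aestronglyMeasurable measurableSet_Ioi
  · exact integrableOn_cpow_mul_cexp_neg_mul ha hp
  · have h1 := (continuousOn_cpow_mul_cexp_neg_mul a p).mul
      (f := fun r : ℝ => (r : ℂ) ^ (a - 1) * cexp (-(p * r)))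
      (g := fun r : ℝ => -(r : ℂ)) (s := Ioi 0) (by fun_prop)
    refine (h1.congr fun r _ => ?_).aestronglyMeasurable measurableSet_Ioi
    simp only [Pi.mul_apply]
    ring
  · filter_upwards [ae_restrict_mem measurableSet_Ioi] with r hr q hq
    have hr' : (0 : ℝ) < r := hr
    rw [← mul_assoc, norm_mul, norm_cpow_mul_cexp_neg_mul a q hr', norm_neg, Complex.norm_real,
      Real.norm_of_nonneg hr'.le, mul_right_comm, ← Real.rpow_add_one hr'.ne']
    have := hre q hq
    have e : a.re - 1 + 1 = a.re := by ring
    rw [e]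
    gcongr
  · exact integrableOn_rpow_mul_exp_neg_mul (by linarith) (by linarith)
  · filter_upwards with r q _
    have : HasDerivAt (fun q : ℂ => -(q * r)) (-(1 * r)) q := ((hasDerivAt_id q).mul_const _).neg
    simpa using (this.cexp).const_mul ((r : ℂ) ^ (a - 1))

/-- The Gamma integral with a complex rate. -/
theorem integral_cpow_mul_cexp_neg_mul {a p : ℂ} (ha : 0 < a.re) (hp : 0 < p.re) :
    ∫ r in Ioi (0 : ℝ), (r : ℂ) ^ (a - 1) * cexp (-(p * r)) = p ^ (-a) * Gamma a := by
  have hopen : IsOpen {p : ℂ | 0 < p.re} := isOpen_lt continuous_const Complex.continuous_re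
  have hF : AnalyticOnNhd ℂ
      (fun p : ℂ => ∫ r in Ioi (0 : ℝ), (r : ℂ) ^ (a - 1) * cexp (-(p * r))) {p : ℂ | 0 < p.re} :=
    DifferentiableOn.analyticOnNhd (fun q hq =>
      (differentiableAt_integral_cpow_mul_cexp ha hq).differentiableWithinAt) hopen
  have hG : AnalyticOnNhd ℂ (fun p : ℂ => p ^ (-a) * Gamma a) {p : ℂ | 0 < p.re} :=
    DifferentiableOn.analyticOnNhd (fun q hq =>
      ((differentiableAt_id.cpow_const (Or.inl hq)).mul_const _).differentiableWithinAt) hopen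
  have hconn : IsPreconnected {p : ℂ | 0 < p.re} := (convex_halfSpace_re_gt 0).isPreconnected
  refine hF.eqOn_of_preconnected_of_frequently_eq hG hconn (z₀ := 1) (by simp) ?_ hp
  have hseq : Tendsto (fun n : ℕ => ((1 + 1 / ((n : ℝ) + 1) : ℝ) : ℂ)) atTop
      (nhdsWithin 1 {1}ᶜ) := by
    rw [tendsto_nhdsWithin_iff]
    constructor
    · have := (tendsto_one_div_add_atTop_nhds_zero_nat (𝕜 := ℝ)).const_add 1
      have h2 := (Complex.continuous_ofReal.tendsto _).comp this
      simpa [Function.comp_def] using h2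
    · filter_upwards with n
      have : (0 : ℝ) < 1 / ((n : ℝ) + 1) := by positivity
      have h1 : (1 + 1 / ((n : ℝ) + 1) : ℝ) ≠ 1 := by linarith
      exact mt Complex.ofReal_eq_one.mp h1
  refine hseq.frequently (Frequently.of_forall fun n => ?_)
  have hr : (0 : ℝ) < 1 + 1 / ((n : ℝ) + 1) := by positivity
  generalize (1 + 1 / ((n : ℝ) + 1) : ℝ) = q at hr
  have := Complex.integral_cpow_mul_exp_neg_mul_Ioi ha hr
  rw [this, one_div, ← Complex.ofReal_inv, Complex.ofReal_inv, Complex.inv_cpow, Complex.cpow_neg]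
  rw [Complex.arg_ofReal_of_nonneg hr.le]
  exact Real.pi_pos.ne

theorem poch_zero (x : ℂ) : poch x 0 = 1 := by simp [poch]

theorem poch_succ (x : ℂ) (n : ℕ) : poch x (n + 1) = poch x n * (x + n) := by
  simp [poch, Finset.prod_range_succ]

theorem poch_succ' (x : ℂ) (n : ℕ) : poch x (n + 1) = x * poch (x + 1) n := by
  simp only [poch, Finset.prod_range_succ', Nat.cast_zero, add_zero]
  rw [mul_comm]
  congr 1
  refine Finset.prod_congr rfl fun i _ => ?_
  push_cast
  ring

theorem add_natCast_ne_zero {q : ℂ} (hq : 0 < q.re) (n : ℕ) : q + n ≠ 0 := by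
  intro h
  have := congrArg Complex.re h
  simp only [Complex.add_re, Complex.natCast_re, Complex.zero_re] at this
  have hn : (0 : ℝ) ≤ n := Nat.cast_nonneg n
  linarith

theorem poch_ne_zero {q : ℂ} (hq : 0 < q.re) (n : ℕ) : poch q n ≠ 0 :=
  Finset.prod_ne_zero_iff.mpr fun i _ => add_natCast_ne_zero hq i

/-- A bound for the ratios `(r + n) / (q + n)`. -/
def ratioBound (r q : ℂ) : ℝ := max (‖r‖ / q.re) 1

theorem one_le_ratioBound (r q : ℂ) : 1 ≤ ratioBound r q := le_max_right _ _

theorem ratioBound_pos (r q : ℂ) : 0 < ratioBound r q :=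
  one_pos.trans_le (one_le_ratioBound r q)

theorem norm_add_natCast_le {r q : ℂ} (hq : 0 < q.re) (n : ℕ) :
    ‖r + n‖ ≤ ratioBound r q * ‖q + n‖ := by
  have h1 : ‖r + n‖ ≤ ‖r‖ + n := (norm_add_le _ _).trans (by simp)
  have h2 : q.re + n ≤ ‖q + n‖ := by
    have := (Complex.re_le_norm (q + n))
    simpa using this
  have h3 : ‖r‖ ≤ ratioBound r q * q.re := (div_le_iff₀ hq).mp (le_max_left _ _)
  have h4 := one_le_ratioBound r q
  have hn : (0 : ℝ) ≤ n := Nat.cast_nonneg n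
  nlinarith [mul_le_mul_of_nonneg_left h2 (ratioBound_pos r q).le,
    mul_nonneg (sub_nonneg.mpr h4) hn]

theorem norm_poch_div_poch_le {r q : ℂ} (hq : 0 < q.re) (n : ℕ) :
    ‖poch r n / poch q n‖ ≤ ratioBound r q ^ n := by
  induction n with
  | zero => simp [poch_zero]
  | succ n ih =>
    rw [poch_succ, poch_succ, mul_div_mul_comm, norm_mul, pow_succ]
    refine mul_le_mul ih ?_ (norm_nonneg _) (pow_nonneg (ratioBound_pos r q).le _)
    rw [norm_div, div_le_iff₀ (norm_pos_iff.mpr (add_natCast_ne_zero hq n))]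
    exact norm_add_natCast_le hq n

/-- The coefficients of the confluent hypergeometric series. -/
def hypCoeff (r q : ℂ) (n : ℕ) : ℂ := poch r n / (poch q n * n.factorial)

theorem hypCoeff_zero (r q : ℂ) : hypCoeff r q 0 = 1 := by simp [hypCoeff, poch_zero]

theorem norm_hypCoeff_le {r q : ℂ} (hq : 0 < q.re) (n : ℕ) :
    ‖hypCoeff r q n‖ ≤ ratioBound r q ^ n / n.factorial := by
  rw [hypCoeff, ← div_div, norm_div, Complex.norm_natCast]
  gcongr
  exact norm_poch_div_poch_le hq n

theorem norm_hypCoeff_mul_pow_le {r q : ℂ} (hq : 0 < q.re) (n : ℕ) (z : ℂ) :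
    ‖hypCoeff r q n * z ^ n‖ ≤ (ratioBound r q * ‖z‖) ^ n / n.factorial := by
  rw [norm_mul, norm_pow, mul_pow, mul_div_right_comm]
  gcongr
  exact norm_hypCoeff_le hq n

theorem summable_norm_hypCoeff {r q : ℂ} (hq : 0 < q.re) (z : ℂ) :
    Summable fun n => ‖hypCoeff r q n * z ^ n‖ :=
  Summable.of_nonneg_of_le (fun _ => norm_nonneg _) (fun n => norm_hypCoeff_mul_pow_le hq n z)
    (Real.summable_pow_div_factorial _)

theorem hasSum_oneF1 {r q : ℂ} (hq : 0 < q.re) (z : ℂ) :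
    HasSum (fun n => hypCoeff r q n * z ^ n) (oneF1 r q z) :=
  (summable_norm_hypCoeff hq z).of_norm.hasSum

theorem norm_oneF1_le {r q : ℂ} (hq : 0 < q.re) (z : ℂ) :
    ‖oneF1 r q z‖ ≤ Real.exp (ratioBound r q * ‖z‖) := by
  have h := NormedSpace.expSeries_div_hasSum_exp (ratioBound r q * ‖z‖)
  rw [← Real.exp_eq_exp_ℝ] at h
  exact tsum_of_norm_bounded h fun n => norm_hypCoeff_mul_pow_le hq n z

theorem hypCoeff_succ_mul {r q : ℂ} (n : ℕ) :
    hypCoeff r q (n + 1) * (n + 1) = r / q * hypCoeff (r + 1) (q + 1) n := by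
  have hn : ((n : ℂ) + 1) ≠ 0 := by exact_mod_cast Nat.succ_ne_zero n
  simp only [hypCoeff, poch_succ', Nat.factorial_succ]
  push_cast
  rw [div_mul_eq_mul_div, div_mul_div_comm, show q * poch (q + 1) n * (((n : ℂ) + 1) * n.factorial)
    = q * (poch (q + 1) n * n.factorial) * (n + 1) by ring, mul_div_mul_right _ _ hn]

theorem hasDerivAt_oneF1 {r q : ℂ} (hq : 0 < q.re) (z : ℂ) :
    HasDerivAt (oneF1 r q) (r / q * oneF1 (r + 1) (q + 1) z) z := by
  have hq1 : 0 < (q + 1).re := by simp; linarith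
  set L := ratioBound r q
  set R := ‖z‖ + 1
  have hu : Summable fun n : ℕ => L ^ n / n.factorial * (n * R ^ (n - 1)) := by
    rw [← summable_nat_add_iff 1]
    refine ((Real.summable_pow_div_factorial (L * R)).mul_left L).congr fun n => ?_
    have hn : ((n : ℝ) + 1) ≠ 0 := by positivity
    simp only [Nat.factorial_succ, Nat.add_sub_cancel]
    push_cast
    field_simp
    rw [mul_pow]
    ring
  have key := hasDerivAt_tsum_of_isPreconnected (𝕜 := ℂ)
    (g := fun n z => hypCoeff r q n * z ^ n)
    (g' := fun n z => hypCoeff r q n * (n * z ^ (n - 1))) hu Metric.isOpen_ball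
    ((convex_ball (0 : ℂ) R).isPreconnected) (fun n y _ => (hasDerivAt_pow n y).const_mul _) ?_
    (Metric.mem_ball_self (by positivity)) (summable_norm_hypCoeff hq 0).of_norm
    (y := z) (by simp [R])
  · refine HasDerivAt.congr_deriv (f := oneF1 r q) key ?_
    have hs : Summable fun n => hypCoeff r q n * (n * z ^ (n - 1)) := by
      rw [← summable_nat_add_iff 1]
      refine ((hasSum_oneF1 (r := r + 1) hq1 z).summable.mul_left (r / q)).congr fun n => ?_
      rw [← mul_assoc, ← hypCoeff_succ_mul]
      simp only [Nat.add_sub_cancel]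
      push_cast
      ring
    rw [hs.tsum_eq_zero_add]
    simp only [Nat.cast_zero, zero_mul, mul_zero, zero_add, Nat.add_sub_cancel]
    rw [← ((hasSum_oneF1 (r := r + 1) hq1 z).mul_left (r / q)).tsum_eq]
    refine tsum_congr fun n => ?_
    rw [← mul_assoc, ← mul_assoc, ← hypCoeff_succ_mul]
    push_cast
    ring
  · intro n y hy
    rw [mem_ball_zero_iff] at hy
    rw [norm_mul, norm_mul, norm_pow, Complex.norm_natCast]
    have := norm_hypCoeff_le (r := r) hq n
    have hL := ratioBound_pos r q
    gcongr

theorem differentiable_oneF1 {r q : ℂ} (hq : 0 < q.re) : Differentiable ℂ (oneF1 r q) :=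
  fun z => (hasDerivAt_oneF1 hq z).differentiableAt

theorem continuous_oneF1 {r q : ℂ} (hq : 0 < q.re) : Continuous (oneF1 r q) :=
  (differentiable_oneF1 hq).continuous

theorem hasSum_oneF1_succ {r q : ℂ} (hq : 0 < q.re) (z : ℂ) :
    HasSum (fun n => hypCoeff r q (n + 1) * z ^ (n + 1)) (oneF1 r q z - 1) := by
  have := (hasSum_nat_add_iff' 1).mpr (hasSum_oneF1 (r := r) hq z)
  simpa [hypCoeff_zero] using this

theorem hasSum_mul_oneF1 {r q : ℂ} (hq : 0 < q.re) (z : ℂ) :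
    HasSum (fun n => hypCoeff r q n * z ^ (n + 1)) (z * oneF1 r q z) := by
  refine ((hasSum_oneF1 hq z).mul_left z).congr_fun ?_ 
  intro n
  ring

/-- `₁F₁(s+1, b) = ₁F₁(s, b) + (z/b) ₁F₁(s+1, b+1)`. -/
theorem oneF1_contiguous {s b : ℂ} (hb : 0 < b.re) (z : ℂ) :
    oneF1 (s + 1) b z = oneF1 s b z + z / b * oneF1 (s + 1) (b + 1) z := by
  have hb1 : 0 < (b + 1).re := by simp; linarith
  have hb0 : b ≠ 0 := by simpa using add_natCast_ne_zero hb 0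
  have h := (hasSum_oneF1_succ (r := s) hb z).add
    ((hasSum_mul_oneF1 (r := s + 1) hb1 z).mul_left b⁻¹)
  have h2 := h.unique ((hasSum_oneF1_succ (r := s + 1) hb z).congr_fun fun n => ?_)
  · linear_combination -h2
  · have hn : ((n : ℂ) + 1) ≠ 0 := by exact_mod_cast Nat.succ_ne_zero n
    have hf : (n.factorial : ℂ) ≠ 0 := by exact_mod_cast n.factorial_ne_zero
    have hp := poch_ne_zero hb1 n
    simp only [hypCoeff, poch_succ' b, poch_succ' s, poch_succ (s + 1), Nat.factorial_succ]
    push_cast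
    field_simp
    ring

/-- The Euler operator identity `(z d/dz + b) ₁F₁(s+1, b+1) = b ₁F₁(s+1, b)`. -/
theorem oneF1_euler {s b : ℂ} (hb : 0 < b.re) (z : ℂ) :
    z * (s / (b + 1) * oneF1 (s + 1) (b + 1 + 1) z) + b * oneF1 s (b + 1) z = b * oneF1 s b z := by
  have hb1 : 0 < (b + 1).re := by simp; linarith
  have hb2 : 0 < (b + 1 + 1).re := by simp; linarith
  have hb0 : b ≠ 0 := by simpa using add_natCast_ne_zero hb 0
  have h := ((hasSum_mul_oneF1 (r := s + 1) hb2 z).mul_left (s / (b + 1))).add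
    ((hasSum_oneF1_succ (r := s) hb1 z).mul_left b)
  have h2 := h.unique (((hasSum_oneF1_succ (r := s) hb z).mul_left b).congr_fun fun n => ?_)
  · linear_combination h2
  · rw [← mul_assoc, ← hypCoeff_succ_mul]
    have hn : ((n : ℂ) + 1) ≠ 0 := by exact_mod_cast Nat.succ_ne_zero n
    have hf : (n.factorial : ℂ) ≠ 0 := by exact_mod_cast n.factorial_ne_zero
    have hp := poch_ne_zero hb1 n
    have hbn : b + 1 + n ≠ 0 := add_natCast_ne_zero hb1 n
    simp only [hypCoeff, poch_succ' b, poch_succ (b + 1), Nat.factorial_succ]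
    push_cast
    field_simp
    ring

theorem sum_choose_poch_div_poch {a b : ℂ} (hb : 0 < b.re) (n : ℕ) :
    ∑ ij ∈ Finset.HasAntidiagonal.antidiagonal n,
        n.choose ij.1 • ((-1 : ℂ) ^ ij.1 * (poch a ij.1 / poch b ij.1)) =
      poch (b - a) n / poch b n := by
  induction n generalizing a b with
  | zero => simp [poch_zero]
  | succ n ih =>
    have hb1 : 0 < (b + 1).re := by simp; linarith
    have hb0 : b ≠ 0 := by simpa using add_natCast_ne_zero hb 0
    rw [Finset.sum_antidiagonal_choose_succ_nsmul
      (fun i _ => (-1 : ℂ) ^ i * (poch a i / poch b i)) n, ih hb]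
    have e : ∀ ij ∈ Finset.HasAntidiagonal.antidiagonal n, n.choose ij.2 • ((-1 : ℂ) ^ (ij.1 + 1) *
        (poch a (ij.1 + 1) / poch b (ij.1 + 1))) = -(a / b) * (n.choose ij.1 • ((-1 : ℂ) ^ ij.1 *
          (poch (a + 1) ij.1 / poch (b + 1) ij.1))) := by
      intro ij hij
      rw [← Finset.HasAntidiagonal.mem_antidiagonal.mp hij, Nat.choose_symm_add, poch_succ',
        poch_succ',
        mul_div_mul_comm]
      simp only [nsmul_eq_mul]
      ring
    rw [Finset.sum_congr rfl e, ← Finset.mul_sum, ih hb1, poch_succ]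
    have h1 : poch (b + 1) n * b = poch b n * (b + n) := by
      rw [← poch_succ, poch_succ', mul_comm]
    have h2 := poch_ne_zero hb n
    have h3 := poch_ne_zero hb1 n
    have h4 := add_natCast_ne_zero hb n
    rw [show b + 1 - (a + 1) = b - a by ring, poch_succ]
    field_simp
    linear_combination (a * poch (b - a) n) * h1

/-- Kummer's transformation. -/
theorem exp_neg_mul_oneF1 {a b : ℂ} (hb : 0 < b.re) (z : ℂ) :
    cexp (-z) * oneF1 a b z = oneF1 (b - a) b (-z) := by
  have he : HasSum (fun n : ℕ => (-z) ^ n / n.factorial) (cexp (-z)) := by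
    rw [Complex.exp_eq_exp_ℂ]
    exact NormedSpace.expSeries_div_hasSum_exp (-z)
  have hes : Summable fun n : ℕ => ‖(-z) ^ n / n.factorial‖ := by
    simpa [norm_div] using Real.summable_pow_div_factorial ‖z‖
  rw [mul_comm, ← he.tsum_eq, ← (hasSum_oneF1 (r := a) hb z).tsum_eq,
    ← (hasSum_oneF1 (r := b - a) hb (-z)).tsum_eq,
    tsum_mul_tsum_eq_tsum_sum_antidiagonal_of_summable_norm (summable_norm_hypCoeff hb z) hes]
  refine tsum_congr fun n => ?_
  rw [hypCoeff, ← div_div, ← sum_choose_poch_div_poch hb, Finset.sum_div, Finset.sum_mul]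
  refine Finset.sum_congr rfl fun ij hij => ?_
  have hn := Finset.HasAntidiagonal.mem_antidiagonal.mp hij
  have hf : (n.factorial : ℂ) = n.choose ij.1 * ij.1.factorial * ij.2.factorial := by
    rw [← hn]
    rw [Nat.choose_symm_add]
    exact_mod_cast (Nat.add_choose_mul_factorial_mul_factorial ij.1 ij.2).symm
  have h1 : (ij.1.factorial : ℂ) ≠ 0 := by exact_mod_cast Nat.factorial_ne_zero _
  have h2 : (ij.2.factorial : ℂ) ≠ 0 := by exact_mod_cast Nat.factorial_ne_zero _
  have h3 : (n.choose ij.1 : ℂ) ≠ 0 := by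
    exact_mod_cast (Nat.choose_pos (hn ▸ Nat.le_add_right _ _)).ne'
  have h4 := poch_ne_zero hb ij.1
  have h5 : (-z) ^ n = (-1) ^ ij.1 * z ^ ij.1 * (-z) ^ ij.2 := by
    rw [← hn, pow_add, neg_pow z ij.1]
  have h6 : ((-1 : ℂ) ^ ij.1) * (-1) ^ ij.1 = 1 := by rw [← mul_pow]; simp
  rw [hf, h5, hypCoeff, nsmul_eq_mul]
  field_simp
  linear_combination (-(poch a ij.1 * z ^ ij.1 * (-z) ^ ij.2)) * h6

theorem conj_poch (r : ℂ) (n : ℕ) :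
    (starRingEnd ℂ) (poch r n) = poch ((starRingEnd ℂ) r) n := by
  simp [poch, map_prod]

theorem conj_oneF1 (r q z : ℂ) : (starRingEnd ℂ) (oneF1 r q z) =
    oneF1 ((starRingEnd ℂ) r) ((starRingEnd ℂ) q) ((starRingEnd ℂ) z) := by
  simp [oneF1, Complex.conj_tsum, conj_poch]

/-- The entire function `v ↦ ₁F₁[s+1, 2Re(s)+1; iv]` on the real line. -/
def hypWave (s : ℂ) (v : ℝ) : ℂ := oneF1 (s + 1) ((2 * s.re + 1 : ℝ) : ℂ) (I * v)

/-- The kernel `k(u,v) = ∫₀¹ φ(uτ) conj(φ(vτ)) τ^{2 Re s} dτ`. -/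
def waveKernel (s : ℂ) (u v : ℝ) : ℂ :=
  ∫ τ in Ioc (0 : ℝ) 1, hypWave s (u * τ) * (starRingEnd ℂ) (hypWave s (v * τ)) *
    ((τ ^ (2 * s.re) : ℝ) : ℂ)

/-- The exponential type bound of `hypWave`. -/
def waveType (s : ℂ) : ℝ := ratioBound (s + 1) ((2 * s.re + 1 : ℝ) : ℂ)

section
variable {s : ℂ}

theorem waveType_pos (s : ℂ) : 0 < waveType s := ratioBound_pos _ _

theorem re_ofReal_pos {s : ℂ} (hs : -(1 / 2 : ℝ) < s.re) : 0 < (((2 * s.re + 1 : ℝ) : ℂ)).re := by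
  rw [Complex.ofReal_re]; linarith

theorem norm_hypWave_le (hs : -(1 / 2 : ℝ) < s.re) (v : ℝ) :
    ‖hypWave s v‖ ≤ Real.exp (waveType s * |v|) := by
  have := norm_oneF1_le (r := s + 1) (re_ofReal_pos hs) (I * v)
  simpa [hypWave, waveType] using this

theorem continuous_hypWave (hs : -(1 / 2 : ℝ) < s.re) : Continuous (hypWave s) := by
  unfold hypWave
  have := continuous_oneF1 (r := s + 1) (re_ofReal_pos hs)
  fun_prop

theorem conj_hypWave (hs : -(1 / 2 : ℝ) < s.re) (v : ℝ) :
    (starRingEnd ℂ) (hypWave s v) =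
      cexp (-(I * v)) * oneF1 s ((2 * s.re + 1 : ℝ) : ℂ) (I * v) := by
  rw [exp_neg_mul_oneF1 (re_ofReal_pos hs), hypWave, conj_oneF1]
  have e : ((2 * s.re + 1 : ℝ) : ℂ) - s = (starRingEnd ℂ) (s + 1) := by
    apply Complex.ext
    · simp
      ring
    · simp
  rw [e, Complex.conj_ofReal, map_mul, Complex.conj_I, Complex.conj_ofReal, neg_mul]

theorem integrableOn_rpow_Ioc {c R : ℝ} (hc : -1 < c) (hR : 0 ≤ R) :
    IntegrableOn (fun τ : ℝ => τ ^ c) (Ioc 0 R) := by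
  rw [← intervalIntegrable_iff_integrableOn_Ioc_of_le hR]
  exact intervalIntegral.intervalIntegrable_rpow' hc

theorem hasDerivAt_christoffel (hs : -(1 / 2 : ℝ) < s.re) (u v : ℝ) {t : ℝ} (ht : 0 < t) :
    HasDerivAt (fun t : ℝ => ((t ^ (2 * s.re + 1) : ℝ) : ℂ) * cexp (-(I * ((v * t : ℝ) : ℂ))) *
      (v * oneF1 s ((2 * s.re + 1 : ℝ) : ℂ) (I * ((u * t : ℝ) : ℂ)) *
          oneF1 (s + 1) (((2 * s.re + 1 : ℝ) : ℂ) + 1) (I * ((v * t : ℝ) : ℂ)) -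
        u * oneF1 (s + 1) (((2 * s.re + 1 : ℝ) : ℂ) + 1) (I * ((u * t : ℝ) : ℂ)) *
          oneF1 s ((2 * s.re + 1 : ℝ) : ℂ) (I * ((v * t : ℝ) : ℂ))))
      (((2 * s.re + 1 : ℝ) : ℂ) * (v - u) * (hypWave s (u * t) *
        (starRingEnd ℂ) (hypWave s (v * t)) * ((t ^ (2 * s.re) : ℝ) : ℂ))) t := by
  rw [conj_hypWave hs]
  unfold hypWave
  set b : ℂ := ((2 * s.re + 1 : ℝ) : ℂ) with hb
  have hb0 : 0 < b.re := re_ofReal_pos hs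
  have hbne : b ≠ 0 := by simpa using add_natCast_ne_zero hb0 0
  have hb1 : 0 < (b + 1).re := by simp; linarith
  have hlin : ∀ w : ℝ, HasDerivAt (fun t : ℝ => I * ((w * t : ℝ) : ℂ)) (I * w) t := by
    intro w
    have := (((hasDerivAt_id t).const_mul w).ofReal_comp).const_mul I
    simpa using this
  have hA : ∀ w : ℝ, HasDerivAt (fun t : ℝ => oneF1 s b (I * ((w * t : ℝ) : ℂ)))
      (s / b * oneF1 (s + 1) (b + 1) (I * ((w * t : ℝ) : ℂ)) * (I * w)) t := fun w =>
    (hasDerivAt_oneF1 hb0 _).comp t (hlin w)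
  have hB : ∀ w : ℝ, HasDerivAt (fun t : ℝ => oneF1 (s + 1) (b + 1) (I * ((w * t : ℝ) : ℂ)))
      ((s + 1) / (b + 1) * oneF1 (s + 1 + 1) (b + 1 + 1) (I * ((w * t : ℝ) : ℂ)) * (I * w)) t :=
    fun w => (hasDerivAt_oneF1 hb1 _).comp t (hlin w)
  have hpow : HasDerivAt (fun t : ℝ => ((t ^ (2 * s.re + 1) : ℝ) : ℂ))
      ((((2 * s.re + 1) * t ^ (2 * s.re) : ℝ) : ℂ)) t := by
    have := Real.hasDerivAt_rpow_const (p := 2 * s.re + 1) (x := t) (Or.inl ht.ne')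
    rw [add_sub_cancel_right] at this
    exact this.ofReal_comp
  have hexp := (hlin v).neg.cexp
  have key := (hpow.mul hexp).mul ((((hA u).const_mul (v : ℂ)).mul (hB v)).sub
    (((hB u).const_mul (u : ℂ)).mul (hA v)))
  refine HasDerivAt.congr_deriv key ?_
  have cu := oneF1_contiguous (s := s) hb0 (I * ((u * t : ℝ) : ℂ))
  have cv := oneF1_contiguous (s := s) hb0 (I * ((v * t : ℝ) : ℂ))
  have eu := oneF1_euler (s := s + 1) hb0 (I * ((u * t : ℝ) : ℂ))
  have ev := oneF1_euler (s := s + 1) hb0 (I * ((v * t : ℝ) : ℂ))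
  have ht1 : ((t ^ (2 * s.re + 1) : ℝ) : ℂ) = ((t ^ (2 * s.re) : ℝ) : ℂ) * t := by
    rw [Real.rpow_add_one ht.ne']; push_cast; rfl
  have hbe : (((2 * s.re + 1) * t ^ (2 * s.re) : ℝ) : ℂ) = b * ((t ^ (2 * s.re) : ℝ) : ℂ) := by
    rw [hb]; push_cast; rfl
  simp only [Pi.mul_apply, Pi.sub_apply, Pi.neg_apply]
  rw [ht1, hbe]
  clear_value b
  generalize oneF1 (s + 1) b (I * ((u * t : ℝ) : ℂ)) = Xp at *
  generalize oneF1 (s + 1) b (I * ((v * t : ℝ) : ℂ)) = Yp at *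
  generalize oneF1 s b (I * ((u * t : ℝ) : ℂ)) = X at *
  generalize oneF1 s b (I * ((v * t : ℝ) : ℂ)) = Y at *
  generalize oneF1 (s + 1) (b + 1) (I * ((u * t : ℝ) : ℂ)) = XB at *
  generalize oneF1 (s + 1) (b + 1) (I * ((v * t : ℝ) : ℂ)) = YB at *
  generalize (s + 1) / (b + 1) * oneF1 (s + 1 + 1) (b + 1 + 1) (I * ((u * t : ℝ) : ℂ)) = XC at *
  generalize (s + 1) / (b + 1) * oneF1 (s + 1 + 1) (b + 1 + 1) (I * ((v * t : ℝ) : ℂ)) = YC at *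
  generalize ((t ^ (2 * s.re) : ℝ) : ℂ) = p
  generalize cexp (-(I * ((v * t : ℝ) : ℂ))) = e
  have cu' : b * Xp = b * X + I * ((u * t : ℝ) : ℂ) * XB := by rw [cu]; field_simp
  have cv' : b * Yp = b * Y + I * ((v * t : ℝ) : ℂ) * YB := by rw [cv]; field_simp
  push_cast at *
  linear_combination (p * e * v * X) * ev - (p * e * u * Y) * eu + (p * e * v * X) * cv'
    - (p * e * v * Y) * cu'

theorem norm_waveKernel_integrand_le (hs : -(1 / 2 : ℝ) < s.re) {u v C : ℝ} (hu : |u| ≤ C)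
    (hv : |v| ≤ C) {τ : ℝ} (hτ : τ ∈ Ioc (0 : ℝ) 1) :
    ‖hypWave s (u * τ) * (starRingEnd ℂ) (hypWave s (v * τ)) * ((τ ^ (2 * s.re) : ℝ) : ℂ)‖ ≤
      Real.exp (waveType s * C) ^ 2 * τ ^ (2 * s.re) := by
  have hb : ∀ w : ℝ, |w| ≤ C → ‖hypWave s (w * τ)‖ ≤ Real.exp (waveType s * C) := by
    intro w hw
    refine (norm_hypWave_le hs _).trans ?_
    have hL := waveType_pos s
    have : |w * τ| ≤ C := by
      rw [abs_mul, abs_of_pos hτ.1]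
      calc |w| * τ ≤ |w| * 1 := by gcongr; exact hτ.2
        _ ≤ C := by simpa using hw
    gcongr
  have hp : 0 ≤ τ ^ (2 * s.re) := Real.rpow_nonneg hτ.1.le _
  rw [norm_mul, norm_mul, RCLike.norm_conj, Complex.norm_real, Real.norm_of_nonneg hp, sq]
  have h1 := hb u hu
  have h2 := hb v hv
  gcongr

theorem aestronglyMeasurable_waveKernel_integrand (hs : -(1 / 2 : ℝ) < s.re) (u v : ℝ)
    (S : Set ℝ) : AEStronglyMeasurable (fun τ : ℝ => hypWave s (u * τ) *
      (starRingEnd ℂ) (hypWave s (v * τ)) * ((τ ^ (2 * s.re) : ℝ) : ℂ)) (volume.restrict S) := by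
  have h := continuous_hypWave hs
  have h1 : Continuous fun τ : ℝ => hypWave s (u * τ) * (starRingEnd ℂ) (hypWave s (v * τ)) :=
    (h.comp (by fun_prop)).mul (Complex.continuous_conj.comp (h.comp (by fun_prop)))
  have h2 : Measurable fun τ : ℝ => ((τ ^ (2 * s.re) : ℝ) : ℂ) := by fun_prop
  exact (h1.measurable.mul h2).aestronglyMeasurable

theorem integrableOn_waveKernel_integrand (hs : -(1 / 2 : ℝ) < s.re) (u v : ℝ) :
    IntegrableOn (fun τ : ℝ => hypWave s (u * τ) *
      (starRingEnd ℂ) (hypWave s (v * τ)) * ((τ ^ (2 * s.re) : ℝ) : ℂ)) (Ioc 0 1) := by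
  refine Integrable.mono' ((integrableOn_rpow_Ioc (c := 2 * s.re) (by linarith)
    zero_le_one).const_mul (Real.exp (waveType s * max |u| |v|) ^ 2))
    (aestronglyMeasurable_waveKernel_integrand hs u v _) ?_
  filter_upwards [ae_restrict_mem measurableSet_Ioc] with τ hτ
  exact norm_waveKernel_integrand_le hs (le_max_left |u| |v|) (le_max_right |u| |v|) hτ

/-- The Christoffel–Darboux type formula for the wave kernel. -/
theorem christoffel_eq (hs : -(1 / 2 : ℝ) < s.re) (u v : ℝ) :
    cexp (-(I * v)) * (v * oneF1 s ((2 * s.re + 1 : ℝ) : ℂ) (I * u) *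
          oneF1 (s + 1) (((2 * s.re + 1 : ℝ) : ℂ) + 1) (I * v) -
        u * oneF1 (s + 1) (((2 * s.re + 1 : ℝ) : ℂ) + 1) (I * u) *
          oneF1 s ((2 * s.re + 1 : ℝ) : ℂ) (I * v)) =
      ((2 * s.re + 1 : ℝ) : ℂ) * (v - u) * waveKernel s u v := by
  have hb0 := re_ofReal_pos hs
  have hb1 : 0 < (((2 * s.re + 1 : ℝ) : ℂ) + 1).re := by simp; linarith
  have c0 := continuous_oneF1 (r := s) hb0
  have c1 := continuous_oneF1 (r := s + 1) hb1
  have hp : Continuous fun t : ℝ => ((t ^ (2 * s.re + 1) : ℝ) : ℂ) :=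
    Complex.continuous_ofReal.comp (Real.continuous_rpow_const (by linarith))
  have := intervalIntegral.integral_eq_sub_of_hasDerivAt_of_le (a := (0 : ℝ)) (b := 1) zero_le_one
    (Continuous.continuousOn (by fun_prop)) (fun t ht => hasDerivAt_christoffel hs u v ht.1) ?_
  · rw [intervalIntegral.integral_of_le zero_le_one, integral_const_mul] at this
    rw [waveKernel, this]
    simp [Real.zero_rpow (show 2 * s.re + 1 ≠ 0 by linarith)]
  · rw [intervalIntegrable_iff_integrableOn_Ioc_of_le zero_le_one]
    exact (integrableOn_waveKernel_integrand hs u v).const_mul _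

theorem continuous_waveKernel (hs : -(1 / 2 : ℝ) < s.re) :
    Continuous fun p : ℝ × ℝ => waveKernel s p.1 p.2 := by
  rw [continuous_iff_continuousAt]
  intro p₀
  unfold waveKernel
  refine continuousAt_of_dominated (bound := fun τ => Real.exp (waveType s * (‖p₀‖ + 1)) ^ 2 *
    τ ^ (2 * s.re)) ?_ ?_ ?_ ?_
  · exact Eventually.of_forall fun p => aestronglyMeasurable_waveKernel_integrand hs p.1 p.2 _
  · filter_upwards [Metric.ball_mem_nhds p₀ one_pos] with p hp
    filter_upwards [ae_restrict_mem measurableSet_Ioc] with τ hτ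
    have hn : ‖p‖ ≤ ‖p₀‖ + 1 := by
      have := norm_sub_norm_le p p₀
      rw [Metric.mem_ball, dist_eq_norm] at hp
      linarith
    exact norm_waveKernel_integrand_le hs ((norm_fst_le p).trans hn) ((norm_snd_le p).trans hn) hτ
  · exact (integrableOn_rpow_Ioc (c := 2 * s.re) (by linarith) zero_le_one).const_mul _
  · refine Eventually.of_forall fun τ => ?_
    have h := continuous_hypWave hs
    have h1 : Continuous fun p : ℝ × ℝ => hypWave s (p.1 * τ) *
        (starRingEnd ℂ) (hypWave s (p.2 * τ)) * ((τ ^ (2 * s.re) : ℝ) : ℂ) :=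
      ((h.comp (by fun_prop)).mul (Complex.continuous_conj.comp (h.comp (by fun_prop)))).mul
        continuous_const
    exact h1.continuousAt

theorem conj_waveKernel (s : ℂ) (u v : ℝ) :
    (starRingEnd ℂ) (waveKernel s u v) = waveKernel s v u := by
  unfold waveKernel
  rw [← integral_conj]
  congr 1
  ext τ
  simp only [map_mul, Complex.conj_conj, Complex.conj_ofReal]
  ring

end

/-- The positive constant relating `K_∞` and the wave kernel. -/
def waveConst (s : ℂ) : ℝ :=
  Real.exp (Real.pi * s.im) * ‖Gamma (s + 1)‖ ^ 2 /
    (2 * Real.pi * Real.Gamma (2 * s.re + 1) ^ 2)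

/-- The gauge factor relating `K_∞` and the wave kernel. -/
def waveGauge (s : ℂ) (x : ℝ) : ℂ :=
  (((2 / x) ^ (s.re + 1) / Real.sqrt 2 : ℝ) : ℂ) * cexp (-I / x)

section
variable {s : ℂ}

theorem waveConst_pos (hs : -(1 / 2 : ℝ) < s.re) : 0 < waveConst s := by
  have h1 : Gamma (s + 1) ≠ 0 := Complex.Gamma_ne_zero_of_re_pos (by simp; linarith)
  have h2 : 0 < Real.Gamma (2 * s.re + 1) := Real.Gamma_pos_of_pos (by linarith)
  unfold waveConst
  positivity

theorem cinf_mul_eq_waveConst (hs : -(1 / 2 : ℝ) < s.re) :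
    cinf s * (Real.exp (Real.pi * s.im) : ℝ) * ((2 * s.re + 1 : ℝ) : ℂ) = (waveConst s : ℂ) := by
  have hb : (2 * s.re + 1 : ℝ) ≠ 0 := by linarith
  have h2 : (Real.Gamma (2 * s.re + 1) : ℂ) ≠ 0 := by
    exact_mod_cast (Real.Gamma_pos_of_pos (by linarith)).ne'
  have hb' : ((2 * s.re + 1 : ℝ) : ℂ) ≠ 0 := by exact_mod_cast hb
  have hpi : (Real.pi : ℂ) ≠ 0 := by exact_mod_cast Real.pi_ne_zero
  have e : Gamma ((starRingEnd ℂ) s + 1) = (starRingEnd ℂ) (Gamma (s + 1)) := by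
    rw [← Complex.Gamma_conj]; simp
  have e2 : Gamma ((2 * s.re + 2 : ℝ) : ℂ) =
      ((2 * s.re + 1 : ℝ) : ℂ) * (Real.Gamma (2 * s.re + 1) : ℂ) := by
    rw [show (2 * s.re + 2 : ℝ) = 2 * s.re + 1 + 1 by ring, Complex.Gamma_ofReal,
      Real.Gamma_add_one hb]
    push_cast
    rfl
  rw [cinf, waveConst, e, Complex.mul_conj, e2, Complex.Gamma_ofReal, Complex.normSq_eq_norm_sq]
  push_cast at *
  field_simp

theorem prefac_of_pos (s : ℂ) {x : ℝ} (hx : 0 < x) : prefac s x =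
    (((2 / x) ^ s.re : ℝ) : ℂ) * cexp (-I / x + ((Real.pi * s.im / 2 : ℝ) : ℂ)) := by
  rw [prefac, abs_of_pos (by positivity), Real.sign_of_pos hx, mul_one]

theorem prefac_mul_prefac (s : ℂ) {x y : ℝ} (hx : 0 < x) (hy : 0 < y) :
    prefac s x * prefac s y * cexp (I * ((2 / y : ℝ) : ℂ)) * ((2 / x * (2 / y) / 2 : ℝ) : ℂ) =
      (Real.exp (Real.pi * s.im) : ℝ) * (waveGauge s x * (starRingEnd ℂ) (waveGauge s y)) := by
  have hsq : ((Real.sqrt 2 : ℝ) : ℂ)⁻¹ * ((Real.sqrt 2 : ℝ) : ℂ)⁻¹ = 1 / 2 := by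
    rw [← mul_inv, ← Complex.ofReal_mul, Real.mul_self_sqrt (by norm_num)]; norm_num
  rw [prefac_of_pos s hx, prefac_of_pos s hy, waveGauge, waveGauge, map_mul, Complex.conj_ofReal,
    ← Complex.exp_conj, Real.rpow_add_one (by positivity), Real.rpow_add_one (by positivity)]
  have hexp : cexp (-I / x + ((Real.pi * s.im / 2 : ℝ) : ℂ)) *
      cexp (-I / y + ((Real.pi * s.im / 2 : ℝ) : ℂ)) * cexp (I * ((2 / y : ℝ) : ℂ)) =
      (Real.exp (Real.pi * s.im) : ℝ) * (cexp (-I / x) * cexp ((starRingEnd ℂ) (-I / y))) := by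
    rw [Complex.ofReal_exp, ← Complex.exp_add, ← Complex.exp_add, ← Complex.exp_add,
      ← Complex.exp_add]
    congr 1
    simp only [map_div₀, map_neg, Complex.conj_I, Complex.conj_ofReal]
    push_cast
    ring
  generalize (2 / x) ^ s.re = p
  generalize (2 / y) ^ s.re = q
  push_cast at hexp ⊢
  linear_combination (p * q * (2 / x) * (2 / y) / 2 : ℂ) * hexp - (cexp (Real.pi * s.im) * p * q *
    (2 / x) * (2 / y) * cexp (-I / x) * cexp ((starRingEnd ℂ) (-I / y))) * hsq

theorem KinfC_eq_of_ne (hs : -(1 / 2 : ℝ) < s.re) {x y : ℝ} (hx : 0 < x) (hy : 0 < y)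
    (hxy : x ≠ y) : KinfC s x y = (waveConst s : ℂ) *
      (waveGauge s x * (starRingEnd ℂ) (waveGauge s y)) * waveKernel s (2 / x) (2 / y) := by
  have hc := christoffel_eq hs (2 / x) (2 / y)
  have hp := prefac_mul_prefac s hx hy
  have hx' : (x : ℂ) ≠ 0 := by exact_mod_cast hx.ne'
  have hy' : (y : ℂ) ≠ 0 := by exact_mod_cast hy.ne'
  have hne : (x : ℂ) - y ≠ 0 := by
    rw [← Complex.ofReal_sub]
    exact_mod_cast sub_ne_zero.mpr hxy
  have hb2 : ((2 * s.re + 2 : ℝ) : ℂ) = ((2 * s.re + 1 : ℝ) : ℂ) + 1 := by push_cast; ring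
  have ex : ∀ w : ℝ, 2 * I / (w : ℂ) = I * ((2 / w : ℝ) : ℂ) := by
    intro w; push_cast; ring
  rw [KinfC, if_neg hxy, ← cinf_mul_eq_waveConst hs, Ptilde, Ptilde, Qfun, Qfun, hb2, ex, ex,
    div_eq_iff hne]
  generalize oneF1 s ((2 * s.re + 1 : ℝ) : ℂ) (I * ((2 / x : ℝ) : ℂ)) = X at *
  generalize oneF1 s ((2 * s.re + 1 : ℝ) : ℂ) (I * ((2 / y : ℝ) : ℂ)) = Y at *
  generalize oneF1 (s + 1) (((2 * s.re + 1 : ℝ) : ℂ) + 1) (I * ((2 / x : ℝ) : ℂ)) = XB at *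
  generalize oneF1 (s + 1) (((2 * s.re + 1 : ℝ) : ℂ) + 1) (I * ((2 / y : ℝ) : ℂ)) = YB at *
  generalize waveKernel s (2 / x) (2 / y) = k at *
  have hc' : ((2 / y : ℝ) : ℂ) * X * YB - ((2 / x : ℝ) : ℂ) * XB * Y =
      cexp (I * ((2 / y : ℝ) : ℂ)) * (((2 * s.re + 1 : ℝ) : ℂ) *
        (((2 / y : ℝ) : ℂ) - ((2 / x : ℝ) : ℂ)) * k) := by
    rw [← hc, ← mul_assoc, ← Complex.exp_add, add_neg_cancel, Complex.exp_zero, one_mul]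
  have hd : ((2 / y : ℝ) : ℂ) - ((2 / x : ℝ) : ℂ) = ((2 / x * (2 / y) / 2 : ℝ) : ℂ) * (x - y) := by
    push_cast; field_simp
  rw [hd] at hc'
  have h2x : (2 / x : ℂ) = ((2 / x : ℝ) : ℂ) := by push_cast; rfl
  have h2y : (2 / y : ℂ) = ((2 / y : ℝ) : ℂ) := by push_cast; rfl
  rw [h2x, h2y]
  linear_combination (cinf s * prefac s x * prefac s y) * hc' +
    (cinf s * ((2 * s.re + 1 : ℝ) : ℂ) * k * (x - y)) * hp

theorem differentiableAt_prefac (s : ℂ) {x : ℝ} (hx : 0 < x) : DifferentiableAt ℝ (prefac s) x := by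
  have he : prefac s =ᶠ[nhds x] fun x : ℝ =>
      (((2 / x) ^ s.re : ℝ) : ℂ) * cexp (-I / x + ((Real.pi * s.im / 2 : ℝ) : ℂ)) := by
    filter_upwards [lt_mem_nhds hx] with y hy
    exact prefac_of_pos s hy
  refine DifferentiableAt.congr_of_eventuallyEq ?_ he
  have hx' : (x : ℂ) ≠ 0 := by exact_mod_cast hx.ne'
  have hof : DifferentiableAt ℝ (fun x : ℝ => (x : ℂ)) x := Complex.ofRealCLM.differentiableAt
  have h1 : DifferentiableAt ℝ (fun x : ℝ => (2 / x) ^ s.re) x := by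
    refine DifferentiableAt.rpow_const ?_ (Or.inl (by positivity))
    exact (differentiableAt_const _).div differentiableAt_id hx.ne'
  have h2 : DifferentiableAt ℝ (fun x : ℝ => (((2 / x) ^ s.re : ℝ) : ℂ)) x :=
    (Complex.ofRealCLM.differentiableAt).comp x h1
  exact h2.mul ((((differentiableAt_const _).div hof hx').add_const _).cexp)

theorem differentiableAt_oneF1_comp {r q : ℂ} (hq : 0 < q.re) {x : ℝ} (hx : 0 < x) :
    DifferentiableAt ℝ (fun x : ℝ => oneF1 r q (2 * I / (x : ℂ))) x := by
  have hx' : (x : ℂ) ≠ 0 := by exact_mod_cast hx.ne'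
  have hof : DifferentiableAt ℝ (fun x : ℝ => (x : ℂ)) x := Complex.ofRealCLM.differentiableAt
  have h1 : DifferentiableAt ℝ (fun x : ℝ => 2 * I / (x : ℂ)) x :=
    (differentiableAt_const _).div hof hx'
  exact (((differentiable_oneF1 (r := r) hq) _).restrictScalars ℝ).comp x h1

theorem continuousAt_waveGauge (s : ℂ) {x : ℝ} (hx : 0 < x) : ContinuousAt (waveGauge s) x := by
  have hx' : (x : ℂ) ≠ 0 := by exact_mod_cast hx.ne'
  have h1 : ContinuousAt (fun x : ℝ => (2 / x) ^ (s.re + 1)) x := by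
    refine ContinuousAt.rpow_const ?_ (Or.inl (by positivity))
    exact continuousAt_const.div continuousAt_id hx.ne'
  have h2 : ContinuousAt (fun x : ℝ => (((2 / x) ^ (s.re + 1) / Real.sqrt 2 : ℝ) : ℂ)) x :=
    Complex.continuous_ofReal.continuousAt.comp (h1.div_const _)
  refine h2.mul (ContinuousAt.cexp ?_)
  exact continuousAt_const.div Complex.continuous_ofReal.continuousAt hx'

/-- On the positive half-line `K_∞` is conjugate to a multiple of the wave kernel. -/
theorem KinfC_eq (hs : -(1 / 2 : ℝ) < s.re) {x y : ℝ} (hx : 0 < x) (hy : 0 < y) :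
    KinfC s x y = (waveConst s : ℂ) *
      (waveGauge s x * (starRingEnd ℂ) (waveGauge s y)) * waveKernel s (2 / x) (2 / y) := by
  rcases ne_or_eq x y with hxy | rfl
  · exact KinfC_eq_of_ne hs hx hy hxy
  have hx' : (x : ℂ) ≠ 0 := by exact_mod_cast hx.ne'
  have hof : DifferentiableAt ℝ (fun x : ℝ => (x : ℂ)) x := Complex.ofRealCLM.differentiableAt
  have hP : DifferentiableAt ℝ (Ptilde s) x :=
    (differentiableAt_prefac s hx).mul (differentiableAt_oneF1_comp (re_ofReal_pos hs) hx)
  have hQ : DifferentiableAt ℝ (Qfun s) x :=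
    (((differentiableAt_const _).div hof hx').mul (differentiableAt_prefac s hx)).mul
      (differentiableAt_oneF1_comp (by rw [Complex.ofReal_re]; linarith) hx)
  have hd := ((hP.hasDerivAt.mul_const (Qfun s x)).sub
    (hQ.hasDerivAt.mul_const (Ptilde s x))).const_mul (cinf s)
  rw [hasDerivAt_iff_tendsto_slope] at hd
  have hK : KinfC s x x = cinf s * (deriv (Ptilde s) x * Qfun s x -
    deriv (Qfun s) x * Ptilde s x) := if_pos rfl
  rw [← hK] at hd
  have hr : Tendsto (fun y : ℝ => (waveConst s : ℂ) *
      (waveGauge s y * (starRingEnd ℂ) (waveGauge s x)) * waveKernel s (2 / y) (2 / x))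
      (nhdsWithin x {x}ᶜ) (nhds ((waveConst s : ℂ) *
      (waveGauge s x * (starRingEnd ℂ) (waveGauge s x)) * waveKernel s (2 / x) (2 / x))) := by
    refine Tendsto.mono_left ?_ nhdsWithin_le_nhds
    have h1 : ContinuousAt (fun y : ℝ => waveKernel s (2 / y) (2 / x)) x :=
      ContinuousAt.comp (f := fun y : ℝ => (2 / y, 2 / x)) (continuous_waveKernel hs).continuousAt
        ((continuousAt_const.div continuousAt_id hx.ne').prodMk continuousAt_const)
    exact (continuousAt_const.mul ((continuousAt_waveGauge s hx).mul continuousAt_const)).mul h1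
  refine tendsto_nhds_unique hd (hr.congr' ?_)
  filter_upwards [self_mem_nhdsWithin, mem_nhdsWithin_of_mem_nhds (lt_mem_nhds hx)] with y hyx hy
  have hyx' : y ≠ x := hyx
  rw [← KinfC_eq_of_ne hs hy hx hyx', KinfC, if_neg hyx', slope_def_module]
  simp only [Pi.sub_apply]
  rw [Complex.real_smul]
  push_cast
  ring

end

theorem ringChoose_eq_poch (a : ℂ) (n : ℕ) :
    Ring.choose (a + n - 1) n = poch a n / n.factorial := by
  have h : ∀ n : ℕ, (ascPochhammer ℂ n).eval a = poch a n := by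
    intro n
    induction n with
    | zero => simp [poch_zero]
    | succ n ih => rw [ascPochhammer_succ_eval, ih, poch_succ]
  rw [Ring.choose_eq_smul, Polynomial.descPochhammer_smeval_eq_ascPochhammer,
    Polynomial.ascPochhammer_smeval_cast, Polynomial.ascPochhammer_smeval_eq_eval,
    show a + n - 1 - n + 1 = a by ring, h, smul_eq_mul, inv_mul_eq_div]

/-- The binomial series of `(1 - z)^{-a}`. -/
theorem hasSum_one_sub_cpow_neg (a : ℂ) {z : ℂ} (hz : ‖z‖ < 1) :
    HasSum (fun n : ℕ => poch a n / n.factorial * z ^ n) ((1 - z) ^ (-a)) := by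
  have hz' : z ∈ Metric.eball (0 : ℂ) 1 := by
    rw [Metric.mem_eball, edist_zero_right, enorm_eq_nnnorm]
    exact_mod_cast hz
  have := (Complex.one_div_one_sub_cpow_hasFPowerSeriesOnBall_zero a).hasSum hz'
  rw [zero_add, one_div, ← Complex.cpow_neg] at this
  have e : (fun n : ℕ => poch a n / n.factorial * z ^ n) = fun n : ℕ =>
      (FormalMultilinearSeries.ofScalars ℂ (fun n : ℕ => Ring.choose (a + n - 1) n) n)
        fun _ => z := by
    funext n
    rw [FormalMultilinearSeries.ofScalars_apply_eq, ringChoose_eq_poch, smul_eq_mul]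
  rw [e]
  exact this

theorem Gamma_add_natCast {b : ℂ} (hb : 0 < b.re) (n : ℕ) :
    Gamma (b + n) = poch b n * Gamma b := by
  induction n with
  | zero => simp [poch_zero]
  | succ n ih =>
    push_cast
    rw [← add_assoc, Complex.Gamma_add_one _ (add_natCast_ne_zero hb n), ih, poch_succ]
    ring

/-- The weight `u^{2 Re s} du` on the positive half-line. -/
def powMeasure (s : ℂ) : Measure ℝ :=
  (volume.restrict (Ioi 0)).withDensity fun u => ENNReal.ofReal (u ^ (2 * s.re))

theorem measurable_powDensity (s : ℂ) :
    Measurable fun u : ℝ => ENNReal.ofReal (u ^ (2 * s.re)) := by fun_prop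

section
variable {E : Type*} [NormedAddCommGroup E] [NormedSpace ℝ E]

theorem setIntegral_powMeasure (s : ℂ) (f : ℝ → E) {S : Set ℝ} (hS : MeasurableSet S)
    (hS0 : S ⊆ Ioi 0) :
    ∫ u in S, f u ∂(powMeasure s) = ∫ u in S, u ^ (2 * s.re) • f u := by
  rw [powMeasure, restrict_withDensity hS, Measure.restrict_restrict hS, inter_eq_left.mpr hS0,
    integral_withDensity_eq_integral_toReal_smul (measurable_powDensity s) (by simp)]
  refine setIntegral_congr_fun hS fun u hu => ?_
  have : 0 < u := hS0 hu
  rw [ENNReal.toReal_ofReal (by positivity)]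

theorem integrableOn_powMeasure_iff (s : ℂ) (f : ℝ → E) {S : Set ℝ} (hS : MeasurableSet S)
    (hS0 : S ⊆ Ioi 0) :
    IntegrableOn f S (powMeasure s) ↔ IntegrableOn (fun u => u ^ (2 * s.re) • f u) S := by
  rw [IntegrableOn, powMeasure, restrict_withDensity hS, Measure.restrict_restrict hS,
    inter_eq_left.mpr hS0, integrable_withDensity_iff_integrable_smul₀'
      (measurable_powDensity s).aemeasurable (by simp)]
  refine integrableOn_congr_fun (fun u hu => ?_) hS
  have : 0 < u := hS0 hu
  rw [ENNReal.toReal_ofReal (by positivity)]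

theorem powMeasure_restrict_Ioi (s : ℂ) : (powMeasure s).restrict (Ioi 0) = powMeasure s := by
  rw [powMeasure, restrict_withDensity measurableSet_Ioi, Measure.restrict_restrict
    measurableSet_Ioi, inter_self]

theorem integral_powMeasure (s : ℂ) (f : ℝ → E) :
    ∫ u, f u ∂(powMeasure s) = ∫ u in Ioi 0, u ^ (2 * s.re) • f u := by
  rw [← setIntegral_powMeasure s f measurableSet_Ioi subset_rfl, powMeasure_restrict_Ioi]

theorem integrable_powMeasure_iff (s : ℂ) (f : ℝ → E) :
    Integrable f (powMeasure s) ↔ IntegrableOn (fun u => u ^ (2 * s.re) • f u) (Ioi 0) := by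
  rw [← integrableOn_powMeasure_iff s f measurableSet_Ioi subset_rfl, IntegrableOn,
    powMeasure_restrict_Ioi]

end

theorem integral_rpow_mul_exp {s : ℂ} (hs : -(1 / 2 : ℝ) < s.re) {x : ℝ} (hx : 0 < x) (n : ℕ) :
    ∫ u in Ioi (0 : ℝ), u ^ (2 * s.re) * (u ^ n * Real.exp (-(x * u))) =
      (1 / x) ^ (2 * s.re + 1 + n) * Real.Gamma (2 * s.re + 1 + n) := by
  have hn : (0 : ℝ) ≤ n := Nat.cast_nonneg n
  rw [← Real.integral_rpow_mul_exp_neg_mul_Ioi (by linarith) hx]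
  refine setIntegral_congr_fun measurableSet_Ioi fun u hu => ?_
  have hu' : (0 : ℝ) < u := hu
  rw [← mul_assoc, ← Real.rpow_natCast u n, ← Real.rpow_add hu']
  congr 2
  ring

/-- The Laplace transform of the wave function. -/
theorem laplace_hypWave {s : ℂ} (hs : -(1 / 2 : ℝ) < s.re) {x τ : ℝ} (hτ : 0 < τ)
    (hx : waveType s * τ < x) :
    ∫ u, hypWave s (u * τ) * ((Real.exp (-(x * u)) : ℝ) : ℂ) ∂(powMeasure s) =
      (Real.Gamma (2 * s.re + 1) : ℂ) * (((1 / x) ^ (2 * s.re + 1) : ℝ) : ℂ) *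
        (1 - I * τ / x) ^ (-(s + 1)) := by
  have hL := waveType_pos s
  have hx0 : 0 < x := lt_trans (by positivity) hx
  have hb := re_ofReal_pos hs
  set b : ℂ := ((2 * s.re + 1 : ℝ) : ℂ) with hbdef
  have h1L : 1 ≤ waveType s := one_le_ratioBound _ _
  have hint : ∀ c : ℝ, 0 < c → IntegrableOn (fun u : ℝ => u ^ (2 * s.re) * Real.exp (-c * u))
      (Ioi 0) := fun c hc => integrableOn_rpow_mul_exp_neg_mul (by linarith) hc
  have hB : ∀ u : ℝ, HasSum (fun n : ℕ => u ^ (2 * s.re) * (Real.exp (-(x * u)) *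
      ((waveType s * τ * u) ^ n / n.factorial)))
      (u ^ (2 * s.re) * Real.exp (-(x - waveType s * τ) * u)) := by
    intro u
    have h := NormedSpace.expSeries_div_hasSum_exp (waveType s * τ * u)
    rw [← Real.exp_eq_exp_ℝ] at h
    have e : Real.exp (-(x - waveType s * τ) * u) =
        Real.exp (-(x * u)) * Real.exp (waveType s * τ * u) := by
      rw [← Real.exp_add]
      congr 1
      ring
    rw [e]
    exact (h.mul_left (Real.exp (-(x * u)))).mul_left (u ^ (2 * s.re))
  have key := hasSum_integral_of_dominated_convergence (μ := volume.restrict (Ioi (0 : ℝ)))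
    (F := fun (n : ℕ) (u : ℝ) => hypCoeff (s + 1) b n * (I * τ) ^ n *
      ((u ^ (2 * s.re) * (u ^ n * Real.exp (-(x * u))) : ℝ) : ℂ))
    (f := fun u => u ^ (2 * s.re) • (hypWave s (u * τ) * ((Real.exp (-(x * u)) : ℝ) : ℂ)))
    (fun n u => u ^ (2 * s.re) * (Real.exp (-(x * u)) *
      ((waveType s * τ * u) ^ n / n.factorial))) ?_ ?_ ?_ ?_ ?_
  · rw [integral_powMeasure]
    refine key.unique ?_
    have hz : ‖I * τ / x‖ < 1 := by
      rw [norm_div, norm_mul, Complex.norm_I, one_mul, Complex.norm_real, Complex.norm_real,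
        Real.norm_of_nonneg hτ.le, Real.norm_of_nonneg hx0.le, div_lt_one hx0]
      nlinarith
    refine ((hasSum_one_sub_cpow_neg (s + 1) hz).mul_left ((Real.Gamma (2 * s.re + 1) : ℂ) *
      (((1 / x) ^ (2 * s.re + 1) : ℝ) : ℂ))).congr_fun fun n => ?_
    rw [integral_const_mul, integral_complex_ofReal, integral_rpow_mul_exp hs hx0]
    have hG : (Real.Gamma (2 * s.re + 1 + n) : ℂ) = poch b n * (Real.Gamma (2 * s.re + 1) : ℂ) := by
      have := Gamma_add_natCast hb n
      rw [hbdef, ← Complex.ofReal_natCast, ← Complex.ofReal_add, Complex.Gamma_ofReal,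
        Complex.Gamma_ofReal] at this
      exact this
    rw [Real.rpow_add_natCast (by positivity)]
    push_cast at hG ⊢
    rw [hG, hypCoeff]
    have hp := poch_ne_zero hb n
    have hf : (n.factorial : ℂ) ≠ 0 := by exact_mod_cast n.factorial_ne_zero
    have hx' : (x : ℂ) ≠ 0 := by exact_mod_cast hx0.ne'
    field_simp
    rw [div_pow, div_pow, one_pow]
    ring
  · intro n
    have : Measurable fun u : ℝ => hypCoeff (s + 1) b n * (I * τ) ^ n *
      ((u ^ (2 * s.re) * (u ^ n * Real.exp (-(x * u))) : ℝ) : ℂ) := by fun_prop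
    exact this.aestronglyMeasurable
  · intro n
    filter_upwards [ae_restrict_mem measurableSet_Ioi] with u hu
    have hu' : (0 : ℝ) < u := hu
    rw [norm_mul, norm_mul, norm_pow, norm_mul, Complex.norm_I, one_mul, Complex.norm_real,
      Complex.norm_real, Real.norm_of_nonneg hτ.le, Real.norm_of_nonneg (by positivity)]
    have := norm_hypCoeff_le (r := s + 1) hb n
    calc _ ≤ ratioBound (s + 1) b ^ n / n.factorial * τ ^ n *
          (u ^ (2 * s.re) * (u ^ n * Real.exp (-(x * u)))) := by gcongr
      _ = _ := by
        rw [waveType, mul_pow, mul_pow]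
        ring
  · exact Eventually.of_forall fun u => (hB u).summable
  · simp_rw [fun u => (hB u).tsum_eq]
    exact hint _ (by linarith)
  · refine Eventually.of_forall fun u => ?_
    have := (hasSum_oneF1 (r := s + 1) hb (I * ((u * τ : ℝ) : ℂ))).mul_left
      ((u ^ (2 * s.re) * Real.exp (-(x * u)) : ℝ) : ℂ)
    have e : u ^ (2 * s.re) • (hypWave s (u * τ) * ((Real.exp (-(x * u)) : ℝ) : ℂ)) =
        ((u ^ (2 * s.re) * Real.exp (-(x * u)) : ℝ) : ℂ) *
          oneF1 (s + 1) b (I * ((u * τ : ℝ) : ℂ)) := by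
      rw [Complex.real_smul, hbdef]
      unfold hypWave
      push_cast
      ring
    rw [e]
    refine this.congr_fun fun n => ?_
    push_cast
    rw [hypCoeff]
    ring

/-- Finite sums of decaying exponentials. -/
def expSum {ι : Type*} (J : Finset ι) (α : ι → ℂ) (x : ι → ℝ) (u : ℝ) : ℂ :=
  ∑ j ∈ J, α j * ((Real.exp (-(x j * u)) : ℝ) : ℂ)

/-- The integral transform with kernel `hypWave s (u * τ)`. -/
def waveTransform (s : ℂ) (f : ℝ → ℂ) (τ : ℝ) : ℂ :=
  ∫ u, hypWave s (u * τ) * f u ∂(powMeasure s)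

section
variable {ι : Type*} {J : Finset ι} {α : ι → ℂ} {x : ι → ℝ} {s : ℂ}

theorem continuous_expSum : Continuous (expSum J α x) := by
  unfold expSum
  fun_prop

theorem integrable_exp_powMeasure (hs : -(1 / 2 : ℝ) < s.re) {c : ℝ} (hc : 0 < c) :
    Integrable (fun u : ℝ => Real.exp (-(c * u))) (powMeasure s) := by
  rw [integrable_powMeasure_iff]
  have := integrableOn_rpow_mul_exp_neg_mul (c := 2 * s.re) (by linarith) hc
  simpa only [neg_mul, smul_eq_mul] using this

theorem integral_exp_powMeasure (hs : -(1 / 2 : ℝ) < s.re) {c : ℝ} (hc : 0 < c) :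
    ∫ u, Real.exp (-(c * u)) ∂(powMeasure s) =
      Real.Gamma (2 * s.re + 1) * (1 / c) ^ (2 * s.re + 1) := by
  rw [integral_powMeasure]
  have := integral_rpow_mul_exp hs hc 0
  simpa [mul_comm] using this

theorem ofReal_norm_sq_expSum (u : ℝ) : ((‖expSum J α x u‖ ^ 2 : ℝ) : ℂ) =
    ∑ j ∈ J, ∑ k ∈ J, α j * (starRingEnd ℂ) (α k) *
      ((Real.exp (-((x j + x k) * u)) : ℝ) : ℂ) := by
  rw [Complex.ofReal_pow, ← Complex.mul_conj', expSum, map_sum, Finset.sum_mul_sum]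
  refine Finset.sum_congr rfl fun j _ => Finset.sum_congr rfl fun k _ => ?_
  rw [map_mul, Complex.conj_ofReal, add_mul, neg_add, Real.exp_add]
  push_cast
  ring

theorem integrable_expSum_aux (hs : -(1 / 2 : ℝ) < s.re) (hx : ∀ j ∈ J, 0 < x j) :
    ∀ j ∈ J, ∀ k ∈ J, Integrable (fun u : ℝ => α j * (starRingEnd ℂ) (α k) *
      ((Real.exp (-((x j + x k) * u)) : ℝ) : ℂ)) (powMeasure s) := fun j hj k hk =>
  ((integrable_exp_powMeasure hs (add_pos (hx j hj) (hx k hk))).ofReal).const_mul _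

theorem integrable_norm_sq_expSum (hs : -(1 / 2 : ℝ) < s.re) (hx : ∀ j ∈ J, 0 < x j) :
    Integrable (fun u => ‖expSum J α x u‖ ^ 2) (powMeasure s) := by
  have h : Integrable (fun u => ((‖expSum J α x u‖ ^ 2 : ℝ) : ℂ)) (powMeasure s) := by
    simp_rw [ofReal_norm_sq_expSum]
    exact integrable_finsetSum _ fun j hj => integrable_finsetSum _ fun k hk =>
      integrable_expSum_aux hs hx j hj k hk
  simpa only [RCLike.re_to_complex, Complex.ofReal_re] using h.re

theorem integral_norm_sq_expSum (hs : -(1 / 2 : ℝ) < s.re) (hx : ∀ j ∈ J, 0 < x j) :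
    ((∫ u, ‖expSum J α x u‖ ^ 2 ∂(powMeasure s) : ℝ) : ℂ) =
      ∑ j ∈ J, ∑ k ∈ J, α j * (starRingEnd ℂ) (α k) *
        ((Real.Gamma (2 * s.re + 1) * (1 / (x j + x k)) ^ (2 * s.re + 1) : ℝ) : ℂ) := by
  rw [← integral_complex_ofReal]
  simp_rw [ofReal_norm_sq_expSum]
  rw [integral_finsetSum _ fun j hj => integrable_finsetSum _ fun k hk =>
      integrable_expSum_aux hs hx j hj k hk]
  refine Finset.sum_congr rfl fun j hj => ?_
  rw [integral_finsetSum _ fun k hk => integrable_expSum_aux hs hx j hj k hk]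
  refine Finset.sum_congr rfl fun k hk => ?_
  rw [integral_const_mul, integral_complex_ofReal,
    integral_exp_powMeasure hs (add_pos (hx j hj) (hx k hk))]

/-- The exponential sum dual to `expSum J α x`. -/
theorem integral_norm_sq_expSum_dual (hs : -(1 / 2 : ℝ) < s.re) (hx : ∀ j ∈ J, 0 < x j) :
    ∫ u, ‖expSum J (fun j => α j * (((1 / x j) ^ (2 * s.re + 1) : ℝ) : ℂ))
        (fun j => 1 / x j) u‖ ^ 2 ∂(powMeasure s) =
      ∫ u, ‖expSum J α x u‖ ^ 2 ∂(powMeasure s) := by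
  have hx' : ∀ j ∈ J, 0 < 1 / x j := fun j hj => one_div_pos.mpr (hx j hj)
  apply Complex.ofReal_injective
  rw [integral_norm_sq_expSum hs hx', integral_norm_sq_expSum hs hx]
  refine Finset.sum_congr rfl fun j hj => Finset.sum_congr rfl fun k hk => ?_
  have hj := hx j hj
  have hk := hx k hk
  rw [map_mul, Complex.conj_ofReal]
  have e : (1 / x j) ^ (2 * s.re + 1) * (1 / x k) ^ (2 * s.re + 1) *
      (1 / (1 / x j + 1 / x k)) ^ (2 * s.re + 1) = (1 / (x j + x k)) ^ (2 * s.re + 1) := by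
    rw [← Real.mul_rpow (by positivity) (by positivity),
      ← Real.mul_rpow (by positivity) (by positivity)]
    congr 1
    field_simp
    ring
  rw [← e]
  push_cast
  ring

theorem one_sub_cpow_eq (a : ℂ) {x ρ : ℝ} (hx : 0 < x) (hρ : 0 < ρ) :
    (1 - I * ((1 / ρ : ℝ) : ℂ) / x) ^ (-a) =
      (-I * ((1 / ρ : ℝ) : ℂ)) ^ (-a) * (((1 / x : ℝ) : ℂ) + I * ρ) ^ (-a) := by
  have hx' : (x : ℂ) ≠ 0 := by exact_mod_cast hx.ne'
  have hρ' : (ρ : ℂ) ≠ 0 := by exact_mod_cast hρ.ne'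
  have e : 1 - I * ((1 / ρ : ℝ) : ℂ) / x =
      (-I * ((1 / ρ : ℝ) : ℂ)) * (((1 / x : ℝ) : ℂ) + I * ρ) := by
    push_cast
    field_simp
    ring_nf
    rw [Complex.I_sq]
    ring
  have hre : 0 < (((1 / x : ℝ) : ℂ) + I * ρ).re := by
    simp [hx]
  have h1 : (-I * ((1 / ρ : ℝ) : ℂ)) ≠ 0 := by
    push_cast
    simp [hρ']
  have h2 : (((1 / x : ℝ) : ℂ) + I * ρ) ≠ 0 := by
    intro h; rw [h] at hre; simp at hre
  have harg : arg (-I * ((1 / ρ : ℝ) : ℂ)) = -(Real.pi / 2) := by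
    rw [Complex.arg_mul_real (by positivity), Complex.arg_neg_I]
  have harg2 := Complex.abs_arg_lt_pi_div_two_iff.mpr (Or.inl hre)
  rw [abs_lt] at harg2
  rw [e, Complex.cpow_def_of_ne_zero (mul_ne_zero h1 h2), Complex.cpow_def_of_ne_zero h1,
    Complex.cpow_def_of_ne_zero h2, ← Complex.exp_add, Complex.log_mul h1 h2, add_mul]
  rw [harg]
  constructor <;> linarith [harg2.1, harg2.2, Real.pi_pos]

theorem norm_neg_I_mul_cpow (a : ℂ) {ρ : ℝ} (hρ : 0 < ρ) :
    ‖(-I * ((1 / ρ : ℝ) : ℂ)) ^ (-a)‖ = ρ ^ a.re * Real.exp (-(Real.pi / 2 * a.im)) := by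
  have h1 : (-I * ((1 / ρ : ℝ) : ℂ)) ≠ 0 := by
    simp [hρ.ne']
  rw [Complex.norm_cpow_of_ne_zero h1, Complex.arg_mul_real (by positivity), Complex.arg_neg_I,
    norm_mul, norm_neg, Complex.norm_I, one_mul, Complex.norm_real,
    Real.norm_of_nonneg (by positivity), Complex.neg_re, Complex.neg_im, one_div, Real.inv_rpow
    hρ.le, Real.rpow_neg hρ.le, inv_inv, neg_mul_neg, Real.exp_neg, div_eq_mul_inv]

/-- The Fourier side profile attached to an exponential sum. -/
def expProfile (s : ℂ) (J : Finset ι) (α : ι → ℂ) (x : ι → ℝ) : ℝ → ℂ :=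
  (Ioi (0 : ℝ)).indicator fun r => (r : ℂ) ^ ((s + 1) - 1) *
    expSum J (fun j => α j * (((1 / x j) ^ (2 * s.re + 1) : ℝ) : ℂ)) (fun j => 1 / x j) r

theorem expProfile_sum (r : ℝ) : (r : ℂ) ^ ((s + 1) - 1) *
    expSum J (fun j => α j * (((1 / x j) ^ (2 * s.re + 1) : ℝ) : ℂ)) (fun j => 1 / x j) r =
    ∑ j ∈ J, α j * (((1 / x j) ^ (2 * s.re + 1) : ℝ) : ℂ) *
      ((r : ℂ) ^ ((s + 1) - 1) * cexp (-(((1 / x j : ℝ) : ℂ) * r))) := by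
  rw [expSum, Finset.mul_sum]
  refine Finset.sum_congr rfl fun j _ => ?_
  push_cast
  ring

theorem integrable_expProfile (hs : -(1 / 2 : ℝ) < s.re) (hx : ∀ j ∈ J, 0 < x j) :
    Integrable (expProfile s J α x) := by
  rw [expProfile, integrable_indicator_iff measurableSet_Ioi]
  simp_rw [expProfile_sum]
  refine integrable_finsetSum _ fun j hj => Integrable.const_mul ?_ _
  refine integrableOn_cpow_mul_cexp_neg_mul (by simp; linarith) ?_
  rw [Complex.ofReal_re]
  exact one_div_pos.mpr (hx j hj)

theorem norm_sq_expProfile (r : ℝ) : ‖expProfile s J α x r‖ ^ 2 =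
    (Ioi (0 : ℝ)).indicator (fun r => r ^ (2 * s.re) * ‖expSum J
      (fun j => α j * (((1 / x j) ^ (2 * s.re + 1) : ℝ) : ℂ)) (fun j => 1 / x j) r‖ ^ 2) r := by
  by_cases hr : r ∈ Ioi (0 : ℝ)
  · have hr' : (0 : ℝ) < r := hr
    rw [expProfile, indicator_of_mem hr, indicator_of_mem hr, norm_mul, mul_pow,
      Complex.norm_cpow_eq_rpow_re_of_pos hr', add_sub_cancel_right, ← Real.rpow_natCast,
      ← Real.rpow_mul hr'.le]
    congr 2
    push_cast
    ring
  · rw [expProfile, indicator_of_notMem hr, indicator_of_notMem hr]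
    simp

theorem memLp_expProfile (hs : -(1 / 2 : ℝ) < s.re) (hx : ∀ j ∈ J, 0 < x j) :
    MemLp (expProfile s J α x) 2 := by
  rw [memLp_two_iff_integrable_sq_norm (integrable_expProfile hs hx).aestronglyMeasurable]
  simp_rw [norm_sq_expProfile]
  rw [integrable_indicator_iff measurableSet_Ioi]
  have := (integrable_powMeasure_iff s _).mp (integrable_norm_sq_expSum (s := s)
    (α := fun j => α j * (((1 / x j) ^ (2 * s.re + 1) : ℝ) : ℂ)) hs
    (fun j hj => one_div_pos.mpr (hx j hj)))
  simpa only [smul_eq_mul] using this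

theorem integral_norm_sq_expProfile (hs : -(1 / 2 : ℝ) < s.re) (hx : ∀ j ∈ J, 0 < x j) :
    ∫ r, ‖expProfile s J α x r‖ ^ 2 = ∫ u, ‖expSum J α x u‖ ^ 2 ∂(powMeasure s) := by
  rw [← integral_norm_sq_expSum_dual hs hx, integral_powMeasure]
  simp_rw [norm_sq_expProfile]
  rw [integral_indicator measurableSet_Ioi]
  simp only [smul_eq_mul]

open scoped FourierTransform in
theorem fourier_expProfile (hs : -(1 / 2 : ℝ) < s.re) (hx : ∀ j ∈ J, 0 < x j) (ξ : ℝ) :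
    𝓕 (expProfile s J α x) ξ = ∑ j ∈ J, α j * (((1 / x j) ^ (2 * s.re + 1) : ℝ) : ℂ) *
      ((((1 / x j : ℝ) : ℂ) + I * ((2 * Real.pi * ξ : ℝ) : ℂ)) ^ (-(s + 1)) * Gamma (s + 1)) := by
  rw [Real.fourier_eq']
  have e : ∀ v : ℝ, cexp (((-2 * Real.pi * inner ℝ v ξ : ℝ) : ℂ) * I) • expProfile s J α x v =
      (Ioi (0 : ℝ)).indicator (fun r => ∑ j ∈ J, α j * (((1 / x j) ^ (2 * s.re + 1) : ℝ) : ℂ) *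
        ((r : ℂ) ^ ((s + 1) - 1) * cexp (-((((1 / x j : ℝ) : ℂ) +
          I * ((2 * Real.pi * ξ : ℝ) : ℂ)) * r)))) v := by
    intro v
    by_cases hv : v ∈ Ioi (0 : ℝ)
    · rw [expProfile, indicator_of_mem hv, indicator_of_mem hv, expProfile_sum, smul_eq_mul,
        Finset.mul_sum]
      refine Finset.sum_congr rfl fun j _ => ?_
      rw [add_mul, neg_add, Complex.exp_add,
        show ((-2 * Real.pi * inner ℝ v ξ : ℝ) : ℂ) * I = -(I * ((2 * Real.pi * ξ : ℝ) : ℂ) * v) by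
          simp; ring]
      ring
    · rw [expProfile, indicator_of_notMem hv, indicator_of_notMem hv, smul_zero]
  simp_rw [e]
  have hre : ∀ j ∈ J, 0 < (((1 / x j : ℝ) : ℂ) + I * ((2 * Real.pi * ξ : ℝ) : ℂ)).re := by
    intro j hj
    rw [Complex.add_re, Complex.ofReal_re, Complex.re_mul_ofReal]
    simpa using hx j hj
  have ha : 0 < (s + 1).re := by simp; linarith
  rw [integral_indicator measurableSet_Ioi, integral_finsetSum]
  · refine Finset.sum_congr rfl fun j hj => ?_
    rw [integral_const_mul, integral_cpow_mul_cexp_neg_mul ha (hre j hj)]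
  · exact fun j hj => (integrableOn_cpow_mul_cexp_neg_mul ha (hre j hj)).const_mul _

theorem integrable_hypWave_mul_exp (hs : -(1 / 2 : ℝ) < s.re) {x τ : ℝ} (hτ : 0 ≤ τ)
    (hx : waveType s * τ < x) : Integrable (fun u : ℝ => hypWave s (u * τ) *
      ((Real.exp (-(x * u)) : ℝ) : ℂ)) (powMeasure s) := by
  refine (integrable_exp_powMeasure hs (sub_pos.mpr hx)).mono' ?_ ?_
  · have := continuous_hypWave hs
    exact Continuous.aestronglyMeasurable (by fun_prop)
  · rw [← powMeasure_restrict_Ioi]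
    filter_upwards [ae_restrict_mem measurableSet_Ioi] with u hu
    have hu' : (0 : ℝ) < u := hu
    rw [norm_mul, Complex.norm_real, Real.norm_of_nonneg (Real.exp_pos _).le]
    have := norm_hypWave_le hs (u * τ)
    rw [abs_of_nonneg (by positivity)] at this
    calc _ ≤ Real.exp (waveType s * (u * τ)) * Real.exp (-(x * u)) := by gcongr
      _ = _ := by
        rw [← Real.exp_add]
        congr 1
        ring

open scoped FourierTransform in
theorem waveTransform_expSum (hs : -(1 / 2 : ℝ) < s.re) {ξ : ℝ} (hξ : 0 < ξ)
    (hx : ∀ j ∈ J, waveType s * (1 / (2 * Real.pi * ξ)) < x j) :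
    waveTransform s (expSum J α x) (1 / (2 * Real.pi * ξ)) * Gamma (s + 1) =
      (Real.Gamma (2 * s.re + 1) : ℂ) *
        (-I * ((1 / (2 * Real.pi * ξ) : ℝ) : ℂ)) ^ (-(s + 1)) * 𝓕 (expProfile s J α x) ξ := by
  have hL := waveType_pos s
  have hπ := Real.pi_pos
  have hτ : 0 < 1 / (2 * Real.pi * ξ) := by positivity
  have hx0 : ∀ j ∈ J, 0 < x j := fun j hj => lt_trans (by positivity) (hx j hj)
  rw [fourier_expProfile hs hx0, waveTransform]
  have e : ∀ u : ℝ, hypWave s (u * (1 / (2 * Real.pi * ξ))) * expSum J α x u =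
      ∑ j ∈ J, α j * (hypWave s (u * (1 / (2 * Real.pi * ξ))) *
        ((Real.exp (-(x j * u)) : ℝ) : ℂ)) := by
    intro u
    rw [expSum, Finset.mul_sum]
    exact Finset.sum_congr rfl fun j _ => by ring
  simp_rw [e]
  rw [integral_finsetSum _ fun j hj =>
    (integrable_hypWave_mul_exp hs hτ.le (hx j hj)).const_mul _, Finset.sum_mul, Finset.mul_sum]
  refine Finset.sum_congr rfl fun j hj => ?_
  rw [integral_const_mul, laplace_hypWave hs hτ (hx j hj),
    one_sub_cpow_eq _ (hx0 j hj) (by positivity : 0 < 2 * Real.pi * ξ)]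
  ring

end

section
variable {ι : Type*} {J : Finset ι} {α : ι → ℂ} {x : ι → ℝ} {s : ℂ}

open scoped FourierTransform in
theorem norm_sq_waveTransform_expSum (hs : -(1 / 2 : ℝ) < s.re) {ξ : ℝ} (hξ : 0 < ξ)
    (hx : ∀ j ∈ J, waveType s * (1 / (2 * Real.pi * ξ)) < x j) :
    |-(1 / (2 * Real.pi * ξ ^ 2))| * (waveConst s * ((1 / (2 * Real.pi * ξ)) ^ (2 * s.re) *
      ‖waveTransform s (expSum J α x) (1 / (2 * Real.pi * ξ))‖ ^ 2)) =
    ‖𝓕 (expProfile s J α x) ξ‖ ^ 2 := by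
  have hπ := Real.pi_pos
  have h := congrArg norm (waveTransform_expSum (α := α) hs hξ hx)
  have hρ : 0 < 2 * Real.pi * ξ := by positivity
  have hB : 0 < Real.Gamma (2 * s.re + 1) := Real.Gamma_pos_of_pos (by linarith)
  rw [norm_mul, norm_mul, norm_mul, norm_neg_I_mul_cpow _ hρ, Complex.norm_real,
    Real.norm_of_nonneg hB.le] at h
  have hP : (1 / (2 * Real.pi * ξ)) ^ (2 * s.re) * ((2 * Real.pi * ξ) ^ (s + 1).re) ^ 2 =
      (2 * Real.pi * ξ) ^ 2 := by
    rw [one_div, Real.inv_rpow hρ.le, ← Real.rpow_neg hρ.le, ← Real.rpow_natCast, ←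
      Real.rpow_natCast, ← Real.rpow_mul hρ.le, ← Real.rpow_add hρ]
    congr 1
    simp
    ring
  have hE : Real.exp (Real.pi * s.im) * Real.exp (-(Real.pi / 2 * (s + 1).im)) ^ 2 = 1 := by
    rw [← Real.exp_nat_mul, ← Real.exp_add, ← Real.exp_zero]
    congr 1
    simp
    ring
  rw [abs_neg, abs_of_pos (by positivity), waveConst]
  set W := ‖waveTransform s (expSum J α x) (1 / (2 * Real.pi * ξ))‖
  set G := ‖Gamma (s + 1)‖
  set B := Real.Gamma (2 * s.re + 1)
  set F := ‖𝓕 (expProfile s J α x) ξ‖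
  set P := (2 * Real.pi * ξ) ^ (s + 1).re
  set r := (1 / (2 * Real.pi * ξ)) ^ (2 * s.re)
  set Q := Real.exp (Real.pi * s.im)
  set E := Real.exp (-(Real.pi / 2 * (s + 1).im))
  calc _ = 1 / (2 * Real.pi * ξ ^ 2) * (Q / (2 * Real.pi * B ^ 2) * r * (W * G) ^ 2) := by ring
    _ = 1 / (2 * Real.pi * ξ ^ 2) * (1 / (2 * Real.pi * B ^ 2) * (r * P ^ 2) * (Q * E ^ 2) *
        B ^ 2 * F ^ 2) := by rw [h]; ring
    _ = F ^ 2 := by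
      rw [hP, hE]
      field_simp

theorem contraction_expSum (hs : -(1 / 2 : ℝ) < s.re) {R : ℝ} (hR : 0 < R)
    (hx : ∀ j ∈ J, waveType s * R < x j) :
    IntegrableOn (fun τ => ‖waveTransform s (expSum J α x) τ‖ ^ 2) (Ioc 0 R) (powMeasure s) ∧
    waveConst s * ∫ τ in Ioc 0 R, ‖waveTransform s (expSum J α x) τ‖ ^ 2 ∂(powMeasure s) ≤
      ∫ u, ‖expSum J α x u‖ ^ 2 ∂(powMeasure s) := by
  have hπ := Real.pi_pos
  have hL := waveType_pos s
  have hc := waveConst_pos hs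
  have hx0 : ∀ j ∈ J, 0 < x j := fun j hj => lt_trans (by positivity) (hx j hj)
  obtain ⟨h1, h2⟩ := memLp_fourier_and_integral_norm_sq
    (integrable_expProfile (α := α) hs hx0) (memLp_expProfile hs hx0)
  set S : Set ℝ := Ici (1 / (2 * Real.pi * R))
  have hS0 : ∀ ξ ∈ S, 0 < ξ := fun ξ hξ => lt_of_lt_of_le (by positivity) (mem_Ici.mp hξ)
  have himg : (fun ξ : ℝ => 1 / (2 * Real.pi * ξ)) '' S = Ioc 0 R := by
    ext τ
    constructor
    · rintro ⟨ξ, hξ, rfl⟩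
      have h0 := hS0 ξ hξ
      refine ⟨by positivity, ?_⟩
      have h3 : 1 / (2 * Real.pi * R) ≤ ξ := hξ
      rw [div_le_iff₀ (by positivity)] at h3
      change 1 / (2 * Real.pi * ξ) ≤ R
      rw [div_le_iff₀ (by positivity)]
      linarith
    · rintro ⟨h3, h4⟩
      refine ⟨1 / (2 * Real.pi * τ), ?_, ?_⟩
      · change 1 / (2 * Real.pi * R) ≤ 1 / (2 * Real.pi * τ)
        gcongr
      · change 1 / (2 * Real.pi * (1 / (2 * Real.pi * τ))) = τ
        field_simp
  have hinj : InjOn (fun ξ : ℝ => 1 / (2 * Real.pi * ξ)) S := by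
    intro ξ hξ ζ hζ h
    have h0 := hS0 ξ hξ
    have h0' := hS0 ζ hζ
    simp only at h
    field_simp at h
    linarith
  have hder : ∀ ξ ∈ S, HasDerivWithinAt (fun ξ : ℝ => 1 / (2 * Real.pi * ξ))
      (-(1 / (2 * Real.pi * ξ ^ 2))) S ξ := by
    intro ξ hξ
    have h0 := hS0 ξ hξ
    have h3 := ((hasDerivAt_inv h0.ne').const_mul (1 / (2 * Real.pi))).hasDerivWithinAt (s := S)
    have e : (fun ξ : ℝ => 1 / (2 * Real.pi * ξ)) = fun y => 1 / (2 * Real.pi) * y⁻¹ := by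
      funext y
      rw [one_div, one_div, mul_inv]
    rw [e]
    refine h3.congr_deriv ?_
    field_simp
  have hpt : ∀ ξ ∈ S, ‖FourierTransform.fourier (expProfile s J α x) ξ‖ ^ 2 =
      |-(1 / (2 * Real.pi * ξ ^ 2))| • (waveConst s * ((1 / (2 * Real.pi * ξ)) ^ (2 * s.re) *
      ‖waveTransform s (expSum J α x) (1 / (2 * Real.pi * ξ))‖ ^ 2)) := by
    intro ξ hξ
    rw [smul_eq_mul, norm_sq_waveTransform_expSum hs (hS0 ξ hξ)]
    intro j hj
    have : 1 / (2 * Real.pi * ξ) ∈ Ioc 0 R := himg ▸ ⟨ξ, hξ, rfl⟩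
    exact lt_of_le_of_lt (by gcongr; exact this.2) (hx j hj)
  have hint := (memLp_two_iff_integrable_sq_norm h1.1).mp h1
  have hIoc : Ioc 0 R ⊆ Ioi 0 := fun τ hτ => hτ.1
  have hI : IntegrableOn (fun τ => waveConst s * (τ ^ (2 * s.re) *
      ‖waveTransform s (expSum J α x) τ‖ ^ 2)) (Ioc 0 R) := by
    rw [← himg, integrableOn_image_iff_integrableOn_abs_deriv_smul measurableSet_Ici hder hinj]
    exact (integrableOn_congr_fun hpt measurableSet_Ici).mp hint.integrableOn
  constructor
  · rw [integrableOn_powMeasure_iff s _ measurableSet_Ioc hIoc]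
    have h3 := hI.const_mul (waveConst s)⁻¹
    refine h3.congr (Eventually.of_forall fun τ => ?_)
    simp only [smul_eq_mul]
    field_simp
  · rw [setIntegral_powMeasure s _ measurableSet_Ioc hIoc, ← integral_const_mul]
    simp only [smul_eq_mul]
    rw [← himg, integral_image_eq_integral_abs_deriv_smul measurableSet_Ici hder hinj,
      ← setIntegral_congr_fun measurableSet_Ici hpt, ← integral_norm_sq_expProfile hs hx0, ← h2]
    exact setIntegral_le_integral hint (Eventually.of_forall fun ξ => by positivity)

end

theorem exists_complex_polynomial_near {g : ℝ → ℂ} (hg : Continuous g) {ε : ℝ} (hε : 0 < ε) :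
    ∃ P : Polynomial ℂ, ∀ y ∈ Icc (0 : ℝ) 1, ‖g y - P.eval (y : ℂ)‖ ≤ ε := by
  obtain ⟨p, hp⟩ := exists_polynomial_near_of_continuousOn 0 1 (fun y => (g y).re)
    (Complex.continuous_re.comp hg).continuousOn (ε / 2) (by positivity)
  obtain ⟨q, hq⟩ := exists_polynomial_near_of_continuousOn 0 1 (fun y => (g y).im)
    (Complex.continuous_im.comp hg).continuousOn (ε / 2) (by positivity)
  refine ⟨p.map Complex.ofRealHom + Polynomial.C I * q.map Complex.ofRealHom, fun y hy => ?_⟩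
  have he : ∀ r : Polynomial ℝ, (r.map Complex.ofRealHom).eval (y : ℂ) = ((r.eval y : ℝ) : ℂ) :=
    fun r => Polynomial.eval_map_apply Complex.ofRealHom y
  rw [Polynomial.eval_add, Polynomial.eval_mul, Polynomial.eval_C, he, he]
  have e : g y - (((p.eval y : ℝ) : ℂ) + I * ((q.eval y : ℝ) : ℂ)) =
      -(((p.eval y - (g y).re : ℝ) : ℂ) + ((q.eval y - (g y).im : ℝ) : ℂ) * I) := by
    nth_rewrite 1 [← Complex.re_add_im (g y)]
    push_cast
    ring
  rw [e, norm_neg]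
  refine (norm_add_le _ _).trans ?_
  rw [norm_mul, Complex.norm_I, mul_one, Complex.norm_real, Complex.norm_real, Real.norm_eq_abs,
    Real.norm_eq_abs]
  linarith [hp y hy, hq y hy]

theorem integral_norm_sq_le_of_eLpNorm_le {X : Type*} [MeasurableSpace X] {m : Measure X}
    {f : X → ℂ} (hf : MemLp f 2 m) {δ : ℝ} (hδ : 0 ≤ δ) (h : eLpNorm f 2 m ≤ ENNReal.ofReal δ) :
    ∫ x, ‖f x‖ ^ 2 ∂m ≤ δ ^ 2 := by
  rw [hf.eLpNorm_eq_integral_rpow_norm (by simp) (by simp), ENNReal.ofReal_le_ofReal_iff hδ] at h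
  simp only [ENNReal.toReal_ofNat, Real.rpow_ofNat] at h
  rw [← one_div, ← Real.sqrt_eq_rpow] at h
  exact (Real.sqrt_le_left hδ).mp h

/-- Polynomials in a bounded variable are dense in `L²`. -/
theorem exists_polynomial_integral_norm_sq_sub_le {m : Measure ℝ} [IsFiniteMeasure m]
    (hm : ∀ᵐ u ∂m, 0 < u) {F : ℝ → ℂ} (hF : Measurable F) (hF2 : MemLp F 2 m) {δ : ℝ}
    (hδ : 0 < δ) : ∃ P : Polynomial ℂ,
      MemLp (fun u : ℝ => F u - P.eval ((Real.exp (-u) : ℝ) : ℂ)) 2 m ∧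
      ∫ u, ‖F u - P.eval ((Real.exp (-u) : ℝ) : ℂ)‖ ^ 2 ∂m ≤ δ ^ 2 := by
  have hmeas : Measurable fun u : ℝ => Real.exp (-u) := by fun_prop
  set m' := m.map fun u : ℝ => Real.exp (-u)
  set G : ℝ → ℂ := fun y => F (-Real.log y)
  have hG : Measurable G := hF.comp (by fun_prop)
  have hGF : G ∘ (fun u : ℝ => Real.exp (-u)) = F := by
    funext u
    simp [G]
  have hG2 : MemLp G 2 m' := by
    rw [memLp_map_measure_iff hG.aestronglyMeasurable hmeas.aemeasurable, hGF]
    exact hF2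
  have : IsFiniteMeasure m' := Measure.isFiniteMeasure_map _ _
  obtain ⟨g, -, hg, hgc, hg2⟩ := hG2.exists_hasCompactSupport_eLpNorm_sub_le (by simp)
    (ε := ENNReal.ofReal (δ / 2)) (by simpa using hδ)
  set A : ℝ := m.real univ
  have hA : 0 ≤ A := measureReal_nonneg
  obtain ⟨P, hP⟩ := exists_complex_polynomial_near hgc (ε := δ / (2 * (A ^ (2 : ℝ)⁻¹ + 1)))
    (by positivity)
  have hPm : Measurable fun u : ℝ => P.eval ((Real.exp (-u) : ℝ) : ℂ) := by
    have : Continuous fun u : ℝ => P.eval ((Real.exp (-u) : ℝ) : ℂ) :=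
      P.continuous.comp (by fun_prop)
    exact this.measurable
  have hge : MemLp (fun u : ℝ => g (Real.exp (-u))) 2 m := hg2.comp_of_map hmeas.aemeasurable
  have hb : ∀ᵐ u ∂m, ‖g (Real.exp (-u)) - P.eval ((Real.exp (-u) : ℝ) : ℂ)‖ ≤
      δ / (2 * (A ^ (2 : ℝ)⁻¹ + 1)) := by
    filter_upwards [hm] with u hu
    exact hP _ ⟨(Real.exp_pos _).le, Real.exp_le_one_iff.mpr (by linarith)⟩
  have hd : MemLp (fun u : ℝ => g (Real.exp (-u)) - P.eval ((Real.exp (-u) : ℝ) : ℂ)) 2 m :=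
    MemLp.of_bound (hge.1.sub hPm.aestronglyMeasurable) _ hb
  have hFg : MemLp (fun u : ℝ => F u - g (Real.exp (-u))) 2 m := hF2.sub hge
  have e : (fun u : ℝ => F u - P.eval ((Real.exp (-u) : ℝ) : ℂ)) =
      (fun u : ℝ => F u - g (Real.exp (-u))) +
      fun u : ℝ => g (Real.exp (-u)) - P.eval ((Real.exp (-u) : ℝ) : ℂ) := by
    funext u
    simp
  have hmem : MemLp (fun u : ℝ => F u - P.eval ((Real.exp (-u) : ℝ) : ℂ)) 2 m := by
    rw [e]
    exact hFg.add hd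
  refine ⟨P, hmem, integral_norm_sq_le_of_eLpNorm_le hmem hδ.le ?_⟩
  rw [e]
  refine (eLpNorm_add_le hFg.1 hd.1 (by norm_num)).trans ?_
  have h1 : eLpNorm (fun u : ℝ => F u - g (Real.exp (-u))) 2 m ≤ ENNReal.ofReal (δ / 2) := by
    rw [eLpNorm_map_measure (hG2.1.sub hg2.1) hmeas.aemeasurable] at hg
    convert hg using 2
    funext u
    simp [G]
  have h2 : eLpNorm (fun u : ℝ => g (Real.exp (-u)) - P.eval ((Real.exp (-u) : ℝ) : ℂ)) 2 m ≤
      ENNReal.ofReal (δ / 2) := by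
    refine (eLpNorm_le_of_ae_bound hb).trans ?_
    rw [← ofReal_measureReal, ENNReal.toReal_ofNat, ENNReal.ofReal_rpow_of_nonneg hA (by norm_num),
      ← ENNReal.ofReal_mul (by positivity)]
    refine ENNReal.ofReal_le_ofReal ?_
    rw [mul_div_assoc', div_le_div_iff₀ (by positivity) (by positivity)]
    have : 0 ≤ A ^ (2 : ℝ)⁻¹ := by positivity
    nlinarith
  calc _ ≤ ENNReal.ofReal (δ / 2) + ENNReal.ofReal (δ / 2) := add_le_add h1 h2
    _ = ENNReal.ofReal δ := by rw [← ENNReal.ofReal_add (by positivity) (by positivity), add_halves]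

section
variable {s : ℂ}

theorem ae_powMeasure_pos (s : ℂ) : ∀ᵐ u ∂(powMeasure s), 0 < u := by
  rw [← powMeasure_restrict_Ioi]
  exact ae_restrict_mem measurableSet_Ioi

/-- The finite measure `e^{-2u} u^{2 Re s} du` on the positive half-line. -/
def expMeasure (s : ℂ) : Measure ℝ :=
  (powMeasure s).withDensity fun u => ENNReal.ofReal (Real.exp (-(2 * u)))

theorem measurable_expDensity : Measurable fun u : ℝ => ENNReal.ofReal (Real.exp (-(2 * u))) := by
  fun_prop

theorem isFiniteMeasure_expMeasure (hs : -(1 / 2 : ℝ) < s.re) : IsFiniteMeasure (expMeasure s) :=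
  isFiniteMeasure_withDensity_ofReal (integrable_exp_powMeasure hs (by norm_num)).2

theorem expMeasure_le (s : ℂ) : expMeasure s ≤ powMeasure s := by
  rw [expMeasure]
  conv_rhs => rw [← withDensity_one (μ := powMeasure s)]
  refine withDensity_mono ?_
  filter_upwards [ae_powMeasure_pos s] with u hu
  rw [Pi.one_apply, ENNReal.ofReal_le_one]
  exact Real.exp_le_one_iff.mpr (by linarith)

theorem integral_expMeasure (s : ℂ) (f : ℝ → ℝ) :
    ∫ u, f u ∂(expMeasure s) = ∫ u, Real.exp (-(2 * u)) * f u ∂(powMeasure s) := by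
  rw [expMeasure, integral_withDensity_eq_integral_toReal_smul measurable_expDensity (by simp)]
  simp [ENNReal.toReal_ofReal (Real.exp_pos _).le]

theorem integrable_expMeasure_iff (s : ℂ) (f : ℝ → ℝ) :
    Integrable f (expMeasure s) ↔
      Integrable (fun u => Real.exp (-(2 * u)) * f u) (powMeasure s) := by
  rw [expMeasure, integrable_withDensity_iff_integrable_smul₀' measurable_expDensity.aemeasurable
    (by simp)]
  simp [ENNReal.toReal_ofReal (Real.exp_pos _).le]

theorem integrable_waveTransform (hs : -(1 / 2 : ℝ) < s.re) {R τ : ℝ} (hτ : τ ∈ Icc 0 R)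
    {f : ℝ → ℂ} (hf : AEStronglyMeasurable f (powMeasure s))
    (hint : Integrable (fun u => Real.exp (waveType s * R * u) * ‖f u‖) (powMeasure s)) :
    Integrable (fun u => hypWave s (u * τ) * f u) (powMeasure s) ∧
    ‖waveTransform s f τ‖ ≤ ∫ u, Real.exp (waveType s * R * u) * ‖f u‖ ∂(powMeasure s) := by
  have hL := waveType_pos s
  have hb : ∀ᵐ u ∂(powMeasure s), ‖hypWave s (u * τ) * f u‖ ≤
      Real.exp (waveType s * R * u) * ‖f u‖ := by
    filter_upwards [ae_powMeasure_pos s] with u hu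
    rw [norm_mul]
    have := norm_hypWave_le hs (u * τ)
    rw [abs_of_nonneg (mul_nonneg hu.le hτ.1)] at this
    gcongr
    refine this.trans (Real.exp_le_exp.mpr ?_)
    have h2 : u * τ ≤ u * R := by gcongr; exact hτ.2
    calc waveType s * (u * τ) ≤ waveType s * (u * R) := by gcongr
      _ = _ := by ring
  have hc : Continuous fun u : ℝ => hypWave s (u * τ) := by
    have := continuous_hypWave hs
    fun_prop
  exact ⟨hint.mono' (hc.aestronglyMeasurable.mul hf) hb, norm_integral_le_of_norm_le hint hb⟩

theorem sq_add_le_mul_add_mul {ε : ℝ} (hε : 0 < ε) (a b : ℝ) :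
    (a + b) ^ 2 ≤ (1 + ε) * a ^ 2 + (1 + 1 / ε) * b ^ 2 := by
  have h : (1 + ε) * a ^ 2 + (1 + 1 / ε) * b ^ 2 - (a + b) ^ 2 = (ε * a - b) ^ 2 / ε := by
    field_simp
    ring
  have : 0 ≤ (ε * a - b) ^ 2 / ε := by positivity
  linarith

theorem expSum_polynomial (P : Polynomial ℂ) (X u : ℝ) :
    expSum (Finset.range (P.natDegree + 1)) P.coeff (fun i => X + i) u =
      ((Real.exp (-(X * u)) : ℝ) : ℂ) * P.eval ((Real.exp (-u) : ℝ) : ℂ) := by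
  rw [Polynomial.eval_eq_sum_range, Finset.mul_sum, expSum]
  refine Finset.sum_congr rfl fun i _ => ?_
  rw [← Complex.ofReal_pow, ← Real.exp_nat_mul, mul_left_comm, ← Complex.ofReal_mul,
    ← Real.exp_add]
  congr 3
  ring

theorem exists_expSum_near (hs : -(1 / 2 : ℝ) < s.re) {T R : ℝ} (hR : 0 < R) {f : ℝ → ℂ}
    (hf : Measurable f) (hT : ∀ u, T < u → f u = 0) (hf2 : MemLp f 2 (powMeasure s))
    {δ : ℝ} (hδ : 0 < δ) : ∃ (n : ℕ) (α : ℕ → ℂ) (x : ℕ → ℝ),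
      (∀ j ∈ Finset.range n, waveType s * R < x j) ∧
      Integrable (fun u => ‖f u - expSum (Finset.range n) α x u‖ ^ 2) (powMeasure s) ∧
      ∫ u, ‖f u - expSum (Finset.range n) α x u‖ ^ 2 ∂(powMeasure s) ≤ δ ^ 2 ∧
      Integrable (fun u => Real.exp (waveType s * R * u) * ‖f u - expSum (Finset.range n) α x u‖)
        (powMeasure s) ∧
      ∫ u, Real.exp (waveType s * R * u) * ‖f u - expSum (Finset.range n) α x u‖ ∂(powMeasure s) ≤
        δ * ((expMeasure s).real univ + 1) := by
  have hL := waveType_pos s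
  have := isFiniteMeasure_expMeasure hs
  set X : ℝ := waveType s * R + 2
  have hX : 2 ≤ X := by
    have : 0 < waveType s * R := by positivity
    linarith
  set F : ℝ → ℂ := fun u => f u * ((Real.exp (X * u) : ℝ) : ℂ)
  have hF : Measurable F := by fun_prop
  have hF2' : MemLp F 2 (powMeasure s) := by
    refine (hf2.const_mul ((Real.exp (X * |T|) : ℝ) : ℂ)).of_le hF.aestronglyMeasurable ?_
    filter_upwards [ae_powMeasure_pos s] with u hu
    rcases le_or_gt u T with h | h
    · rw [norm_mul, norm_mul, mul_comm, Complex.norm_real, Complex.norm_real,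
        Real.norm_of_nonneg (Real.exp_pos _).le, Real.norm_of_nonneg (Real.exp_pos _).le]
      gcongr
      exact h.trans (le_abs_self T)
    · simp [F, hT u h]
  have hF2 : MemLp F 2 (expMeasure s) := hF2'.mono_measure (expMeasure_le s)
  have hpos : ∀ᵐ u ∂(expMeasure s), 0 < u :=
    (Measure.absolutelyContinuous_of_le (expMeasure_le s)).ae_le (ae_powMeasure_pos s)
  obtain ⟨P, hP, hPδ⟩ := exists_polynomial_integral_norm_sq_sub_le hpos hF hF2 hδ
  set E : ℝ → ℂ := fun u => F u - P.eval ((Real.exp (-u) : ℝ) : ℂ)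
  have hE2 : Integrable (fun u => ‖E u‖ ^ 2) (expMeasure s) :=
    (memLp_two_iff_integrable_sq_norm hP.1).mp hP
  have hE1 : Integrable (fun u => ‖E u‖) (expMeasure s) :=
    (hP.integrable (by norm_num)).norm
  have hE2μ := (integrable_expMeasure_iff s _).mp hE2
  have hE1μ := (integrable_expMeasure_iff s _).mp hE1
  have hD : ∀ u, ‖f u - expSum (Finset.range (P.natDegree + 1)) P.coeff (fun i => X + i) u‖ =
      Real.exp (-(X * u)) * ‖E u‖ := by
    intro u
    have : f u - expSum (Finset.range (P.natDegree + 1)) P.coeff (fun i => X + i) u =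
        ((Real.exp (-(X * u)) : ℝ) : ℂ) * E u := by
      rw [expSum_polynomial, mul_sub, mul_left_comm, ← Complex.ofReal_mul, ← Real.exp_add]
      simp
    rw [this, norm_mul, Complex.norm_real, Real.norm_of_nonneg (Real.exp_pos _).le]
  have hDsq : ∀ᵐ u ∂(powMeasure s), ‖f u - expSum (Finset.range (P.natDegree + 1)) P.coeff
      (fun i => X + i) u‖ ^ 2 ≤ Real.exp (-(2 * u)) * ‖E u‖ ^ 2 := by
    filter_upwards [ae_powMeasure_pos s] with u hu
    rw [hD, mul_pow, ← Real.exp_nat_mul]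
    gcongr
    push_cast
    nlinarith
  have hD1 : ∀ u, Real.exp (waveType s * R * u) * ‖f u - expSum (Finset.range (P.natDegree + 1))
      P.coeff (fun i => X + i) u‖ = Real.exp (-(2 * u)) * ‖E u‖ := by
    intro u
    rw [hD, ← mul_assoc, ← Real.exp_add]
    congr 2
    simp only [X]
    ring
  have hmeas : AEStronglyMeasurable (fun u => ‖f u - expSum (Finset.range (P.natDegree + 1))
      P.coeff (fun i => X + i) u‖ ^ 2) (powMeasure s) :=
    ((hf.sub continuous_expSum.measurable).norm.pow_const 2).aestronglyMeasurable
  refine ⟨P.natDegree + 1, P.coeff, fun i => X + i, fun j _ => ?_, ?_, ?_, ?_, ?_⟩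
  · have : (0 : ℝ) ≤ j := Nat.cast_nonneg j
    simp only [X]
    linarith
  · refine hE2μ.mono' hmeas ?_
    filter_upwards [hDsq] with u hu
    rwa [Real.norm_of_nonneg (by positivity)]
  · rw [integral_expMeasure] at hPδ
    exact (integral_mono_of_nonneg (Eventually.of_forall fun u => by positivity) hE2μ hDsq).trans
      hPδ
  · simp_rw [hD1]
    exact hE1μ
  · simp_rw [hD1]
    rw [← integral_expMeasure]
    have hb : ∀ u, ‖E u‖ ≤ δ / 2 + 1 / (2 * δ) * ‖E u‖ ^ 2 := by
      intro u
      have : δ / 2 + 1 / (2 * δ) * ‖E u‖ ^ 2 - ‖E u‖ = (‖E u‖ - δ) ^ 2 / (2 * δ) := by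
        field_simp
        ring
      have h2 : 0 ≤ (‖E u‖ - δ) ^ 2 / (2 * δ) := by positivity
      linarith
    have hi : Integrable (fun u => δ / 2 + 1 / (2 * δ) * ‖E u‖ ^ 2) (expMeasure s) :=
      (integrable_const (δ / 2)).add (hE2.const_mul (1 / (2 * δ)))
    calc _ ≤ ∫ u, (δ / 2 + 1 / (2 * δ) * ‖E u‖ ^ 2) ∂(expMeasure s) :=
          integral_mono hE1 hi hb
      _ = (expMeasure s).real univ * (δ / 2) + 1 / (2 * δ) * ∫ u, ‖E u‖ ^ 2 ∂(expMeasure s) := by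
          rw [integral_add (integrable_const _) (hE2.const_mul _), integral_const,
            integral_const_mul, smul_eq_mul]
      _ ≤ (expMeasure s).real univ * (δ / 2) + 1 / (2 * δ) * δ ^ 2 := by gcongr
      _ ≤ _ := by
          have h0 : 0 ≤ (expMeasure s).real univ := measureReal_nonneg
          have : 1 / (2 * δ) * δ ^ 2 = δ / 2 := by field_simp
          rw [this]
          nlinarith

theorem isFiniteMeasure_powMeasure_Ioc (hs : -(1 / 2 : ℝ) < s.re) (R : ℝ) :
    IsFiniteMeasure ((powMeasure s).restrict (Ioc 0 R)) := by
  rcases le_or_gt R 0 with h | h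
  · rw [Ioc_eq_empty (by simpa using h), Measure.restrict_empty]
    infer_instance
  have h1 : IntegrableOn (fun _ : ℝ => (1 : ℝ)) (Ioc 0 R) (powMeasure s) := by
    rw [integrableOn_powMeasure_iff s _ measurableSet_Ioc fun u hu => hu.1]
    simpa using integrableOn_rpow_Ioc (c := 2 * s.re) (by linarith) h.le
  rcases integrable_const_iff.mp h1 with h2 | h2
  · simp at h2
  · exact h2

/-- The integral transform is a contraction from `L²` of bounded support to `L²(0, R)`. -/
theorem contraction (hs : -(1 / 2 : ℝ) < s.re) {T R : ℝ} (hR : 0 < R) {f : ℝ → ℂ}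
    (hf : Measurable f) (hT : ∀ u, T < u → f u = 0) (hf2 : MemLp f 2 (powMeasure s)) :
    waveConst s * ∫ τ in Ioc 0 R, ‖waveTransform s f τ‖ ^ 2 ∂(powMeasure s) ≤
      ∫ u, ‖f u‖ ^ 2 ∂(powMeasure s) := by
  have hL := waveType_pos s
  have hc := waveConst_pos hs
  have := isFiniteMeasure_powMeasure_Ioc hs R
  set A : ℝ := (expMeasure s).real univ
  set B : ℝ := ((powMeasure s).restrict (Ioc 0 R)).real univ
  set N : ℝ := ∫ u, ‖f u‖ ^ 2 ∂(powMeasure s)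
  have hfi : Integrable (fun u => ‖f u‖ ^ 2) (powMeasure s) :=
    (memLp_two_iff_integrable_sq_norm hf2.1).mp hf2
  have key : ∀ ε : ℝ, 0 < ε →
      waveConst s * ∫ τ in Ioc 0 R, ‖waveTransform s f τ‖ ^ 2 ∂(powMeasure s) ≤
      (1 + ε) * ((1 + ε) * N + (ε ^ 2 + ε)) + waveConst s * ((ε ^ 2 + ε) * (A + 1) ^ 2 * B) := by
    intro ε hε
    obtain ⟨n, α, x, hx, hD2, hD2', hD1, hD1'⟩ := exists_expSum_near hs hR hf hT hf2 hε
    obtain ⟨hS, hS'⟩ := contraction_expSum (α := α) hs hR hx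
    have hx0 : ∀ j ∈ Finset.range n, 0 < x j := fun j hj => lt_trans (by positivity) (hx j hj)
    have hSi := integrable_norm_sq_expSum (α := α) hs hx0
    have hN : ∫ u, ‖expSum (Finset.range n) α x u‖ ^ 2 ∂(powMeasure s) ≤
        (1 + ε) * N + (ε ^ 2 + ε) := by
      calc _ ≤ ∫ u, ((1 + ε) * ‖f u‖ ^ 2 + (1 + 1 / ε) *
            ‖f u - expSum (Finset.range n) α x u‖ ^ 2) ∂(powMeasure s) := by
            refine integral_mono hSi ((hfi.const_mul _).add (hD2.const_mul _)) fun u => ?_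
            refine le_trans ?_ (sq_add_le_mul_add_mul hε _ _)
            gcongr
            have := norm_sub_le (f u) (f u - expSum (Finset.range n) α x u)
            rwa [sub_sub_cancel] at this
        _ ≤ (1 + ε) * N + (1 + 1 / ε) * ε ^ 2 := by
            rw [integral_add (hfi.const_mul _) (hD2.const_mul _), integral_const_mul,
              integral_const_mul]
            gcongr
        _ = _ := by field_simp
    have hsub : ∀ τ ∈ Ioc 0 R, ‖waveTransform s f τ‖ ^ 2 ≤
        (1 + ε) * ‖waveTransform s (expSum (Finset.range n) α x) τ‖ ^ 2 +
        (1 + 1 / ε) * (ε * (A + 1)) ^ 2 := by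
      intro τ hτ
      obtain ⟨hi, hn⟩ := integrable_waveTransform hs (Ioc_subset_Icc_self hτ)
        (hf.sub continuous_expSum.measurable).aestronglyMeasurable hD1
      have hi2 : Integrable (fun u => hypWave s (u * τ) * expSum (Finset.range n) α x u)
          (powMeasure s) := by
        have e : ∀ u, hypWave s (u * τ) * expSum (Finset.range n) α x u =
            ∑ j ∈ Finset.range n, α j * (hypWave s (u * τ) *
              ((Real.exp (-(x j * u)) : ℝ) : ℂ)) := by
          intro u
          rw [expSum, Finset.mul_sum]
          exact Finset.sum_congr rfl fun j _ => by ring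
        simp_rw [e]
        refine integrable_finsetSum _ fun j hj => (integrable_hypWave_mul_exp hs hτ.1.le
          (lt_of_le_of_lt ?_ (hx j hj))).const_mul _
        gcongr
        exact hτ.2
      have hadd : waveTransform s f τ = waveTransform s (expSum (Finset.range n) α x) τ +
          waveTransform s (f - expSum (Finset.range n) α x) τ := by
        rw [waveTransform, waveTransform, waveTransform, ← integral_add hi2 hi]
        refine integral_congr_ae (Eventually.of_forall fun u => ?_)
        simp only [Pi.sub_apply]
        ring
      rw [hadd]
      refine le_trans ?_ (sq_add_le_mul_add_mul hε _ _)
      gcongr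
      exact (norm_add_le _ _).trans (add_le_add le_rfl (hn.trans hD1'))
    calc _ ≤ waveConst s * ∫ τ in Ioc 0 R,
          ((1 + ε) * ‖waveTransform s (expSum (Finset.range n) α x) τ‖ ^ 2 +
          (1 + 1 / ε) * (ε * (A + 1)) ^ 2) ∂(powMeasure s) := by
          refine mul_le_mul_of_nonneg_left ?_ hc.le
          refine integral_mono_of_nonneg (Eventually.of_forall fun τ => sq_nonneg _)
            ((hS.const_mul _).add (integrable_const _)) ?_
          filter_upwards [ae_restrict_mem measurableSet_Ioc] with τ hτ using hsub τ hτ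
      _ = (1 + ε) * (waveConst s * ∫ τ in Ioc 0 R,
            ‖waveTransform s (expSum (Finset.range n) α x) τ‖ ^ 2 ∂(powMeasure s)) +
          waveConst s * (B * ((1 + 1 / ε) * (ε * (A + 1)) ^ 2)) := by
          rw [integral_add (hS.const_mul _) (integrable_const _), integral_const_mul,
            integral_const, smul_eq_mul]
          ring
      _ ≤ (1 + ε) * ((1 + ε) * N + (ε ^ 2 + ε)) +
          waveConst s * (B * ((1 + 1 / ε) * (ε * (A + 1)) ^ 2)) := by
          gcongr
          exact hS'.trans hN
      _ = _ := by
          field_simp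
  have hlim : Tendsto (fun ε : ℝ => (1 + ε) * ((1 + ε) * N + (ε ^ 2 + ε)) +
      waveConst s * ((ε ^ 2 + ε) * (A + 1) ^ 2 * B)) (nhdsWithin 0 (Ioi 0)) (nhds N) := by
    have hcont : Continuous fun ε : ℝ => (1 + ε) * ((1 + ε) * N + (ε ^ 2 + ε)) +
      waveConst s * ((ε ^ 2 + ε) * (A + 1) ^ 2 * B) := by fun_prop
    have := hcont.tendsto 0
    simp only [add_zero, one_mul, ne_eq, OfNat.ofNat_ne_zero, not_false_eq_true, zero_pow,
      zero_mul, mul_zero] at this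
    exact this.mono_left nhdsWithin_le_nhds
  refine ge_of_tendsto hlim ?_
  filter_upwards [self_mem_nhdsWithin] with ε hε using key ε hε

end

/-- The power series `∑ c_k (i z)^k y_k` built from the Taylor coefficients of the wave function. -/
def momentSeries (s : ℂ) (y : ℕ → ℂ) (z : ℂ) : ℂ :=
  ∑' k, hypCoeff (s + 1) ((2 * s.re + 1 : ℝ) : ℂ) k * (I * z) ^ k * y k

section
variable {s : ℂ}

theorem norm_momentSeries_term_le (hs : -(1 / 2 : ℝ) < s.re) {y : ℕ → ℂ} {T M r : ℝ}
    (hT : 0 ≤ T) (hM : 0 ≤ M) (hy : ∀ k, ‖y k‖ ≤ T ^ k * M) {z : ℂ} (hz : ‖z‖ ≤ r) (k : ℕ) :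
    ‖hypCoeff (s + 1) ((2 * s.re + 1 : ℝ) : ℂ) k * (I * z) ^ k * y k‖ ≤
      (waveType s * r * T) ^ k / k.factorial * M := by
  have h := norm_hypCoeff_mul_pow_le (r := s + 1) (re_ofReal_pos hs) k (I * z)
  have hL := waveType_pos s
  rw [norm_mul Complex.I, Complex.norm_I, one_mul] at h
  rw [norm_mul]
  calc _ ≤ (waveType s * ‖z‖) ^ k / k.factorial * (T ^ k * M) := by
        gcongr
        · exact h
        · exact hy k
    _ = (waveType s * ‖z‖ * T) ^ k / k.factorial * M := by ring
    _ ≤ _ := by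
        gcongr

theorem differentiable_momentSeries (hs : -(1 / 2 : ℝ) < s.re) {y : ℕ → ℂ} {T M : ℝ}
    (hT : 0 ≤ T) (hM : 0 ≤ M) (hy : ∀ k, ‖y k‖ ≤ T ^ k * M) :
    Differentiable ℂ (momentSeries s y) := by
  intro z
  have h := Complex.differentiableOn_tsum_of_summable_norm (U := Metric.ball 0 (‖z‖ + 1))
    (F := fun k z => hypCoeff (s + 1) ((2 * s.re + 1 : ℝ) : ℂ) k * (I * z) ^ k * y k)
    ((Real.summable_pow_div_factorial (waveType s * (‖z‖ + 1) * T)).mul_right M)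
    (fun k => by fun_prop) Metric.isOpen_ball
    (fun k w hw => norm_momentSeries_term_le hs hT hM hy (by
      rw [Metric.mem_ball, dist_zero_right] at hw
      exact hw.le) k)
  exact h.differentiableAt (Metric.isOpen_ball.mem_nhds (by simp))

theorem norm_momentSeries_le (hs : -(1 / 2 : ℝ) < s.re) {y : ℕ → ℂ} {T M r : ℝ}
    (hT : 0 ≤ T) (hM : 0 ≤ M) (hy : ∀ k, ‖y k‖ ≤ T ^ k * M) {z : ℂ} (hz : ‖z‖ ≤ r) :
    ‖momentSeries s y z‖ ≤ Real.exp (waveType s * r * T) * M := by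
  have h := (NormedSpace.expSeries_div_hasSum_exp (waveType s * r * T)).mul_right M
  rw [← Real.exp_eq_exp_ℝ] at h
  exact tsum_of_norm_bounded h fun k => norm_momentSeries_term_le hs hT hM hy hz k

theorem tendsto_momentSeries (hs : -(1 / 2 : ℝ) < s.re) {y : ℕ → ℕ → ℂ} {y₀ : ℕ → ℂ} {T M : ℝ}
    (hT : 0 ≤ T) (hM : 0 ≤ M) (hy : ∀ n k, ‖y n k‖ ≤ T ^ k * M)
    (h : Tendsto y atTop (nhds y₀)) (z : ℂ) :
    Tendsto (fun n => momentSeries s (y n) z) atTop (nhds (momentSeries s y₀ z)) := by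
  refine tendsto_tsum_of_dominated_convergence
    ((Real.summable_pow_div_factorial (waveType s * ‖z‖ * T)).mul_right M)
    (fun k => ((tendsto_pi_nhds.mp h) k).const_mul _)
    (Eventually.of_forall fun n k => norm_momentSeries_term_le hs hT hM (hy n) le_rfl k)

theorem momentSeries_eq_zero (hs : -(1 / 2 : ℝ) < s.re) {y : ℕ → ℂ} {T M : ℝ}
    (hT : 0 ≤ T) (hM : 0 ≤ M) (hy : ∀ k, ‖y k‖ ≤ T ^ k * M)
    (h : ∀ τ ∈ Ioo (1 : ℝ) 2, momentSeries s y τ = 0) (z : ℂ) : momentSeries s y z = 0 := by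
  have ha : AnalyticOnNhd ℂ (momentSeries s y) univ := fun z _ =>
    (differentiable_momentSeries hs hT hM hy).analyticAt z
  have htend : Tendsto (fun τ : ℝ => (τ : ℂ)) (nhdsWithin (3 / 2) {3 / 2}ᶜ)
      (nhdsWithin ((3 / 2 : ℝ) : ℂ) {((3 / 2 : ℝ) : ℂ)}ᶜ) := by
    refine tendsto_nhdsWithin_iff.mpr
      ⟨Complex.continuous_ofReal.continuousAt.tendsto.mono_left nhdsWithin_le_nhds, ?_⟩
    filter_upwards [self_mem_nhdsWithin] with τ hτ
    intro h
    exact hτ (Complex.ofReal_injective h)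
  have hev : ∀ᶠ τ : ℝ in nhdsWithin (3 / 2) {3 / 2}ᶜ, momentSeries s y τ = 0 := by
    refine nhdsWithin_le_nhds ?_
    filter_upwards [Ioo_mem_nhds (show (1 : ℝ) < 3 / 2 by norm_num)
      (show (3 / 2 : ℝ) < 2 by norm_num)] with τ hτ using h τ hτ
  exact ha.eqOn_zero_of_preconnected_of_frequently_eq_zero isPreconnected_univ
    (mem_univ ((3 / 2 : ℝ) : ℂ)) (htend.frequently hev.frequently) (mem_univ z)

section
variable {T : ℝ} {f : ℝ → ℂ}

theorem norm_le_half_indicator (hT : ∀ u, T < u → f u = 0) {u : ℝ} (hu : 0 < u) :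
    ‖f u‖ ≤ 1 / 2 * ((Ioc 0 T).indicator (fun _ => (1 : ℝ)) u + ‖f u‖ ^ 2) := by
  rcases le_or_gt u T with h | h
  · rw [indicator_of_mem (show u ∈ Ioc 0 T from ⟨hu, h⟩)]
    nlinarith [sq_nonneg (‖f u‖ - 1)]
  · rw [hT u h, indicator_of_notMem (fun h' => absurd h'.2 (not_le.mpr h))]
    simp

theorem integrable_of_memLp_two (hs : -(1 / 2 : ℝ) < s.re) (hf : Measurable f)
    (hT : ∀ u, T < u → f u = 0) (hf2 : MemLp f 2 (powMeasure s)) :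
    Integrable f (powMeasure s) ∧ ∫ u, ‖f u‖ ∂(powMeasure s) ≤
      1 / 2 * ((powMeasure s).real (Ioc 0 T) + ∫ u, ‖f u‖ ^ 2 ∂(powMeasure s)) := by
  have hfi : Integrable (fun u => ‖f u‖ ^ 2) (powMeasure s) :=
    (memLp_two_iff_integrable_sq_norm hf2.1).mp hf2
  have hfin := isFiniteMeasure_powMeasure_Ioc hs T
  have hlt : powMeasure s (Ioc 0 T) < ⊤ := by
    have := measure_lt_top ((powMeasure s).restrict (Ioc 0 T)) univ
    rwa [Measure.restrict_apply_univ] at this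
  have hind : Integrable ((Ioc 0 T).indicator fun _ => (1 : ℝ)) (powMeasure s) := by
    rw [integrable_indicator_iff measurableSet_Ioc]
    exact integrableOn_const hlt.ne
  have hb : ∀ᵐ u ∂(powMeasure s), ‖f u‖ ≤
      1 / 2 * ((Ioc 0 T).indicator (fun _ => (1 : ℝ)) u + ‖f u‖ ^ 2) := by
    filter_upwards [ae_powMeasure_pos s] with u hu using norm_le_half_indicator hT hu
  have hint : Integrable (fun u => 1 / 2 * ((Ioc 0 T).indicator (fun _ => (1 : ℝ)) u +
      ‖f u‖ ^ 2)) (powMeasure s) := (hind.add hfi).const_mul _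
  refine ⟨hint.mono' hf.aestronglyMeasurable hb, ?_⟩
  refine (integral_mono_of_nonneg (Eventually.of_forall fun u => norm_nonneg _) hint hb).trans ?_
  rw [integral_const_mul, integral_add hind hfi, integral_indicator measurableSet_Ioc,
    setIntegral_const, smul_eq_mul, mul_one]

theorem norm_pow_mul_le (hT : ∀ u, T < u → f u = 0) {u : ℝ} (hu : 0 < u) (k : ℕ) :
    ‖(((u ^ k : ℝ)) : ℂ) * f u‖ ≤ T ^ k * ‖f u‖ := by
  rw [norm_mul, Complex.norm_real, Real.norm_of_nonneg (by positivity)]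
  rcases le_or_gt u T with h | h
  · gcongr
  · simp [hT u h]

theorem norm_moment_le (hT : ∀ u, T < u → f u = 0)
    (hf1 : Integrable f (powMeasure s)) (k : ℕ) :
    ‖∫ u, ((u ^ k : ℝ) : ℂ) * f u ∂(powMeasure s)‖ ≤
      T ^ k * ∫ u, ‖f u‖ ∂(powMeasure s) := by
  rw [← integral_const_mul]
  refine norm_integral_le_of_norm_le (hf1.norm.const_mul _) ?_
  filter_upwards [ae_powMeasure_pos s] with u hu using norm_pow_mul_le hT hu k

theorem waveTransform_eq_momentSeries (hs : -(1 / 2 : ℝ) < s.re) (hf : Measurable f)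
    (hT : ∀ u, T < u → f u = 0) (hf1 : Integrable f (powMeasure s)) (τ : ℝ) :
    waveTransform s f τ =
      momentSeries s (fun k => ∫ u, ((u ^ k : ℝ) : ℂ) * f u ∂(powMeasure s)) τ := by
  have hL := waveType_pos s
  set b : ℂ := ((2 * s.re + 1 : ℝ) : ℂ) with hbdef
  have hB : ∀ u : ℝ, HasSum (fun n : ℕ => (waveType s * |τ| * T) ^ n / n.factorial * ‖f u‖)
      (Real.exp (waveType s * |τ| * T) * ‖f u‖) := by
    intro u
    have h := NormedSpace.expSeries_div_hasSum_exp (waveType s * |τ| * T)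
    rw [← Real.exp_eq_exp_ℝ] at h
    exact h.mul_right _
  have key := hasSum_integral_of_dominated_convergence (μ := powMeasure s)
    (F := fun (n : ℕ) (u : ℝ) => hypCoeff (s + 1) b n * (I * τ) ^ n *
      (((u ^ n : ℝ) : ℂ) * f u))
    (f := fun u => hypWave s (u * τ) * f u)
    (fun n u => (waveType s * |τ| * T) ^ n / n.factorial * ‖f u‖) ?_ ?_ ?_ ?_ ?_
  · rw [waveTransform, ← key.tsum_eq, momentSeries]
    simp_rw [integral_const_mul]
    rfl
  · intro n
    have : Measurable fun u : ℝ => hypCoeff (s + 1) b n * (I * τ) ^ n *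
      (((u ^ n : ℝ) : ℂ) * f u) := by fun_prop
    exact this.aestronglyMeasurable
  · intro n
    filter_upwards [ae_powMeasure_pos s] with u hu
    have h1 := norm_hypCoeff_mul_pow_le (r := s + 1) (re_ofReal_pos hs) n (I * (τ : ℂ))
    rw [norm_mul Complex.I, Complex.norm_I, one_mul, Complex.norm_real, Real.norm_eq_abs] at h1
    rw [norm_mul]
    calc _ ≤ (waveType s * |τ|) ^ n / n.factorial * (T ^ n * ‖f u‖) := by
          gcongr
          · exact h1
          · exact norm_pow_mul_le hT hu n
      _ = _ := by ring
  · exact Eventually.of_forall fun u => (hB u).summable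
  · simp_rw [fun u => (hB u).tsum_eq]
    exact hf1.norm.const_mul _
  · refine Eventually.of_forall fun u => ?_
    have := (hasSum_oneF1 (r := s + 1) (re_ofReal_pos hs) (I * ((u * τ : ℝ) : ℂ))).mul_right (f u)
    refine this.congr_fun fun n => ?_
    push_cast
    rw [hbdef]
    push_cast
    ring

end

end

section
variable {s : ℂ} {T : ℝ}

theorem waveTransform_smul (s c : ℂ) (f : ℝ → ℂ) (τ : ℝ) :
    waveTransform s (fun u => c * f u) τ = c * waveTransform s f τ := by
  rw [waveTransform, waveTransform, ← integral_const_mul]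
  congr 1
  ext u
  ring

theorem exists_moments (hs : -(1 / 2 : ℝ) < s.re) (hT0 : 0 ≤ T) {f : ℝ → ℂ} (hf : Measurable f)
    (hT : ∀ u, T < u → f u = 0) (hf2 : MemLp f 2 (powMeasure s)) {a : ℝ} (ha : 0 ≤ a)
    (h : a * ∫ u, ‖f u‖ ^ 2 ∂(powMeasure s) <
      waveConst s * ∫ τ in Ioc 0 1, ‖waveTransform s f τ‖ ^ 2 ∂(powMeasure s)) :
    ∃ y : ℕ → ℂ, (∀ k, ‖y k‖ ≤ T ^ k * (1 / 2 * ((powMeasure s).real (Ioc 0 T) + 1))) ∧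
      a ≤ waveConst s * ∫ τ in Ioc 0 1, ‖momentSeries s y (τ : ℝ)‖ ^ 2 ∂(powMeasure s) ∧
      waveConst s * ∫ τ in Ioc 0 2, ‖momentSeries s y (τ : ℝ)‖ ^ 2 ∂(powMeasure s) ≤ 1 := by
  set N : ℝ := ∫ u, ‖f u‖ ^ 2 ∂(powMeasure s) with hN
  have hN0 : 0 ≤ N := integral_nonneg fun u => by positivity
  have hNpos : 0 < N := by
    have h1 := contraction hs one_pos hf hT hf2
    have h2 : 0 ≤ a * N := by positivity
    linarith
  set c : ℂ := ((1 / √N : ℝ) : ℂ) with hc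
  have hc2 : ‖c‖ ^ 2 = 1 / N := by
    rw [hc, Complex.norm_real, Real.norm_of_nonneg (by positivity), div_pow, one_pow,
      Real.sq_sqrt hN0]
  have hg : Measurable fun u => c * f u := hf.const_mul c
  have hgT : ∀ u, T < u → c * f u = 0 := fun u hu => by rw [hT u hu, mul_zero]
  have hg2 : MemLp (fun u => c * f u) 2 (powMeasure s) := hf2.const_mul c
  have hnorm : ∫ u, ‖c * f u‖ ^ 2 ∂(powMeasure s) = 1 := by
    simp_rw [norm_mul, mul_pow]
    rw [integral_const_mul, hc2, ← hN]
    field_simp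
  have hgi := integrable_of_memLp_two hs hg hgT hg2
  rw [hnorm] at hgi
  refine ⟨fun k => ∫ u, ((u ^ k : ℝ) : ℂ) * (c * f u) ∂(powMeasure s), fun k => ?_, ?_, ?_⟩
  · refine (norm_moment_le hgT hgi.1 k).trans ?_
    exact mul_le_mul_of_nonneg_left hgi.2 (by positivity)
  · simp_rw [← waveTransform_eq_momentSeries hs hg hgT hgi.1, waveTransform_smul, norm_mul,
      mul_pow]
    rw [integral_const_mul, hc2]
    have : a * N * (1 / N) ≤ (waveConst s *
        ∫ τ in Ioc 0 1, ‖waveTransform s f τ‖ ^ 2 ∂(powMeasure s)) * (1 / N) := by gcongr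
    rw [mul_assoc, mul_one_div_cancel hNpos.ne', mul_one] at this
    linarith
  · simp_rw [← waveTransform_eq_momentSeries hs hg hgT hgi.1]
    rw [← hnorm]
    exact contraction hs two_pos hg hgT hg2

theorem tendsto_integral_momentSeries (hs : -(1 / 2 : ℝ) < s.re) {y : ℕ → ℕ → ℂ} {y₀ : ℕ → ℂ}
    {M : ℝ} (hT : 0 ≤ T) (hM : 0 ≤ M) (hy : ∀ n k, ‖y n k‖ ≤ T ^ k * M)
    (h : Tendsto y atTop (nhds y₀)) (R : ℝ) :
    Tendsto (fun n => ∫ τ in Ioc 0 R, ‖momentSeries s (y n) (τ : ℝ)‖ ^ 2 ∂(powMeasure s)) atTop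
      (nhds (∫ τ in Ioc 0 R, ‖momentSeries s y₀ (τ : ℝ)‖ ^ 2 ∂(powMeasure s))) := by
  have := isFiniteMeasure_powMeasure_Ioc hs R
  refine tendsto_integral_of_dominated_convergence
    (fun _ => (Real.exp (waveType s * R * T) * M) ^ 2) (fun n => ?_) (integrable_const _)
    (fun n => ?_) (Eventually.of_forall fun τ =>
      ((tendsto_momentSeries hs hT hM hy h τ).norm.pow 2))
  · have := (differentiable_momentSeries hs hT hM (hy n)).continuous
    have h2 : Continuous fun τ : ℝ => ‖momentSeries s (y n) τ‖ ^ 2 := by fun_prop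
    exact h2.aestronglyMeasurable
  · filter_upwards [ae_restrict_mem measurableSet_Ioc] with τ hτ
    rw [Real.norm_of_nonneg (by positivity)]
    gcongr
    refine norm_momentSeries_le hs hT hM (hy n) ?_
    rw [Complex.norm_real, Real.norm_of_nonneg hτ.1.le]
    exact hτ.2

theorem eq_zero_of_setIntegral_powMeasure (s : ℂ) {g : ℝ → ℂ} (hg : Continuous g)
    (hi : IntegrableOn (fun τ => ‖g τ‖ ^ 2) (Ioc 1 2) (powMeasure s))
    (h : ∫ τ in Ioc 1 2, ‖g τ‖ ^ 2 ∂(powMeasure s) ≤ 0) : ∀ τ ∈ Ioo (1 : ℝ) 2, g τ = 0 := by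
  have hsub : Ioc (1 : ℝ) 2 ⊆ Ioi 0 := fun u hu => one_pos.trans hu.1
  rw [setIntegral_powMeasure s _ measurableSet_Ioc hsub] at h
  rw [integrableOn_powMeasure_iff s _ measurableSet_Ioc hsub] at hi
  have hnn : 0 ≤ᵐ[volume.restrict (Ioc (1 : ℝ) 2)] fun τ => τ ^ (2 * s.re) • ‖g τ‖ ^ 2 := by
    filter_upwards [ae_restrict_mem measurableSet_Ioc] with τ hτ
    have : 0 < τ := hsub hτ
    rw [Pi.zero_apply, smul_eq_mul]
    positivity
  have h0 := (setIntegral_eq_zero_iff_of_nonneg_ae hnn hi).mp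
    (le_antisymm h (integral_nonneg_of_ae hnn))
  have h1 : g =ᵐ[volume.restrict (Ioo (1 : ℝ) 2)] 0 := by
    filter_upwards [ae_restrict_of_ae_restrict_of_subset Ioo_subset_Ioc_self h0,
      ae_restrict_mem measurableSet_Ioo] with τ h2 hτ
    have : 0 < τ := one_pos.trans hτ.1
    have h3 : 0 < τ ^ (2 * s.re) := by positivity
    simpa [h3.ne'] using h2
  exact Measure.eqOn_Ioo_of_ae_eq _ h1 hg.continuousOn continuousOn_const

theorem exists_contraction_gap (hs : -(1 / 2 : ℝ) < s.re) (hT0 : 0 ≤ T) :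
    ∃ ε : ℝ, 0 < ε ∧ ε ≤ 1 ∧ ∀ f : ℝ → ℂ, Measurable f → (∀ u, T < u → f u = 0) →
      MemLp f 2 (powMeasure s) →
      waveConst s * ∫ τ in Ioc 0 1, ‖waveTransform s f τ‖ ^ 2 ∂(powMeasure s) ≤
        (1 - ε) * ∫ u, ‖f u‖ ^ 2 ∂(powMeasure s) := by
  by_contra! hcon
  set M : ℝ := 1 / 2 * ((powMeasure s).real (Ioc 0 T) + 1) with hMdef
  have hM : 0 ≤ M := by positivity
  have hc := waveConst_pos hs
  have hex : ∀ n : ℕ, ∃ y : ℕ → ℂ, (∀ k, ‖y k‖ ≤ T ^ k * M) ∧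
      1 - 1 / ((n : ℝ) + 1) ≤
        waveConst s * ∫ τ in Ioc 0 1, ‖momentSeries s y (τ : ℝ)‖ ^ 2 ∂(powMeasure s) ∧
      waveConst s * ∫ τ in Ioc 0 2, ‖momentSeries s y (τ : ℝ)‖ ^ 2 ∂(powMeasure s) ≤ 1 := by
    intro n
    have hn : 1 / ((n : ℝ) + 1) ≤ 1 := by
      rw [div_le_one (by positivity)]
      linarith [(Nat.cast_nonneg n : (0 : ℝ) ≤ n)]
    obtain ⟨f, hf, hfT, hf2, h⟩ := hcon (1 / ((n : ℝ) + 1)) (by positivity) hn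
    exact exists_moments hs hT0 hf hfT hf2 (by linarith) h
  choose y hy hlow hup using hex
  have hcomp : IsCompact (univ.pi fun k : ℕ => Metric.closedBall (0 : ℂ) (T ^ k * M)) :=
    isCompact_univ_pi fun k => isCompact_closedBall _ _
  obtain ⟨y₀, hy₀, φ, hφ, hlim⟩ := hcomp.tendsto_subseq (x := y) fun n k _ => by
    rw [Metric.mem_closedBall, dist_zero_right]
    exact hy n k
  have hy₀' : ∀ k, ‖y₀ k‖ ≤ T ^ k * M := fun k => by
    simpa [Metric.mem_closedBall] using hy₀ k (mem_univ k)
  have hlim' := fun R => tendsto_integral_momentSeries hs hT0 hM (fun n => hy (φ n)) hlim R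
  have h1 : 1 ≤ waveConst s *
      ∫ τ in Ioc 0 1, ‖momentSeries s y₀ (τ : ℝ)‖ ^ 2 ∂(powMeasure s) := by
    have ht : Tendsto (fun n => 1 - 1 / ((φ n : ℝ) + 1)) atTop (nhds (1 - 0)) :=
      (tendsto_one_div_add_atTop_nhds_zero_nat.comp hφ.tendsto_atTop).const_sub 1
    rw [sub_zero] at ht
    exact le_of_tendsto_of_tendsto' ht ((hlim' 1).const_mul _) fun n => hlow (φ n)
  have h2 : waveConst s *
      ∫ τ in Ioc 0 2, ‖momentSeries s y₀ (τ : ℝ)‖ ^ 2 ∂(powMeasure s) ≤ 1 :=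
    le_of_tendsto' ((hlim' 2).const_mul _) fun n => hup (φ n)
  have hcont : Continuous fun τ : ℝ => momentSeries s y₀ τ := by
    have := (differentiable_momentSeries hs hT0 hM hy₀').continuous
    fun_prop
  have hi2 : IntegrableOn (fun τ : ℝ => ‖momentSeries s y₀ τ‖ ^ 2) (Ioc 0 2) (powMeasure s) := by
    have := isFiniteMeasure_powMeasure_Ioc hs 2
    refine Integrable.mono' (integrable_const ((Real.exp (waveType s * 2 * T) * M) ^ 2))
      (hcont.norm.pow 2).aestronglyMeasurable ?_
    filter_upwards [ae_restrict_mem measurableSet_Ioc] with τ hτ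
    rw [Real.norm_of_nonneg (by positivity)]
    gcongr
    refine norm_momentSeries_le hs hT0 hM hy₀' ?_
    rw [Complex.norm_real, Real.norm_of_nonneg hτ.1.le]
    exact hτ.2
  have hiA := hi2.mono_set (Ioc_subset_Ioc_right (show (1 : ℝ) ≤ 2 by norm_num))
  have hiB := hi2.mono_set (Ioc_subset_Ioc_left (show (0 : ℝ) ≤ 1 by norm_num))
  have hsplit := setIntegral_union (Ioc_disjoint_Ioc_of_le (le_refl (1 : ℝ))) measurableSet_Ioc
    hiA hiB
  rw [Ioc_union_Ioc_eq_Ioc zero_le_one one_le_two] at hsplit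
  have h3 : ∫ τ in Ioc 1 2, ‖momentSeries s y₀ (τ : ℝ)‖ ^ 2 ∂(powMeasure s) ≤ 0 := by
    rw [hsplit] at h2
    nlinarith
  have h4 := eq_zero_of_setIntegral_powMeasure s hcont hiB h3
  have h5 := momentSeries_eq_zero hs hT0 hM hy₀' h4
  simp_rw [h5] at h1
  norm_num at h1

end

section
variable {ι : Type*} [Fintype ι] [DecidableEq ι]

theorem sum_det_submatrix_eq_factorial_mul {R : Type*} [CommRing R] (M : Matrix ι ι R) (n : ℕ) :
    ∑ c : Fin n → ι, (M.submatrix c c).det = (n.factorial : R) *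
      ∑ S ∈ Finset.univ.powersetCard n,
        (M.submatrix (Subtype.val : S → ι) (Subtype.val : S → ι)).det := by
  classical
  have h0 : ∑ c : Fin n → ι, (M.submatrix c c).det =
      ∑ c ∈ Finset.univ.filter (fun c : Fin n → ι => Function.Injective c),
        (M.submatrix c c).det := by
    rw [Finset.sum_filter]
    refine Finset.sum_congr rfl fun c _ => ?_
    split_ifs with h
    · rfl
    · simp only [Function.Injective, not_forall] at h
      obtain ⟨i, j, hij, hne⟩ := h
      refine Matrix.det_zero_of_row_eq hne ?_
      ext k
      simp [hij]
  rw [h0, ← Finset.sum_fiberwise_of_maps_to (g := fun c : Fin n → ι => Finset.univ.image c)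
    (t := Finset.univ.powersetCard n), Finset.mul_sum]
  · refine Finset.sum_congr rfl fun S hS => ?_
    have hcard : S.card = n := (Finset.mem_powersetCard.mp hS).2
    have hc : Fintype.card (Fin n ≃ S) = n.factorial := by
      have e : Fin n ≃ S := (Fintype.equivFinOfCardEq (by simpa using hcard)).symm
      simpa using Fintype.card_equiv e
    have hb : ∑ e : Fin n ≃ S,
        (M.submatrix (Subtype.val : S → ι) (Subtype.val : S → ι)).det =
        ∑ c ∈ (Finset.univ.filter (fun c : Fin n → ι => Function.Injective c)).filter
          (fun c => Finset.univ.image c = S), (M.submatrix c c).det := by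
      refine Finset.sum_bij (fun e _ i => (e i : ι)) ?_ ?_ ?_ ?_
      · intro e _
        simp only [Finset.mem_filter, Finset.mem_univ, true_and]
        refine ⟨Subtype.val_injective.comp e.injective, ?_⟩
        ext a
        simp only [Finset.mem_image, Finset.mem_univ, true_and]
        constructor
        · rintro ⟨i, rfl⟩
          exact (e i).2
        · intro ha
          exact ⟨e.symm ⟨a, ha⟩, by simp⟩
      · intro e _ e' _ h
        ext i
        exact congrFun h i
      · intro c hcm
        simp only [Finset.mem_filter, Finset.mem_univ, true_and] at hcm
        obtain ⟨hinj, him⟩ := hcm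
        have hmem : ∀ i, c i ∈ S := fun i => by
          rw [← him]
          exact Finset.mem_image_of_mem c (Finset.mem_univ i)
        refine ⟨Equiv.ofBijective (fun i => (⟨c i, hmem i⟩ : S)) ⟨fun i j h => ?_, fun a => ?_⟩,
          Finset.mem_univ _, rfl⟩
        · exact hinj (congrArg Subtype.val h)
        · have ha : (a : ι) ∈ Finset.univ.image c := him.symm ▸ a.2
          obtain ⟨i, -, hi⟩ := Finset.mem_image.mp ha
          exact ⟨i, Subtype.ext hi⟩
      · intro e _
        rw [← Matrix.det_submatrix_equiv_self e, Matrix.submatrix_submatrix]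
        rfl
    rw [← hb, Finset.sum_const, Finset.card_univ, hc, nsmul_eq_mul]
  · intro c hcm
    rw [Finset.mem_filter] at hcm
    rw [Finset.mem_powersetCard]
    exact ⟨Finset.subset_univ _, by rw [Finset.card_image_of_injective _ hcm.2]; simp⟩

theorem hasSum_det_one_add (M : Matrix ι ι ℂ) :
    HasSum (fun n : ℕ => (1 / (n.factorial : ℂ)) * ∑ c : Fin n → ι, (M.submatrix c c).det)
      (1 + M).det := by
  set p : Polynomial ℂ := Matrix.det (1 + (Polynomial.X : Polynomial ℂ) • M.map Polynomial.C)
    with hp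
  have heval : p.eval 1 = (1 + M).det := by
    rw [hp, ← Polynomial.coe_evalRingHom, RingHom.map_det]
    congr 1
    ext i j
    by_cases h : i = j <;> simp [h]
  have hcoeff : ∀ n, p.coeff n =
      (1 / (n.factorial : ℂ)) * ∑ c : Fin n → ι, (M.submatrix c c).det := by
    intro n
    rw [hp, Matrix.coeff_det_one_add_X_smul_eq_sum_minors, sum_det_submatrix_eq_factorial_mul,
      ← mul_assoc, one_div_mul_cancel (by exact_mod_cast n.factorial_ne_zero), one_mul]
  simp_rw [← hcoeff]
  rw [← heval, Polynomial.eval_eq_sum_range]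
  simp only [one_pow, mul_one]
  refine hasSum_sum_of_ne_finset_zero fun n hn => Polynomial.coeff_eq_zero_of_natDegree_lt ?_
  simpa using hn

theorem norm_det_le_pow_of_isHermitian {n : ℕ} {M : Matrix (Fin n) (Fin n) ℂ}
    (hM : M.IsHermitian) (h0 : ∀ v : Fin n → ℂ, 0 ≤ (star v ⬝ᵥ M.mulVec v).re) {C : ℝ}
    (hC : ∀ i, (M i i).re ≤ C) : ‖M.det‖ ≤ C ^ n := by
  rcases Nat.eq_zero_or_pos n with rfl | hn
  · simp
  set l := hM.eigenvalues with hl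
  have hnn : ∀ i, 0 ≤ l i := fun i => by
    rw [hl, hM.eigenvalues_eq]
    exact h0 _
  have htr : ∑ i, l i = ∑ i, (M i i).re := by
    have h := congrArg Complex.re hM.trace_eq_sum_eigenvalues
    simpa [Matrix.trace, hl] using h.symm
  have hle : ∑ i, l i ≤ n * C := by
    rw [htr]
    simpa using Finset.sum_le_sum fun i (_ : i ∈ Finset.univ) => hC i
  have hdet : ‖M.det‖ = ∏ i, l i := by
    rw [hM.det_eq_prod_eigenvalues, norm_prod]
    refine Finset.prod_congr rfl fun i _ => ?_
    exact (RCLike.norm_ofReal _).trans (abs_of_nonneg (hnn i))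
  have hn' : (0 : ℝ) < n := by exact_mod_cast hn
  have hgm := Real.geom_mean_le_arith_mean Finset.univ (fun _ => 1) l (fun _ _ => zero_le_one)
    (by simpa using hn) fun i _ => hnn i
  simp only [Real.rpow_one, one_mul, Finset.sum_const, Finset.card_univ, Fintype.card_fin,
    nsmul_eq_mul, mul_one] at hgm
  have hP : 0 ≤ ∏ i, l i := Finset.prod_nonneg fun i _ => hnn i
  have hle' : (∏ i, l i) ^ ((n : ℝ)⁻¹) ≤ C := by
    refine hgm.trans ?_
    rw [div_le_iff₀ hn']
    linarith
  rw [hdet, ← Real.rpow_inv_natCast_pow hP hn.ne']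
  gcongr

theorem exp_neg_trace_div_le_det_one_sub {M : Matrix ι ι ℂ} (hM : M.IsHermitian)
    (h0 : ∀ v : ι → ℂ, 0 ≤ (star v ⬝ᵥ M.mulVec v).re) {δ : ℝ} (hδ : 0 < δ)
    (h : ∀ v : ι → ℂ, (star v ⬝ᵥ M.mulVec v).re ≤ (1 - δ) * ∑ i, ‖v i‖ ^ 2) :
    Real.exp (-(M.trace.re / δ)) ≤ (1 - M).det.re := by
  have hB : (1 - M).IsHermitian := Matrix.isHermitian_one.sub hM
  set b := hB.eigenvalues with hb
  have hvv : ∀ i, ∑ j, ‖hB.eigenvectorBasis i j‖ ^ 2 = 1 := fun i => by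
    rw [← EuclideanSpace.norm_sq_eq, hB.eigenvectorBasis.norm_eq_one, one_pow]
  have hval : ∀ i, b i = 1 - (star ⇑(hB.eigenvectorBasis i) ⬝ᵥ
      M.mulVec ⇑(hB.eigenvectorBasis i)).re := by
    intro i
    rw [hb, hB.eigenvalues_eq, Matrix.sub_mulVec, dotProduct_sub, Matrix.one_mulVec, map_sub,
      ← hvv i]
    congr 1
    simp [dotProduct, ← Complex.normSq_eq_conj_mul_self, Complex.normSq_eq_norm_sq,
      -Complex.ofReal_pow]
  have hlow : ∀ i, δ ≤ b i := fun i => by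
    have := h ⇑(hB.eigenvectorBasis i)
    rw [hvv i] at this
    rw [hval i]
    linarith
  have htr : ∑ i, (1 - b i) = M.trace.re := by
    have h := congrArg Complex.re hB.trace_eq_sum_eigenvalues
    rw [Matrix.trace_sub, Matrix.trace_one] at h
    simp only [Complex.sub_re, Complex.natCast_re, Complex.re_sum] at h
    rw [Finset.sum_sub_distrib]
    simp only [Finset.sum_const, Finset.card_univ, nsmul_eq_mul, mul_one]
    have h' : ∑ i, b i = ∑ x, ((hB.eigenvalues x : ℂ)).re := by simp [hb]
    simp at h h'
    linarith
  have hupper : ∀ i, b i ≤ 1 := fun i => by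
    have := h0 ⇑(hB.eigenvectorBasis i)
    rw [hval i]
    linarith
  have hdet : (1 - M).det.re = ∏ i, b i := by
    rw [hB.det_eq_prod_eigenvalues]
    have : (∏ i, ((hB.eigenvalues i : ℝ) : ℂ)) = ((∏ i, b i : ℝ) : ℂ) := by simp [hb]
    rw [← Complex.ofReal_re (∏ i, b i), ← this]
    rfl
  rw [hdet, ← htr, Finset.sum_div, ← Finset.sum_neg_distrib, Real.exp_sum]
  refine Finset.prod_le_prod (fun i _ => (Real.exp_pos _).le) fun i _ => ?_
  have hbi := hδ.trans_le (hlow i)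
  have h1 : 1 / b i ≤ Real.exp ((1 - b i) / δ) := by
    calc 1 / b i = (1 - b i) / b i + 1 := by field_simp; ring
      _ ≤ Real.exp ((1 - b i) / b i) := Real.add_one_le_exp _
      _ ≤ _ := by
        gcongr
        · linarith [hupper i]
        · exact hlow i
  rw [Real.exp_neg]
  rw [one_div] at h1
  exact inv_le_of_inv_le₀ hbi h1

end

section
variable {s : ℂ} {ι : Type*}

theorem sum_mul_conj_mul_waveKernel [Fintype ι] (hs : -(1 / 2 : ℝ) < s.re) (a : ι → ℂ) (x : ι → ℝ) :
    ∑ i, ∑ j, a i * (starRingEnd ℂ) (a j) * waveKernel s (x i) (x j) =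
      ((∫ τ in Ioc 0 1, ‖∑ i, a i * hypWave s (x i * τ)‖ ^ 2 ∂(powMeasure s) : ℝ) : ℂ) := by
  rw [setIntegral_powMeasure s _ measurableSet_Ioc fun u hu => hu.1, ← integral_complex_ofReal]
  have hi : ∀ i j, IntegrableOn (fun τ : ℝ => a i * (starRingEnd ℂ) (a j) *
      (hypWave s (x i * τ) * (starRingEnd ℂ) (hypWave s (x j * τ)) *
        ((τ ^ (2 * s.re) : ℝ) : ℂ))) (Ioc 0 1) := fun i j =>
    (integrableOn_waveKernel_integrand hs (x i) (x j)).const_mul _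
  simp_rw [waveKernel, ← integral_const_mul]
  simp_rw [← integral_finsetSum _ fun j _ => hi _ j]
  rw [← integral_finsetSum _ fun i _ => integrable_finsetSum _ fun j _ => hi i j]
  refine setIntegral_congr_fun measurableSet_Ioc fun τ _ => ?_
  simp only [smul_eq_mul]
  rw [Complex.ofReal_mul, Complex.ofReal_pow, ← Complex.mul_conj', map_sum, Finset.sum_mul_sum,
    Finset.mul_sum]
  refine Finset.sum_congr rfl fun i _ => ?_
  rw [Finset.mul_sum]
  refine Finset.sum_congr rfl fun j _ => ?_
  rw [map_mul]
  ring

/-- The weighted Gram matrix `b_i c₀ k(x_i, x_j) b_j`. -/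
def waveGram (s : ℂ) (b x : ι → ℝ) : Matrix ι ι ℂ :=
  Matrix.of fun i j => (b i : ℂ) * ((b j : ℂ) * ((waveConst s : ℂ) * waveKernel s (x i) (x j)))

theorem isHermitian_waveGram (s : ℂ) (b x : ι → ℝ) : (waveGram s b x).IsHermitian := by
  ext i j
  simp only [Matrix.conjTranspose_apply, waveGram, Matrix.of_apply, star_mul', Complex.star_def,
    Complex.conj_ofReal, conj_waveKernel]
  ring

theorem star_dotProduct_waveGram_mulVec [Fintype ι] (hs : -(1 / 2 : ℝ) < s.re)
    (b x : ι → ℝ) (v : ι → ℂ) :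
    (star v ⬝ᵥ (waveGram s b x).mulVec v).re = waveConst s * ∫ τ in Ioc 0 1,
      ‖∑ i, (starRingEnd ℂ) (v i) * (b i : ℂ) * hypWave s (x i * τ)‖ ^ 2 ∂(powMeasure s) := by
  rw [← Complex.ofReal_re (waveConst s * _), Complex.ofReal_mul,
    ← sum_mul_conj_mul_waveKernel hs (fun i => (starRingEnd ℂ) (v i) * (b i : ℂ)) x]
  congr 1
  simp only [dotProduct, Matrix.mulVec, waveGram, Matrix.of_apply, Finset.mul_sum, Pi.star_apply,
    Complex.star_def, map_mul, Complex.conj_conj, Complex.conj_ofReal]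
  refine Finset.sum_congr rfl fun i _ => Finset.sum_congr rfl fun j _ => ?_
  ring

theorem star_dotProduct_waveGram_nonneg [Fintype ι] (hs : -(1 / 2 : ℝ) < s.re)
    (b x : ι → ℝ) (v : ι → ℂ) :
    0 ≤ (star v ⬝ᵥ (waveGram s b x).mulVec v).re := by
  rw [star_dotProduct_waveGram_mulVec hs]
  exact mul_nonneg (waveConst_pos hs).le (integral_nonneg fun τ => by positivity)

theorem exists_norm_waveKernel_le (hs : -(1 / 2 : ℝ) < s.re) (T : ℝ) :
    ∃ C : ℝ, 0 ≤ C ∧ ∀ u ∈ Icc 0 T, ∀ v ∈ Icc 0 T, waveConst s * ‖waveKernel s u v‖ ≤ C := by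
  obtain ⟨C, hC⟩ := (isCompact_Icc.prod isCompact_Icc).exists_bound_of_continuousOn
    (continuous_waveKernel hs).continuousOn (s := Icc 0 T ×ˢ Icc 0 T)
  have hc := waveConst_pos hs
  refine ⟨waveConst s * |C|, by positivity, fun u hu v hv => ?_⟩
  gcongr
  exact (hC (u, v) ⟨hu, hv⟩).trans (le_abs_self C)

/-- The minor `det (c₀ k(u_i, u_j))`. -/
def waveMinor (s : ℂ) {n : ℕ} (u : Fin n → ℝ) : ℂ := (waveGram s (fun _ => 1) u).det

theorem norm_waveMinor_le (hs : -(1 / 2 : ℝ) < s.re) {T C : ℝ}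
    (hC : ∀ u ∈ Icc 0 T, ∀ v ∈ Icc 0 T, waveConst s * ‖waveKernel s u v‖ ≤ C) {n : ℕ}
    {u : Fin n → ℝ} (hu : ∀ i, u i ∈ Icc 0 T) : ‖waveMinor s u‖ ≤ C ^ n := by
  refine norm_det_le_pow_of_isHermitian (isHermitian_waveGram s _ u)
    (star_dotProduct_waveGram_nonneg hs _ u) fun i => ?_
  refine (Complex.re_le_norm _).trans (le_trans (le_of_eq ?_) (hC _ (hu i) _ (hu i)))
  simp [waveGram, abs_of_pos (waveConst_pos hs)]

theorem continuous_waveMinor (hs : -(1 / 2 : ℝ) < s.re) (n : ℕ) :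
    Continuous fun u : Fin n → ℝ => waveMinor s u := by
  refine Continuous.matrix_det (continuous_matrix fun i j => ?_)
  have h : Continuous fun u : Fin n → ℝ => waveKernel s (u i) (u j) :=
    (continuous_waveKernel hs).comp₂ (continuous_apply i) (continuous_apply j)
  simp only [waveGram, Matrix.of_apply]
  fun_prop

theorem det_waveGram_submatrix (s : ℂ) (b x : ι → ℝ) {n : ℕ} (c : Fin n → ι) :
    ((waveGram s b x).submatrix c c).det =
      (∏ i, ((b (c i) ^ 2 : ℝ) : ℂ)) * waveMinor s (x ∘ c) := by
  have h : (waveGram s b x).submatrix c c = Matrix.of fun i j => (b (c i) : ℂ) *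
      (Matrix.of fun i j => (b (c j) : ℂ) * waveGram s (fun _ => 1) (x ∘ c) i j) i j := by
    ext i j
    simp [waveGram]
  rw [h, Matrix.det_mul_column, Matrix.det_mul_row, waveMinor, ← mul_assoc,
    ← Finset.prod_mul_distrib]
  simp [pow_two]

theorem hasSum_det_one_sub_waveGram [Fintype ι] [DecidableEq ι] (s : ℂ) (b x : ι → ℝ) :
    HasSum (fun n : ℕ => ((-1) ^ n / (n.factorial : ℂ)) *
      ∑ c : Fin n → ι, waveMinor s (x ∘ c) * ∏ i, ((b (c i) ^ 2 : ℝ) : ℂ))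
      (1 - waveGram s b x).det := by
  rw [sub_eq_add_neg]
  refine (hasSum_det_one_add (-waveGram s b x)).congr_fun fun n => ?_
  simp_rw [Matrix.submatrix_neg, Pi.neg_apply, Matrix.det_neg, det_waveGram_submatrix,
    Fintype.card_fin]
  rw [← Finset.mul_sum]
  simp_rw [mul_comm (waveMinor s _)]
  ring

end

section
variable {α : Type*} [MeasurableSpace α] {ι : Type*} [Fintype ι]
  [MeasurableSpace ι] [MeasurableSingletonClass ι]

theorem integral_prod_mul_step {m : Measure α} [SigmaFinite m] {w : α → ℂ} (hw : Integrable w m)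
    {q : α → ι} (hq : Measurable q) {n : ℕ} (H : (Fin n → ι) → ℂ) :
    ∫ x : Fin n → α, (∏ i, w (x i)) * H (q ∘ x) ∂(Measure.pi fun _ => m) =
      ∑ c : Fin n → ι, H c * ∏ i, ∫ x in q ⁻¹' {c i}, w x ∂m := by
  have hms : ∀ a, MeasurableSet (q ⁻¹' {a}) := fun a => hq (measurableSet_singleton a)
  classical
  have hpt : ∀ x : Fin n → α, (∏ i, w (x i)) * H (q ∘ x) =
      ∑ c : Fin n → ι, H c * ∏ i, (q ⁻¹' {c i}).indicator w (x i) := by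
    intro x
    rw [Finset.sum_eq_single (q ∘ x)]
    · rw [mul_comm]
      congr 1
      refine Finset.prod_congr rfl fun i _ => ?_
      rw [indicator_of_mem]
      rfl
    · intro c _ hc
      obtain ⟨i, hi⟩ := Function.ne_iff.mp hc
      rw [Finset.prod_eq_zero (Finset.mem_univ i), mul_zero]
      rw [indicator_of_notMem]
      exact fun h => hi h.symm
    · simp
  simp_rw [hpt]
  rw [integral_finsetSum]
  · refine Finset.sum_congr rfl fun c _ => ?_
    rw [integral_const_mul, integral_fintype_prod_eq_prod]
    simp_rw [fun i => integral_indicator (hms (c i)) (f := w) (μ := m)]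
  · intro c _
    refine Integrable.const_mul ?_ _
    exact Integrable.fintype_prod fun i => hw.indicator (hms (c i))

end

/-- The index of the cell of the uniform partition of `(0, T)` into `N + 1` cells. -/
def cellIndex (T : ℝ) (N : ℕ) (u : ℝ) : Fin (N + 1) :=
  ⟨min ⌊u * (N + 1) / T⌋₊ N, Nat.lt_succ_of_le (min_le_right _ _)⟩

/-- The left endpoint of a cell. -/
def cellPoint (T : ℝ) (N : ℕ) (i : Fin (N + 1)) : ℝ := (i : ℕ) * T / (N + 1)

/-- A cell of the uniform partition of `(0, T)`. -/
def cell (T : ℝ) (N : ℕ) (i : Fin (N + 1)) : Set ℝ := Ioo 0 T ∩ cellIndex T N ⁻¹' {i}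

/-- The mass of a cell. -/
def cellMass (s : ℂ) (T : ℝ) (N : ℕ) (i : Fin (N + 1)) : ℝ := (powMeasure s).real (cell T N i)

section
variable {s : ℂ} {T : ℝ} {N : ℕ}

theorem measurable_cellIndex (T : ℝ) (N : ℕ) : Measurable (cellIndex T N) := by
  have h : Measurable fun u : ℝ => ⌊u * (N + 1) / T⌋₊ := by fun_prop
  have h2 : Measurable fun m : ℕ => (⟨min m N, Nat.lt_succ_of_le (min_le_right _ _)⟩ :
    Fin (N + 1)) := measurable_from_nat
  exact h2.comp h

theorem measurableSet_cell (T : ℝ) (N : ℕ) (i : Fin (N + 1)) : MeasurableSet (cell T N i) :=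
  measurableSet_Ioo.inter (measurable_cellIndex T N (measurableSet_singleton i))

theorem cellPoint_mem (hT : 0 < T) (i : Fin (N + 1)) : cellPoint T N i ∈ Icc 0 T := by
  have hi : ((i : ℕ) : ℝ) ≤ (N : ℝ) + 1 := by exact_mod_cast i.2.le
  refine ⟨by unfold cellPoint; positivity, ?_⟩
  rw [cellPoint, div_le_iff₀ (by positivity)]
  nlinarith

theorem abs_cellPoint_cellIndex_sub_le {u : ℝ} (hu : u ∈ Ioo 0 T) :
    |cellPoint T N (cellIndex T N u) - u| ≤ T / (N + 1) := by
  have hT : 0 < T := hu.1.trans hu.2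
  have hN : (0 : ℝ) < (N : ℝ) + 1 := by positivity
  set z : ℝ := u * (N + 1) / T with hz
  have hz0 : 0 ≤ z := by
    have := hu.1.le
    positivity
  have hlt : ⌊z⌋₊ < N + 1 := by
    rw [Nat.floor_lt hz0, hz, div_lt_iff₀ hT]
    push_cast
    nlinarith [hu.2]
  have hval : ((cellIndex T N u : ℕ) : ℝ) = ⌊z⌋₊ := by
    simp only [cellIndex, ← hz]
    rw [min_eq_left (Nat.lt_succ_iff.mp hlt)]
  have hu' : u = z * T / (N + 1) := by
    rw [hz]
    field_simp
  have h1 := Nat.floor_le hz0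
  have h2 := Nat.lt_floor_add_one z
  rw [cellPoint, hval]
  conv_lhs => rw [hu']
  rw [← sub_div, ← sub_mul, abs_div, abs_mul, abs_of_pos hT, abs_of_pos hN]
  gcongr
  have : |(⌊z⌋₊ : ℝ) - z| ≤ 1 := by
    rw [abs_le]
    constructor <;> linarith
  nlinarith

theorem iUnion_cell (T : ℝ) (N : ℕ) : ⋃ i, cell T N i = Ioo 0 T := by
  ext u
  simp [cell]

theorem pairwise_disjoint_cell (T : ℝ) (N : ℕ) :
    Pairwise (Function.onFun Disjoint (cell T N)) := by
  intro i j hij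
  refine Set.disjoint_left.mpr fun u hi hj => hij ?_
  exact hi.2.symm.trans hj.2

theorem integrableOn_of_continuous (hs : -(1 / 2 : ℝ) < s.re) {E : Type*} [NormedAddCommGroup E]
    {g : ℝ → E} (hg : Continuous g) (R : ℝ) : IntegrableOn g (Ioc 0 R) (powMeasure s) := by
  have := isFiniteMeasure_powMeasure_Ioc hs R
  obtain ⟨C, hC⟩ := isCompact_Icc.exists_bound_of_continuousOn (s := Icc 0 R) hg.continuousOn
  have hcpt : AEStronglyMeasurable g ((powMeasure s).restrict (Ioc 0 R)) :=
    hg.aestronglyMeasurable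
  refine Integrable.mono' (integrable_const C) hcpt ?_
  filter_upwards [ae_restrict_mem measurableSet_Ioc] with τ hτ using hC τ ⟨hτ.1.le, hτ.2⟩

theorem measure_cell_lt_top (hs : -(1 / 2 : ℝ) < s.re) (i : Fin (N + 1)) :
    powMeasure s (cell T N i) < ⊤ := by
  have := isFiniteMeasure_powMeasure_Ioc hs T
  have h : powMeasure s (Ioc 0 T) < ⊤ := by
    simpa using measure_lt_top ((powMeasure s).restrict (Ioc 0 T)) univ
  exact (measure_mono (inter_subset_left.trans Ioo_subset_Ioc_self)).trans_lt h

theorem sum_cellMass (hs : -(1 / 2 : ℝ) < s.re) (T : ℝ) (N : ℕ) :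
    ∑ i, cellMass s T N i = (powMeasure s).real (Ioo 0 T) := by
  rw [← iUnion_cell T N, measureReal_iUnion_fintype (pairwise_disjoint_cell T N)
    (measurableSet_cell T N) fun i => (measure_cell_lt_top hs i).ne]
  rfl

/-- The step function with value `w i` on the `i`-th cell. -/
def stepFun (T : ℝ) (N : ℕ) (w : Fin (N + 1) → ℂ) : ℝ → ℂ :=
  (Ioo 0 T).indicator fun u => w (cellIndex T N u)

theorem measurable_stepFun (T : ℝ) (N : ℕ) (w : Fin (N + 1) → ℂ) : Measurable (stepFun T N w) :=
  ((Measurable.of_discrete (f := w)).comp (measurable_cellIndex T N)).indicator measurableSet_Ioo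

theorem stepFun_of_lt (w : Fin (N + 1) → ℂ) {u : ℝ} (hu : T < u) : stepFun T N w u = 0 :=
  indicator_of_notMem (fun h => (h.2.trans hu).false) _

theorem integral_comp_stepFun (hs : -(1 / 2 : ℝ) < s.re) {E : Type*} [NormedAddCommGroup E]
    [NormedSpace ℝ E] (w : Fin (N + 1) → ℂ) {g : ℝ → ℂ → E} (hg0 : ∀ u, g u 0 = 0)
    (hg : ∀ c, Continuous fun u => g u c) :
    ∫ u, g u (stepFun T N w u) ∂(powMeasure s) =
      ∑ i, ∫ u in cell T N i, g u (w i) ∂(powMeasure s) := by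
  have hc : ∀ i, EqOn (fun u => g u (stepFun T N w u)) (fun u => g u (w i)) (cell T N i) := by
    intro i u hu
    simp only [stepFun]
    rw [indicator_of_mem hu.1, show cellIndex T N u = i from hu.2]
  have hind : (fun u => g u (stepFun T N w u)) =
      (Ioo 0 T).indicator fun u => g u (stepFun T N w u) := by
    ext u
    by_cases h : u ∈ Ioo 0 T
    · rw [indicator_of_mem h]
    · rw [indicator_of_notMem h, stepFun, indicator_of_notMem h, hg0]
  rw [hind, integral_indicator measurableSet_Ioo, ← iUnion_cell T N,
    integral_iUnion_fintype (measurableSet_cell T N) (pairwise_disjoint_cell T N)]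
  · refine Finset.sum_congr rfl fun i _ => ?_
    exact setIntegral_congr_fun (measurableSet_cell T N i) (hc i)
  · intro i
    refine IntegrableOn.congr_fun ?_ (hc i).symm (measurableSet_cell T N i)
    exact (integrableOn_of_continuous hs (hg (w i)) T).mono_set
      (inter_subset_left.trans Ioo_subset_Ioc_self)

theorem integral_norm_sq_stepFun (hs : -(1 / 2 : ℝ) < s.re) (w : Fin (N + 1) → ℂ) :
    ∫ u, ‖stepFun T N w u‖ ^ 2 ∂(powMeasure s) = ∑ i, cellMass s T N i * ‖w i‖ ^ 2 := by
  rw [integral_comp_stepFun hs w (g := fun _ c => ‖c‖ ^ 2) (by simp) fun c => continuous_const]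
  simp [cellMass]

theorem memLp_stepFun (hs : -(1 / 2 : ℝ) < s.re) (w : Fin (N + 1) → ℂ) :
    MemLp (stepFun T N w) 2 (powMeasure s) := by
  rw [stepFun, memLp_indicator_iff_restrict measurableSet_Ioo]
  have := isFiniteMeasure_powMeasure_Ioc hs T
  refine MemLp.mono_measure (Measure.restrict_mono Ioo_subset_Ioc_self le_rfl) ?_
  refine MemLp.of_bound ((Measurable.of_discrete (f := w)).comp
    (measurable_cellIndex T N)).aestronglyMeasurable (∑ i, ‖w i‖) (Eventually.of_forall fun u => ?_)
  exact Finset.single_le_sum (f := fun i => ‖w i‖) (fun i _ => norm_nonneg _) (Finset.mem_univ _)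

theorem waveTransform_stepFun (hs : -(1 / 2 : ℝ) < s.re) (w : Fin (N + 1) → ℂ) (τ : ℝ) :
    waveTransform s (stepFun T N w) τ =
      ∑ i, w i * ∫ u in cell T N i, hypWave s (u * τ) ∂(powMeasure s) := by
  have := continuous_hypWave hs
  rw [waveTransform, integral_comp_stepFun hs w (g := fun u c => hypWave s (u * τ) * c)
    (by simp) fun c => by fun_prop]
  refine Finset.sum_congr rfl fun i _ => ?_
  rw [integral_mul_const, mul_comm]

theorem norm_sum_sub_waveTransform_stepFun_sq_le (hs : -(1 / 2 : ℝ) < s.re)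
    (w : Fin (N + 1) → ℂ) {τ ω : ℝ}
    (h : ∀ u ∈ Ioo 0 T,
      ‖hypWave s (cellPoint T N (cellIndex T N u) * τ) - hypWave s (u * τ)‖ ≤ ω) :
    ‖(∑ i, w i * (cellMass s T N i : ℂ) * hypWave s (cellPoint T N i * τ)) -
      waveTransform s (stepFun T N w) τ‖ ^ 2 ≤
      ω ^ 2 * (powMeasure s).real (Ioo 0 T) * ∑ i, cellMass s T N i * ‖w i‖ ^ 2 := by
  have hm : ∀ i, 0 ≤ cellMass s T N i := fun i => measureReal_nonneg
  have h1 : ‖(∑ i, w i * (cellMass s T N i : ℂ) * hypWave s (cellPoint T N i * τ)) -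
      waveTransform s (stepFun T N w) τ‖ ≤ ∑ i, ‖w i‖ * (ω * cellMass s T N i) := by
    rw [waveTransform_stepFun hs, ← Finset.sum_sub_distrib]
    refine norm_sum_le_of_le _ fun i _ => ?_
    have hconst : (cellMass s T N i : ℂ) * hypWave s (cellPoint T N i * τ) =
        ∫ _u in cell T N i, hypWave s (cellPoint T N i * τ) ∂(powMeasure s) := by
      rw [setIntegral_const, cellMass, Complex.real_smul]
    have hcw := continuous_hypWave hs
    have hi1 : IntegrableOn (fun _ : ℝ => hypWave s (cellPoint T N i * τ)) (cell T N i)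
        (powMeasure s) := integrableOn_const (measure_cell_lt_top hs i).ne
    have hi2 : IntegrableOn (fun u => hypWave s (u * τ)) (cell T N i) (powMeasure s) :=
      (integrableOn_of_continuous hs (by fun_prop) T).mono_set
        (inter_subset_left.trans Ioo_subset_Ioc_self)
    rw [mul_assoc, ← mul_sub, norm_mul, hconst, ← integral_sub hi1 hi2]
    gcongr
    refine norm_setIntegral_le_of_norm_le_const (measure_cell_lt_top hs i) fun u hu => ?_
    have := h u hu.1
    rwa [show cellIndex T N u = i from hu.2] at this
  have h2 : (∑ i, ‖w i‖ * (ω * cellMass s T N i)) =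
      ω * ∑ i, √(cellMass s T N i) * (√(cellMass s T N i) * ‖w i‖) := by
    rw [Finset.mul_sum]
    refine Finset.sum_congr rfl fun i _ => ?_
    rw [← mul_assoc (√_), Real.mul_self_sqrt (hm i)]
    ring
  have h3 := Finset.sum_mul_sq_le_sq_mul_sq Finset.univ (fun i => √(cellMass s T N i))
    fun i => √(cellMass s T N i) * ‖w i‖
  simp_rw [mul_pow, Real.sq_sqrt (hm _)] at h3
  rw [sum_cellMass hs] at h3
  rw [h2] at h1
  calc _ ≤ (ω * ∑ i, √(cellMass s T N i) * (√(cellMass s T N i) * ‖w i‖)) ^ 2 := by gcongr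
    _ = ω ^ 2 * (∑ i, √(cellMass s T N i) * (√(cellMass s T N i) * ‖w i‖)) ^ 2 := mul_pow _ _ _
    _ ≤ ω ^ 2 * ((powMeasure s).real (Ioo 0 T) * ∑ i, cellMass s T N i * ‖w i‖ ^ 2) := by gcongr
    _ = _ := by ring

theorem eventually_norm_hypWave_sub_le (hs : -(1 / 2 : ℝ) < s.re) (hT : 0 < T) {ω : ℝ}
    (hω : 0 < ω) : ∀ᶠ N : ℕ in atTop, ∀ τ ∈ Ioc (0 : ℝ) 1, ∀ u ∈ Ioo 0 T,
      ‖hypWave s (cellPoint T N (cellIndex T N u) * τ) - hypWave s (u * τ)‖ ≤ ω := by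
  have huc := isCompact_Icc.uniformContinuousOn_of_continuous (s := Icc 0 T)
    (continuous_hypWave hs).continuousOn
  obtain ⟨η, hη, h⟩ := Metric.uniformContinuousOn_iff_le.mp huc ω hω
  have hlim : Tendsto (fun N : ℕ => T / ((N : ℝ) + 1)) atTop (nhds 0) := by
    simpa [div_eq_mul_inv] using (tendsto_one_div_add_atTop_nhds_zero_nat (𝕜 := ℝ)).const_mul T
  filter_upwards [hlim.eventually (gt_mem_nhds hη)] with N hN τ hτ u hu
  have hmem : ∀ x ∈ Icc 0 T, x * τ ∈ Icc 0 T := fun x hx =>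
    ⟨mul_nonneg hx.1 hτ.1.le, (mul_le_of_le_one_right hx.1 hτ.2).trans hx.2⟩
  have hd := h _ (hmem _ (cellPoint_mem (N := N) hT (cellIndex T N u))) _
    (hmem u ⟨hu.1.le, hu.2.le⟩)
  rw [Real.dist_eq, dist_eq_norm, ← sub_mul, abs_mul, abs_of_pos hτ.1] at hd
  refine hd ?_
  calc _ ≤ |cellPoint T N (cellIndex T N u) - u| * 1 := by
        gcongr
        exact hτ.2
    _ ≤ T / (N + 1) := by
        rw [mul_one]
        exact abs_cellPoint_cellIndex_sub_le hu
    _ ≤ η := hN.le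

theorem norm_sq_le_of_sub {a b : ℂ} {ε : ℝ} (hε : 0 < ε) :
    ‖a‖ ^ 2 ≤ (1 + ε) * ‖b‖ ^ 2 + (1 + 1 / ε) * ‖a - b‖ ^ 2 := by
  have h1 : ‖a‖ ≤ ‖b‖ + ‖a - b‖ := by
    simpa using norm_add_le b (a - b)
  have h2 : 2 * ‖b‖ * ‖a - b‖ ≤ ε * ‖b‖ ^ 2 + 1 / ε * ‖a - b‖ ^ 2 := by
    have h3 : 0 ≤ 1 / ε * (ε * ‖b‖ - ‖a - b‖) ^ 2 := by positivity
    have h4 : 1 / ε * (ε * ‖b‖ - ‖a - b‖) ^ 2 =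
        ε * ‖b‖ ^ 2 + 1 / ε * ‖a - b‖ ^ 2 - 2 * ‖b‖ * ‖a - b‖ := by
      field_simp
      ring
    linarith
  calc ‖a‖ ^ 2 ≤ (‖b‖ + ‖a - b‖) ^ 2 := by gcongr
    _ ≤ _ := by nlinarith

theorem integral_norm_sq_sum_le (hs : -(1 / 2 : ℝ) < s.re) (hT : 0 < T) (w : Fin (N + 1) → ℂ)
    {ε ω : ℝ} (hε : 0 < ε)
    (hN : ∀ τ ∈ Ioc (0 : ℝ) 1, ∀ u ∈ Ioo 0 T,
      ‖hypWave s (cellPoint T N (cellIndex T N u) * τ) - hypWave s (u * τ)‖ ≤ ω) :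
    ∫ τ in Ioc 0 1, ‖∑ i, w i * (cellMass s T N i : ℂ) * hypWave s (cellPoint T N i * τ)‖ ^ 2
        ∂(powMeasure s) ≤
      (1 + ε) * ∫ τ in Ioc 0 1, ‖waveTransform s (stepFun T N w) τ‖ ^ 2 ∂(powMeasure s) +
        (powMeasure s).real (Ioc 0 1) * ((1 + 1 / ε) * (ω ^ 2 * (powMeasure s).real (Ioo 0 T) *
          ∑ i, cellMass s T N i * ‖w i‖ ^ 2)) := by
  have hfin := isFiniteMeasure_powMeasure_Ioc hs 1
  have hW : IntegrableOn (fun τ => ‖waveTransform s (stepFun T N w) τ‖ ^ 2) (Ioc 0 1)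
      (powMeasure s) := by
    have hi := integrable_of_memLp_two hs (measurable_stepFun T N w)
      (fun u hu => stepFun_of_lt w hu) (memLp_stepFun hs w)
    simp_rw [waveTransform_eq_momentSeries hs (measurable_stepFun T N w)
      (fun u hu => stepFun_of_lt w hu) hi.1]
    have hd := (differentiable_momentSeries hs hT.le (integral_nonneg fun u => norm_nonneg _)
      (norm_moment_le (fun u hu => stepFun_of_lt w hu) hi.1)).continuous
    exact integrableOn_of_continuous hs (by fun_prop) 1
  have hconst : IntegrableOn (fun _ : ℝ => (1 + 1 / ε) * (ω ^ 2 *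
      (powMeasure s).real (Ioo 0 T) * ∑ i, cellMass s T N i * ‖w i‖ ^ 2)) (Ioc 0 1)
      (powMeasure s) := integrable_const _
  rw [← smul_eq_mul ((powMeasure s).real (Ioc 0 1)), ← setIntegral_const, ← integral_const_mul,
    ← integral_add (hW.const_mul _) hconst]
  refine integral_mono_of_nonneg (Eventually.of_forall fun τ => by positivity)
    ((hW.const_mul _).add hconst) ?_
  filter_upwards [ae_restrict_mem measurableSet_Ioc] with τ hτ
  refine (norm_sq_le_of_sub (b := waveTransform s (stepFun T N w) τ) hε).trans ?_
  refine add_le_add_right (mul_le_mul_of_nonneg_left ?_ (by positivity)) _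
  exact norm_sum_sub_waveTransform_stepFun_sq_le hs w (hN τ hτ)

theorem exists_eventually_star_dotProduct_waveGram_le (hs : -(1 / 2 : ℝ) < s.re) (hT : 0 < T) :
    ∃ δ : ℝ, 0 < δ ∧ ∀ᶠ N : ℕ in atTop, ∀ v : Fin (N + 1) → ℂ,
      (star v ⬝ᵥ (waveGram s (fun i => √(cellMass s T N i)) (cellPoint T N)).mulVec v).re ≤
        (1 - δ) * ∑ i, ‖v i‖ ^ 2 := by
  obtain ⟨ε, hε, hε1, hgap⟩ := exists_contraction_gap hs hT.le
  have hc := waveConst_pos hs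
  set A : ℝ := (powMeasure s).real (Ioo 0 T)
  set B : ℝ := (powMeasure s).real (Ioc 0 1)
  have hA : 0 ≤ A := measureReal_nonneg
  have hB : 0 ≤ B := measureReal_nonneg
  set P : ℝ := (1 + 1 / ε) * waveConst s * A * B with hP
  have hP0 : 0 ≤ P := by positivity
  set ω : ℝ := √(ε ^ 2 / 2 / (P + 1)) with hωdef
  have hω : 0 < ω := Real.sqrt_pos.mpr (by positivity)
  have hωP : ω ^ 2 * P ≤ ε ^ 2 / 2 := by
    rw [hωdef, Real.sq_sqrt (by positivity), div_mul_eq_mul_div, div_le_iff₀ (by positivity)]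
    nlinarith [sq_nonneg ε]
  refine ⟨ε ^ 2 / 2, by positivity, ?_⟩
  filter_upwards [eventually_norm_hypWave_sub_le hs hT hω] with N hN v
  have hm : ∀ i, 0 ≤ cellMass s T N i := fun i => measureReal_nonneg
  set w : Fin (N + 1) → ℂ := fun i => (starRingEnd ℂ) (v i) / ((√(cellMass s T N i) : ℝ) : ℂ)
    with hw
  have hwm : ∀ i, (starRingEnd ℂ) (v i) * ((√(cellMass s T N i) : ℝ) : ℂ) =
      w i * (cellMass s T N i : ℂ) := by
    intro i
    rcases eq_or_lt_of_le (hm i) with h0 | h0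
    · simp [← h0]
    · have h1 : ((√(cellMass s T N i) : ℝ) : ℂ) ≠ 0 := by
        exact_mod_cast (Real.sqrt_pos.mpr h0).ne'
      have h2 : (cellMass s T N i : ℂ) =
          ((√(cellMass s T N i) : ℝ) : ℂ) * ((√(cellMass s T N i) : ℝ) : ℂ) := by
        rw [← Complex.ofReal_mul, Real.mul_self_sqrt (hm i)]
      rw [hw]
      simp only
      rw [h2]
      field_simp
  set E : ℝ := ∑ i, cellMass s T N i * ‖w i‖ ^ 2 with hE
  have hE0 : 0 ≤ E := Finset.sum_nonneg fun i _ => mul_nonneg (hm i) (by positivity)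
  have hEV : E ≤ ∑ i, ‖v i‖ ^ 2 := by
    refine Finset.sum_le_sum fun i _ => ?_
    rcases eq_or_lt_of_le (hm i) with h0 | h0
    · rw [← h0, zero_mul]
      positivity
    · rw [hw]
      simp only
      rw [norm_div, RCLike.norm_conj, Complex.norm_real, Real.norm_of_nonneg (Real.sqrt_nonneg _),
        div_pow, Real.sq_sqrt (hm i), mul_div_cancel₀ _ h0.ne']
  have hgapw := hgap (stepFun T N w) (measurable_stepFun T N w) (fun u hu => stepFun_of_lt w hu)
    (memLp_stepFun hs w)
  rw [integral_norm_sq_stepFun hs, ← hE] at hgapw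
  have hmono := integral_norm_sq_sum_le hs hT w hε hN
  rw [← hE] at hmono
  rw [star_dotProduct_waveGram_mulVec hs]
  simp_rw [hwm]
  calc _ ≤ waveConst s * ((1 + ε) *
          ∫ τ in Ioc 0 1, ‖waveTransform s (stepFun T N w) τ‖ ^ 2 ∂(powMeasure s) +
          B * ((1 + 1 / ε) * (ω ^ 2 * A * E))) := mul_le_mul_of_nonneg_left hmono hc.le
    _ = (1 + ε) * (waveConst s *
          ∫ τ in Ioc 0 1, ‖waveTransform s (stepFun T N w) τ‖ ^ 2 ∂(powMeasure s)) +
          ω ^ 2 * P * E := by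
        rw [hP]
        ring
    _ ≤ (1 + ε) * ((1 - ε) * E) + ε ^ 2 / 2 * E :=
        add_le_add (mul_le_mul_of_nonneg_left hgapw (by linarith))
          (mul_le_mul_of_nonneg_right hωP hE0)
    _ = (1 - ε ^ 2 / 2) * E := by ring
    _ ≤ _ := mul_le_mul_of_nonneg_left hEV (by nlinarith)

end

/-- The squared modulus of `waveGauge` on the positive half-line. -/
def gaugeWeight (s : ℂ) (x : ℝ) : ℝ := ((2 / x) ^ (s.re + 1) / √2) ^ 2

/-- The image of the partition of `(0, T)` under `u ↦ 2 / u`. -/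
def invCellIndex (T : ℝ) (N : ℕ) (x : ℝ) : Fin (N + 1) := cellIndex T N (2 / x)

/-- The determinant of size `n` attached to the kernel sampled at the cell points. -/
def sampledMinor (s : ℂ) (T : ℝ) (N n : ℕ) (x : Fin n → ℝ) : ℂ :=
  waveMinor s (cellPoint T N ∘ (invCellIndex T N ∘ x))

section
variable {s : ℂ} {t T : ℝ}

theorem gaugeWeight_nonneg (s : ℂ) (x : ℝ) : 0 ≤ gaugeWeight s x := sq_nonneg _

theorem measurable_gaugeWeight (s : ℂ) : Measurable (gaugeWeight s) := by
  unfold gaugeWeight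
  fun_prop

theorem waveGauge_mul_conj (s : ℂ) (x : ℝ) :
    waveGauge s x * (starRingEnd ℂ) (waveGauge s x) = (gaugeWeight s x : ℂ) := by
  have h : ‖cexp (-I / x)‖ = 1 := by
    rw [Complex.norm_exp]
    simp [Complex.div_re]
  rw [Complex.mul_conj', waveGauge, norm_mul, h, mul_one, Complex.norm_real, gaugeWeight,
    ← Complex.ofReal_pow, Real.norm_eq_abs, sq_abs]

theorem KinfC_symm (s : ℂ) (x y : ℝ) : KinfC s x y = KinfC s y x := by
  by_cases h : x = y
  · rw [h]
  · have h1 : (x : ℂ) - y ≠ 0 := sub_ne_zero.mpr (by exact_mod_cast h)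
    have h2 : (y : ℂ) - x ≠ 0 := sub_ne_zero.mpr (by exact_mod_cast Ne.symm h)
    rw [KinfC, KinfC, if_neg h, if_neg (Ne.symm h), div_eq_div_iff h1 h2]
    ring

theorem ofReal_Kinf (hs : -(1 / 2 : ℝ) < s.re) {x y : ℝ} (hx : 0 < x) (hy : 0 < y) :
    (Kinf s x y : ℂ) = KinfC s x y := by
  rw [Kinf]
  refine Complex.conj_eq_iff_re.mp ?_
  conv_lhs => rw [KinfC_symm s x y, KinfC_eq hs hy hx]
  rw [KinfC_eq hs hx hy]
  simp only [map_mul, Complex.conj_ofReal, Complex.conj_conj, conj_waveKernel]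
  ring

theorem ofReal_rhoK (hs : -(1 / 2 : ℝ) < s.re) {n : ℕ} {x : Fin n → ℝ} (hx : ∀ i, 0 < x i) :
    (rhoK (Kinf s) n x : ℂ) =
      (∏ i, (gaugeWeight s (x i) : ℂ)) * waveMinor s fun i => 2 / x i := by
  have h : (Matrix.of fun i j => Kinf s (x i) (x j)).map Complex.ofRealHom =
      Matrix.of fun i j => waveGauge s (x i) * (Matrix.of fun i j =>
        (starRingEnd ℂ) (waveGauge s (x j)) *
          waveGram s (fun _ => 1) (fun i => 2 / x i) i j) i j := by
    ext i j
    simp only [Matrix.map_apply, Matrix.of_apply, Complex.ofRealHom_eq_coe,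
      ofReal_Kinf hs (hx i) (hx j), KinfC_eq hs (hx i) (hx j), waveGram, Complex.ofReal_one]
    ring
  rw [rhoK, ← Complex.ofRealHom_eq_coe, RingHom.map_det, RingHom.mapMatrix_apply, h,
    Matrix.det_mul_column, Matrix.det_mul_row, waveMinor, ← mul_assoc,
    ← Finset.prod_mul_distrib]
  simp_rw [waveGauge_mul_conj]

theorem image_two_div (ht : 0 < t) {S : Set ℝ} (hS : S ⊆ Ioo 0 (2 / t)) :
    (fun u : ℝ => 2 / u) '' S = (fun x : ℝ => 2 / x) ⁻¹' S ∩ Ioi t := by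
  ext x
  constructor
  · rintro ⟨u, hu, rfl⟩
    have h := hS hu
    refine ⟨?_, ?_⟩
    · simpa using hu
    · have := (lt_div_iff₀ ht).mp h.2
      exact (lt_div_iff₀ h.1).mpr (by linarith)
  · rintro ⟨hx, _⟩
    exact ⟨2 / x, hx, by simp⟩

theorem abs_deriv_smul_gaugeWeight (s : ℂ) {u : ℝ} (hu : 0 < u) :
    |(-2 / u ^ 2)| • gaugeWeight s (2 / u) = u ^ (2 * s.re) := by
  have h2 : u ^ (s.re + 1) = u ^ s.re * u := by rw [Real.rpow_add hu, Real.rpow_one]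
  have h3 : u ^ (2 * s.re) = (u ^ s.re) ^ 2 := by
    rw [mul_comm, Real.rpow_mul hu.le]
    norm_cast
  rw [gaugeWeight, div_div_cancel₀ two_ne_zero, abs_div, abs_neg, abs_two,
    abs_of_pos (by positivity : 0 < u ^ 2), h2, h3, div_pow, Real.sq_sqrt zero_le_two, smul_eq_mul]
  field_simp

theorem hasDerivWithinAt_two_div {u : ℝ} (hu : u ≠ 0) (S : Set ℝ) :
    HasDerivWithinAt (fun u : ℝ => 2 / u) (-2 / u ^ 2) S u := by
  have h := ((hasDerivAt_inv hu).const_mul 2).hasDerivWithinAt (s := S)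
  simp_rw [div_eq_mul_inv]
  exact h.congr_deriv (by ring)

theorem injOn_two_div (S : Set ℝ) : InjOn (fun u : ℝ => 2 / u) S := by
  intro a _ b _ h
  simpa [div_eq_mul_inv] using h

theorem integrableOn_gaugeWeight (hs : -(1 / 2 : ℝ) < s.re) (ht : 0 < t) :
    IntegrableOn (gaugeWeight s) (Ioi t) := by
  have himg := image_two_div ht (subset_refl (Ioo 0 (2 / t)))
  have hpre : (fun x : ℝ => 2 / x) ⁻¹' Ioo 0 (2 / t) ∩ Ioi t = Ioi t := by
    refine inter_eq_right.mpr fun x (hx : t < x) => ⟨by have := ht.trans hx; positivity, ?_⟩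
    exact div_lt_div_of_pos_left two_pos ht hx
  rw [← hpre, ← himg, integrableOn_image_iff_integrableOn_abs_deriv_smul measurableSet_Ioo
    (fun u hu => hasDerivWithinAt_two_div hu.1.ne' _) (injOn_two_div _)]
  refine IntegrableOn.congr_fun ?_
    (fun u hu => (abs_deriv_smul_gaugeWeight s hu.1).symm) measurableSet_Ioo
  exact (integrableOn_rpow_Ioc (by linarith) (by positivity)).mono_set Ioo_subset_Ioc_self

theorem setIntegral_gaugeWeight (s : ℂ) (ht : 0 < t) {S : Set ℝ} (hSm : MeasurableSet S)
    (hS : S ⊆ Ioo 0 (2 / t)) :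
    ∫ x in (fun x : ℝ => 2 / x) ⁻¹' S ∩ Ioi t, gaugeWeight s x = (powMeasure s).real S := by
  have hS0 : S ⊆ Ioi 0 := fun u hu => (hS hu).1
  rw [← image_two_div ht hS, integral_image_eq_integral_abs_deriv_smul hSm
    (fun u hu => hasDerivWithinAt_two_div (hS hu).1.ne' _) (injOn_two_div _),
    setIntegral_congr_fun hSm fun u hu => abs_deriv_smul_gaugeWeight s (hS hu).1]
  have h := setIntegral_powMeasure s (fun _ => (1 : ℝ)) hSm hS0
  rw [setIntegral_const, smul_eq_mul, mul_one] at h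
  simpa using h.symm

theorem measurable_invCellIndex (T : ℝ) (N : ℕ) : Measurable (invCellIndex T N) :=
  (measurable_cellIndex T N).comp (by fun_prop)

theorem two_div_mem_Ioo (ht : 0 < t) {x : ℝ} (hx : x ∈ Ioi t) : 2 / x ∈ Ioo 0 (2 / t) := by
  have hx' : t < x := hx
  have := ht.trans hx'
  exact ⟨by positivity, div_lt_div_of_pos_left two_pos ht hx'⟩

theorem setIntegral_gaugeWeight_invCell (s : ℂ) (ht : 0 < t) (N : ℕ) (i : Fin (N + 1)) :
    ∫ x in invCellIndex (2 / t) N ⁻¹' {i}, (gaugeWeight s x : ℂ) ∂(volume.restrict (Ioi t)) =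
      (cellMass s (2 / t) N i : ℂ) := by
  rw [Measure.restrict_restrict (measurable_invCellIndex _ N (measurableSet_singleton i)),
    integral_complex_ofReal, cellMass, ← setIntegral_gaugeWeight s ht (measurableSet_cell _ N i)
      inter_subset_left]
  congr 3
  ext x
  constructor
  · rintro ⟨h1, h2⟩
    exact ⟨⟨two_div_mem_Ioo ht h2, h1⟩, h2⟩
  · rintro ⟨h1, h2⟩
    exact ⟨h1.2, h2⟩

theorem integral_sampledMinor (hs : -(1 / 2 : ℝ) < s.re) (ht : 0 < t) (N n : ℕ) :
    ∫ x : Fin n → ℝ, (∏ i, (gaugeWeight s (x i) : ℂ)) * sampledMinor s (2 / t) N n x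
        ∂(Measure.pi fun _ => volume.restrict (Ioi t)) =
      ∑ c : Fin n → Fin (N + 1), waveMinor s (cellPoint (2 / t) N ∘ c) *
        ∏ i, ((√(cellMass s (2 / t) N (c i)) ^ 2 : ℝ) : ℂ) := by
  have h := integral_prod_mul_step (m := volume.restrict (Ioi t))
    (w := fun x => (gaugeWeight s x : ℂ)) (integrableOn_gaugeWeight hs ht).ofReal
    (measurable_invCellIndex (2 / t) N) (n := n) fun c => waveMinor s (cellPoint (2 / t) N ∘ c)
  simp_rw [setIntegral_gaugeWeight_invCell s ht N] at h
  refine Eq.trans h ?_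
  refine Finset.sum_congr rfl fun c _ => ?_
  congr 1
  refine Finset.prod_congr rfl fun i _ => ?_
  rw [Real.sq_sqrt (show 0 ≤ cellMass s (2 / t) N (c i) from measureReal_nonneg)]

theorem integrable_prod_gaugeWeight (hs : -(1 / 2 : ℝ) < s.re) (ht : 0 < t) (n : ℕ) :
    Integrable (fun x : Fin n → ℝ => ∏ i, gaugeWeight s (x i))
      (Measure.pi fun _ => volume.restrict (Ioi t)) :=
  Integrable.fintype_prod fun _ => integrableOn_gaugeWeight hs ht

theorem ae_pi_Ioi (t : ℝ) (n : ℕ) :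
    ∀ᵐ x : Fin n → ℝ ∂(Measure.pi fun _ => volume.restrict (Ioi t)), ∀ i, x i ∈ Ioi t := by
  rw [← Measure.restrict_pi_pi]
  filter_upwards [ae_restrict_mem (MeasurableSet.univ_pi fun _ => measurableSet_Ioi)] with x hx i
    using hx i (mem_univ i)

theorem norm_prod_gaugeWeight_mul_le {C : ℝ} {n : ℕ} (x : Fin n → ℝ) {z : ℂ} (hz : ‖z‖ ≤ C ^ n) :
    ‖(∏ i, (gaugeWeight s (x i) : ℂ)) * z‖ ≤ C ^ n * ∏ i, gaugeWeight s (x i) := by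
  have h : ‖∏ i, (gaugeWeight s (x i) : ℂ)‖ = ∏ i, gaugeWeight s (x i) := by
    rw [← Complex.ofReal_prod, Complex.norm_real, Real.norm_of_nonneg
      (Finset.prod_nonneg fun i _ => gaugeWeight_nonneg s _)]
  rw [norm_mul, h, mul_comm]
  exact mul_le_mul_of_nonneg_right hz (Finset.prod_nonneg fun i _ => gaugeWeight_nonneg s _)

theorem tendsto_cellPoint_cellIndex {u : ℝ} (hu : u ∈ Ioo 0 T) :
    Tendsto (fun N => cellPoint T N (cellIndex T N u)) atTop (nhds u) := by
  have hlim : Tendsto (fun N : ℕ => T / ((N : ℝ) + 1)) atTop (nhds 0) := by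
    simpa [div_eq_mul_inv] using (tendsto_one_div_add_atTop_nhds_zero_nat (𝕜 := ℝ)).const_mul T
  rw [tendsto_iff_norm_sub_tendsto_zero]
  exact squeeze_zero (fun _ => norm_nonneg _) (fun N => abs_cellPoint_cellIndex_sub_le hu) hlim

theorem tendsto_integral_sampledMinor (hs : -(1 / 2 : ℝ) < s.re) (ht : 0 < t) {C : ℝ}
    (hC : ∀ u ∈ Icc 0 (2 / t), ∀ v ∈ Icc 0 (2 / t), waveConst s * ‖waveKernel s u v‖ ≤ C) (n : ℕ) :
    Tendsto (fun N => ∫ x : Fin n → ℝ, (∏ i, (gaugeWeight s (x i) : ℂ)) *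
        sampledMinor s (2 / t) N n x ∂(Measure.pi fun _ => volume.restrict (Ioi t))) atTop
      (nhds (∫ x : Fin n → ℝ, (∏ i, (gaugeWeight s (x i) : ℂ)) * waveMinor s (fun i => 2 / x i)
        ∂(Measure.pi fun _ => volume.restrict (Ioi t)))) := by
  have hT : 0 < 2 / t := by positivity
  have hgm := measurable_gaugeWeight s
  refine tendsto_integral_of_dominated_convergence
    (fun x => C ^ n * ∏ i, gaugeWeight s (x i)) (fun N => ?_)
    ((integrable_prod_gaugeWeight hs ht n).const_mul _) (fun N => Eventually.of_forall fun x => ?_)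
    ?_
  · have h1 : Measurable fun x : Fin n → ℝ => ∏ i, (gaugeWeight s (x i) : ℂ) := by fun_prop
    have h2 : Measurable fun x : Fin n → ℝ => cellPoint (2 / t) N ∘ (invCellIndex (2 / t) N ∘ x) :=
      measurable_pi_lambda _ fun i => (Measurable.of_discrete (f := cellPoint (2 / t) N)).comp
        ((measurable_invCellIndex _ N).comp (measurable_pi_apply i))
    exact (h1.mul ((continuous_waveMinor hs n).measurable.comp h2)).aestronglyMeasurable
  · exact norm_prod_gaugeWeight_mul_le x (norm_waveMinor_le hs hC fun i => cellPoint_mem hT _)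
  · filter_upwards [ae_pi_Ioi t n] with x hx
    refine Tendsto.const_mul _ (((continuous_waveMinor hs n).tendsto _).comp ?_)
    exact tendsto_pi_nhds.mpr fun i => tendsto_cellPoint_cellIndex (two_div_mem_Ioo ht (hx i))

theorem norm_integral_prod_gaugeWeight_mul_le (hs : -(1 / 2 : ℝ) < s.re) (ht : 0 < t) {C : ℝ}
    {n : ℕ} {F : (Fin n → ℝ) → ℂ} (hF : ∀ x : Fin n → ℝ, (∀ i, x i ∈ Ioi t) → ‖F x‖ ≤ C ^ n) :
    ‖∫ x : Fin n → ℝ, (∏ i, (gaugeWeight s (x i) : ℂ)) * F x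
      ∂(Measure.pi fun _ => volume.restrict (Ioi t))‖ ≤
      (C * ∫ x in Ioi t, gaugeWeight s x) ^ n := by
  have h : (C * ∫ x in Ioi t, gaugeWeight s x) ^ n = ∫ x : Fin n → ℝ,
      C ^ n * ∏ i, gaugeWeight s (x i) ∂(Measure.pi fun _ => volume.restrict (Ioi t)) := by
    rw [integral_const_mul, integral_fintype_prod_eq_prod, mul_pow]
    simp
  rw [h]
  refine norm_integral_le_of_norm_le ((integrable_prod_gaugeWeight hs ht n).const_mul _) ?_
  filter_upwards [ae_pi_Ioi t n] with x hx using norm_prod_gaugeWeight_mul_le x (hF x hx)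

theorem norm_neg_one_pow_div_factorial_mul_le {z : ℂ} {r : ℝ} {n : ℕ} (hz : ‖z‖ ≤ r ^ n) :
    ‖((-1) ^ n / (n.factorial : ℂ)) * z‖ ≤ r ^ n / n.factorial := by
  rw [norm_mul, norm_div, norm_pow, norm_neg, norm_one, one_pow, Complex.norm_natCast,
    one_div_mul_eq_div]
  gcongr

theorem tendsto_det_one_sub_waveGram (hs : -(1 / 2 : ℝ) < s.re) (ht : 0 < t) :
    Tendsto (fun N => (1 - waveGram s (fun i => √(cellMass s (2 / t) N i))
      (cellPoint (2 / t) N)).det) atTop (nhds (fredholmDet (Kinf s) t : ℂ)) := by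
  have hT : 0 < 2 / t := by positivity
  obtain ⟨C, -, hC⟩ := exists_norm_waveKernel_le hs (2 / t)
  set J : ℕ → ℂ := fun n => ∫ x : Fin n → ℝ, (∏ i, (gaugeWeight s (x i) : ℂ)) *
    waveMinor s (fun i => 2 / x i) ∂(Measure.pi fun _ => volume.restrict (Ioi t)) with hJ
  have hsum := Real.summable_pow_div_factorial (C * ∫ x in Ioi t, gaugeWeight s x)
  have hJb : ∀ n, ‖((-1) ^ n / (n.factorial : ℂ)) * J n‖ ≤
      (C * ∫ x in Ioi t, gaugeWeight s x) ^ n / n.factorial := fun n =>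
    norm_neg_one_pow_div_factorial_mul_le (norm_integral_prod_gaugeWeight_mul_le hs ht fun x hx =>
      norm_waveMinor_le hs hC fun i => Ioo_subset_Icc_self (two_div_mem_Ioo ht (hx i)))
  have hJi : ∀ n, J n = ((∫ x : Fin n → ℝ in univ.pi fun _ => Ioi t,
      rhoK (Kinf s) n x : ℝ) : ℂ) := by
    intro n
    rw [← integral_complex_ofReal, volume_pi, Measure.restrict_pi_pi]
    refine integral_congr_ae ?_
    filter_upwards [ae_pi_Ioi t n] with x hx
    rw [ofReal_rhoK hs fun i => ht.trans (hx i)]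
  have hJ0 : J 0 = 1 := by
    simp [hJ, waveMinor, measureReal_def]
  have hD : (fredholmDet (Kinf s) t : ℂ) = ∑' n, ((-1) ^ n / (n.factorial : ℂ)) * J n := by
    rw [(Summable.of_norm_bounded hsum hJb).tsum_eq_zero_add, hJ0, fredholmDet]
    push_cast
    simp_rw [hJi]
    simp
  rw [hD]
  simp_rw [← fun N => (hasSum_det_one_sub_waveGram s (fun i => √(cellMass s (2 / t) N i))
    (cellPoint (2 / t) N)).tsum_eq, ← integral_sampledMinor hs ht]
  refine tendsto_tsum_of_dominated_convergence hsum
    (fun n => (tendsto_integral_sampledMinor hs ht hC n).const_mul _)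
    (Eventually.of_forall fun N n => ?_)
  exact norm_neg_one_pow_div_factorial_mul_le (norm_integral_prod_gaugeWeight_mul_le hs ht
    fun x _ => norm_waveMinor_le hs hC fun i => cellPoint_mem hT _)

theorem fredholmDet_Kinf_pos (hs : -(1 / 2 : ℝ) < s.re) (ht : 0 < t) :
    0 < fredholmDet (Kinf s) t := by
  have hT : 0 < 2 / t := by positivity
  obtain ⟨C, -, hC⟩ := exists_norm_waveKernel_le hs (2 / t)
  obtain ⟨δ, hδ, hev⟩ := exists_eventually_star_dotProduct_waveGram_le hs hT
  have hlim : Tendsto (fun N => (1 - waveGram s (fun i => √(cellMass s (2 / t) N i))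
      (cellPoint (2 / t) N)).det.re) atTop (nhds (fredholmDet (Kinf s) t)) :=
    (Complex.continuous_re.tendsto _).comp (tendsto_det_one_sub_waveGram hs ht)
  refine (Real.exp_pos (-((powMeasure s).real (Ioo 0 (2 / t)) * C / δ))).trans_le
    (ge_of_tendsto hlim ?_)
  filter_upwards [hev] with N hN
  refine le_trans ?_ (exp_neg_trace_div_le_det_one_sub (isHermitian_waveGram s _ _)
    (star_dotProduct_waveGram_nonneg hs _ _) hδ hN)
  have hm : ∀ i, 0 ≤ cellMass s (2 / t) N i := fun i => measureReal_nonneg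
  have htr : (waveGram s (fun i => √(cellMass s (2 / t) N i)) (cellPoint (2 / t) N)).trace.re ≤
      (powMeasure s).real (Ioo 0 (2 / t)) * C := by
    rw [← sum_cellMass hs, Finset.sum_mul, Matrix.trace, Complex.re_sum]
    refine Finset.sum_le_sum fun i _ => ?_
    rw [Matrix.diag_apply, waveGram, Matrix.of_apply, ← mul_assoc, ← Complex.ofReal_mul,
      Real.mul_self_sqrt (hm i), Complex.re_ofReal_mul]
    refine mul_le_mul_of_nonneg_left ?_ (hm i)
    refine (Complex.re_le_norm _).trans ?_
    rw [norm_mul, Complex.norm_real, Real.norm_of_nonneg (waveConst_pos hs).le]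
    exact hC _ (cellPoint_mem hT i) _ (cellPoint_mem hT i)
  gcongr

end

/-- For `Re(s) > −1/2`, the Fredholm determinant `F_∞` of the limiting
kernel `K_∞` restricted to `(0,∞)²` satisfies `F_∞(t) ≠ 0` for every `t > 0`. -/
theorem fredholmDet_Kinf_ne_zero (s : ℂ) (hs : -(1 / 2 : ℝ) < s.re) :
    ∀ t : ℝ, 0 < t → fredholmDet (Kinf s) t ≠ 0 :=
  fun _ ht => (fredholmDet_Kinf_pos hs ht).ne'
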